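/- For every ranked alphabet Σ, the union over all k ≥ 1 of the families NPTWA^k of tree languages accepted by nondeterministic k-head tree-walking automata with nested pebbles is closed under complement; consequently it equals the union over all k of FO+TC^k, and it also equals the union over all k of the families NTWA^k of tree languages accepted by nondeterministic k-head tree-walking automata without pebbles. -/

import Mathlib

namespace NestedPebbles

/-- Trees over a ranked alphabet `(Sig, rank)`: terms `σ(t₁,…,tₙ)` with `rank σ = n`. -/
inductive RTree (Sig : Type) (rank : Sig → ℕ) : Type
  | node (a : Sig) (children : Fin (rank a) → RTree Sig rank) : RTree Sig rank

namespace RTree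

variable {Sig : Type} {rank : Sig → ℕ}

/-- The label of the root symbol. -/
def label : RTree Sig rank → Sig
  | node a _ => a

/-- The `i`-th (0-based) immediate subtree, if it exists. -/
def child : RTree Sig rank → ℕ → Option (RTree Sig rank)
  | node a c, i => if h : i < rank a then some (c ⟨i, h⟩) else none

/-- The subtree at a position (a list of 0-based child indices, read from the root). -/
def subtree : RTree Sig rank → List ℕ → Option (RTree Sig rank)
  | t, [] => some t
  | t, i :: p => (t.child i).bind fun s => s.subtree p

end RTree

variable {Sig : Type} {rank : Sig → ℕ}

/-- `p` is (the address of) a node of `t`. -/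
def IsPos (t : RTree Sig rank) (p : List ℕ) : Prop := (t.subtree p).isSome = true

/-- The type of nodes of a tree `t`, as valid positions. -/
def Pos (t : RTree Sig rank) : Type := { p : List ℕ // IsPos t p }

/-- The root node. -/
def rootPos (t : RTree Sig rank) : Pos t := ⟨[], rfl⟩

/-- The label of the node of `t` at position `p`. -/
def labelAt (t : RTree Sig rank) (p : List ℕ) : Option Sig := (t.subtree p).map RTree.label

/-- The child number of a node: `0` for the root, and `j` for a `j`-th child (1-based). -/
def childNo (p : List ℕ) : ℕ :=
  match p.getLast? with
  | none => 0
  | some j => j + 1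

/-!  ### First-order logic with k-ary transitive closure, on trees  -/

/-- First-order formulas over a ranked alphabet, with a `k`-ary transitive closure
operator.  Variables are natural numbers.  `lab a x` means `x` has label `a`;
`edg i x y` means `y` is the `i`-th child of `x` (`i` is 1-based);
`le x y` means `x` is an ancestor of `y`; `tc xs ys φ us vs` is the transitive
closure `φ*` of `φ` with respect to the tuples of variables `xs`, `ys` (which it
binds), applied to the tuples of variables `us`, `vs`. -/
inductive TForm (Sig : Type) (rank : Sig → ℕ) (k : ℕ) : Type
  | lab (a : Sig) (x : ℕ)
  | edg (i : ℕ) (x y : ℕ)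
  | le (x y : ℕ)
  | eq (x y : ℕ)
  | not (φ : TForm Sig rank k)
  | and (φ ψ : TForm Sig rank k)
  | or (φ ψ : TForm Sig rank k)
  | ex (x : ℕ) (φ : TForm Sig rank k)
  | all (x : ℕ) (φ : TForm Sig rank k)
  | tc (xs ys : Fin k → ℕ) (φ : TForm Sig rank k) (us vs : Fin k → ℕ)

/-- Update a valuation on a tuple of variables simultaneously. -/
noncomputable def updVec {α : Type} {k : ℕ} (ν : ℕ → α) (xs : Fin k → ℕ) (a : Fin k → α) :
    ℕ → α :=
  fun n => if h : ∃ i, xs i = n then a h.choose else ν n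

/-- Satisfaction of a formula in a tree `t` under a valuation of the variables by
nodes of `t`. -/
def Sat {k : ℕ} (t : RTree Sig rank) : TForm Sig rank k → (ℕ → Pos t) → Prop
  | .lab a x, ν => labelAt t (ν x).1 = some a
  | .edg i x y, ν => 1 ≤ i ∧ (ν y).1 = (ν x).1 ++ [i - 1]
  | .le x y, ν => (ν x).1 <+: (ν y).1
  | .eq x y, ν => ν x = ν y
  | .not φ, ν => ¬ Sat t φ ν
  | .and φ ψ, ν => Sat t φ ν ∧ Sat t ψ ν
  | .or φ ψ, ν => Sat t φ ν ∨ Sat t ψ ν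
  | .ex x φ, ν => ∃ u : Pos t, Sat t φ (Function.update ν x u)
  | .all x φ, ν => ∀ u : Pos t, Sat t φ (Function.update ν x u)
  | .tc xs ys φ us vs, ν =>
      Relation.ReflTransGen
        (fun a b : Fin k → Pos t => Sat t φ (updVec (updVec ν xs a) ys b))
        (fun i => ν (us i)) (fun i => ν (vs i))

/-- The free variables of a formula. -/
def freeVars {k : ℕ} : TForm Sig rank k → Set ℕ
  | .lab _ x => {x}
  | .edg _ x y => {x, y}
  | .le x y => {x, y}
  | .eq x y => {x, y}
  | .not φ => freeVars φ
  | .and φ ψ => freeVars φ ∪ freeVars ψ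
  | .or φ ψ => freeVars φ ∪ freeVars ψ
  | .ex x φ => freeVars φ \ {x}
  | .all x φ => freeVars φ \ {x}
  | .tc xs ys φ us vs =>
      (freeVars φ \ (Set.range xs ∪ Set.range ys)) ∪ Set.range us ∪ Set.range vs

/-- Two `k`-tuples of variables consist of `2k` pairwise distinct variables. -/
def Distinct2 {k : ℕ} (xs ys : Fin k → ℕ) : Prop :=
  Function.Injective xs ∧ Function.Injective ys ∧ ∀ i j, xs i ≠ ys j

/-- `φ` is functional in the tuples of variables `xs`, `ys`: for every tree, every
valuation of the remaining variables, and every value of `xs`, there is at most one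
value of `ys` satisfying `φ`. -/
def FunctionalIn {k : ℕ} (φ : TForm Sig rank k) (xs ys : Fin k → ℕ) : Prop :=
  ∀ (t : RTree Sig rank) (ν : ℕ → Pos t) (a b b' : Fin k → Pos t),
    Sat t φ (updVec (updVec ν xs a) ys b) →
    Sat t φ (updVec (updVec ν xs a) ys b') → b = b'

/-- Well-formedness: in each transitive closure the `2k` bound variables are
pairwise distinct and occur free in the body. -/
def WF {k : ℕ} : TForm Sig rank k → Prop
  | .not φ => WF φ
  | .and φ ψ => WF φ ∧ WF ψ
  | .or φ ψ => WF φ ∧ WF ψ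
  | .ex _ φ => WF φ
  | .all _ φ => WF φ
  | .tc xs ys φ _ _ =>
      Distinct2 xs ys ∧ (Set.range xs ∪ Set.range ys) ⊆ freeVars φ ∧ WF φ
  | _ => True

/-- All transitive closures occurring in the formula are deterministic, i.e., applied
to functional formulas. -/
def DetTC {k : ℕ} : TForm Sig rank k → Prop
  | .not φ => DetTC φ
  | .and φ ψ => DetTC φ ∧ DetTC ψ
  | .or φ ψ => DetTC φ ∧ DetTC ψ
  | .ex _ φ => DetTC φ
  | .all _ φ => DetTC φ
  | .tc xs ys φ _ _ => FunctionalIn φ xs ys ∧ DetTC φ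
  | _ => True

/-- All occurrences of transitive closure are positive (within the scope of an even
number of negations); the polarity parameter `b` is `true` for an even number. -/
def PosTC {k : ℕ} : Bool → TForm Sig rank k → Prop
  | b, .not φ => PosTC (!b) φ
  | b, .and φ ψ => PosTC b φ ∧ PosTC b ψ
  | b, .or φ ψ => PosTC b φ ∧ PosTC b ψ
  | b, .ex _ φ => PosTC b φ
  | b, .all _ φ => PosTC b φ
  | b, .tc _ _ φ _ _ => b = true ∧ PosTC b φ
  | _, _ => True

/-- The formula contains no transitive closure operator (pure first-order). -/
def TCFree {k : ℕ} : TForm Sig rank k → Prop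
  | .not φ => TCFree φ
  | .and φ ψ => TCFree φ ∧ TCFree ψ
  | .or φ ψ => TCFree φ ∧ TCFree ψ
  | .ex _ φ => TCFree φ
  | .all _ φ => TCFree φ
  | .tc _ _ _ _ _ => False
  | _ => True

/-- The tree language defined by a (closed) formula. -/
def treesOf {k : ℕ} (φ : TForm Sig rank k) : Set (RTree Sig rank) :=
  {t | Sat t φ fun _ => rootPos t}

/-- `FO+DTC^k`: tree languages definable by closed first-order formulas with `k`-ary
deterministic transitive closure. -/
def FODTC (Sig : Type) (rank : Sig → ℕ) (k : ℕ) : Set (Set (RTree Sig rank)) :=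
  {L | ∃ φ : TForm Sig rank k, WF φ ∧ DetTC φ ∧ freeVars φ = ∅ ∧ L = treesOf φ}

/-- `FO+TC^k`: tree languages definable by closed first-order formulas with `k`-ary
transitive closure. -/
def FOTC (Sig : Type) (rank : Sig → ℕ) (k : ℕ) : Set (Set (RTree Sig rank)) :=
  {L | ∃ φ : TForm Sig rank k, WF φ ∧ freeVars φ = ∅ ∧ L = treesOf φ}

/-- `FO+posTC^k`: tree languages definable by closed first-order formulas in which
every occurrence of the `k`-ary transitive closure operator is positive. -/
def FOposTC (Sig : Type) (rank : Sig → ℕ) (k : ℕ) : Set (Set (RTree Sig rank)) :=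
  {L | ∃ φ : TForm Sig rank k, WF φ ∧ PosTC true φ ∧ freeVars φ = ∅ ∧ L = treesOf φ}

/-!  ### k-head tree-walking automata with nested pebbles  -/

/-- Tests of a `k`-head tree-walking automaton with pebble set `X`:
label of the node under head `i`, presence of pebble `x` at head `i`, and
child number of the node under head `i`. -/
inductive TTest (Sig : Type) (k : ℕ) (X : Type) : Type
  | lab (i : Fin k) (a : Sig)
  | peb (i : Fin k) (x : X)
  | chno (i : Fin k) (j : ℕ)

/-- Instructions: move head `i` up / down to the `j`-th child (1-based), drop a
pebble at head `i`, retrieve the most recently dropped pebble (from a distance),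
or perform a positive (`b = true`) or negated (`b = false`) test. -/
inductive TInstr (Sig : Type) (k : ℕ) (X : Type) : Type
  | up (i : Fin k)
  | down (i : Fin k) (j : ℕ)
  | dropPeb (i : Fin k) (x : X)
  | retrieve (x : X)
  | test (b : Bool) (τ : TTest Sig k X)

/-- A `k`-head tree-walking automaton with nested pebbles: a finite state set `Q`,
a finite pebble set `X`, an initial state, accepting states, and a finite set of
instructions `⟨p, χ, q⟩`. -/
structure TWA (Sig : Type) (rank : Sig → ℕ) (k : ℕ) : Type 1 where
  Q : Type
  finQ : Fintype Q
  X : Type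
  finX : Fintype X
  q0 : Q
  acc : Set Q
  instr : Set (Q × TInstr Sig k X × Q)
  instrFin : instr.Finite

/-- Configurations: a state, the positions of the `k` heads, and the stack of
dropped pebbles with their positions (most recent first). -/
abbrev TConf {Sig : Type} {rank : Sig → ℕ} {k : ℕ} (A : TWA Sig rank k)
    (t : RTree Sig rank) : Type :=
  A.Q × (Fin k → Pos t) × List (A.X × Pos t)

/-- Semantics of tests. -/
def testHolds {k : ℕ} (t : RTree Sig rank) {X : Type} (τ : TTest Sig k X)
    (hs : Fin k → Pos t) (π : List (X × Pos t)) : Prop :=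
  match τ with
  | .lab i a => labelAt t (hs i).1 = some a
  | .peb i x => (x, hs i) ∈ π
  | .chno i j => childNo (hs i).1 = j

/-- Semantics of a single instruction, relating head positions and pebble stacks
before and after. -/
def instrStep {k : ℕ} (t : RTree Sig rank) {X : Type} (ins : TInstr Sig k X)
    (hs : Fin k → Pos t) (π : List (X × Pos t))
    (hs' : Fin k → Pos t) (π' : List (X × Pos t)) : Prop :=
  match ins with
  | .up i => π' = π ∧ (∃ j : ℕ, (hs i).1 = (hs' i).1 ++ [j]) ∧ ∀ h, h ≠ i → hs' h = hs h
  | .down i j => π' = π ∧ 1 ≤ j ∧ (hs' i).1 = (hs i).1 ++ [j - 1] ∧ ∀ h, h ≠ i → hs' h = hs h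
  | .dropPeb i x => hs' = hs ∧ π' = (x, hs i) :: π ∧ ∀ w, (x, w) ∉ π
  | .retrieve x => hs' = hs ∧ ∃ w, π = (x, w) :: π'
  | .test b τ => hs' = hs ∧ π' = π ∧ (testHolds t τ hs π ↔ b = true)

/-- The step relation of automaton `A` on tree `t`. -/
def Step {k : ℕ} (A : TWA Sig rank k) (t : RTree Sig rank) :
    TConf A t → TConf A t → Prop :=
  fun c c' => ∃ ins : TInstr Sig k A.X,
    (c.1, ins, c'.1) ∈ A.instr ∧ instrStep t ins c.2.1 c.2.2 c'.2.1 c'.2.2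

/-- `χ'` is the negation of the test `χ`. -/
def negOf {k : ℕ} {X : Type} (χ χ' : TInstr Sig k X) : Prop :=
  ∃ b τ, χ = TInstr.test b τ ∧ χ' = TInstr.test (!b) τ

/-- Determinism: any two distinct instructions with the same source state consist
of a test and its negation. -/
def Deterministic {k : ℕ} (A : TWA Sig rank k) : Prop :=
  ∀ p χ₁ q₁ χ₂ q₂, (p, χ₁, q₁) ∈ A.instr → (p, χ₂, q₂) ∈ A.instr →
    (χ₁, q₁) ≠ (χ₂, q₂) → negOf χ₁ χ₂ ∨ negOf χ₂ χ₁

/-- The initial configuration: initial state, all heads at the root, no pebbles. -/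
def initConf {k : ℕ} (A : TWA Sig rank k) (t : RTree Sig rank) : TConf A t :=
  (A.q0, fun _ => rootPos t, [])

/-- A configuration is halting if no step is possible from it. -/
def HaltingConf {k : ℕ} (A : TWA Sig rank k) (t : RTree Sig rank) (c : TConf A t) : Prop :=
  ∀ c', ¬ Step A t c c'

/-- Acceptance: some computation from the initial configuration halts in an
accepting state with all heads at the root and no pebbles on the tree. -/
def Accepts {k : ℕ} (A : TWA Sig rank k) (t : RTree Sig rank) : Prop :=
  ∃ q ∈ A.acc,
    Relation.ReflTransGen (Step A t) (initConf A t) (q, fun _ => rootPos t, []) ∧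
    HaltingConf A t (q, fun _ => rootPos t, [])

/-- The tree language accepted by `A`. -/
def Lang {k : ℕ} (A : TWA Sig rank k) : Set (RTree Sig rank) := {t | Accepts A t}

/-- The automaton uses no pebbles at all. -/
def PebbleFree {k : ℕ} (A : TWA Sig rank k) : Prop :=
  ∀ p χ q, (p, χ, q) ∈ A.instr →
    (∀ i x, χ ≠ TInstr.dropPeb i x) ∧ (∀ x, χ ≠ TInstr.retrieve x) ∧
    (∀ b i x, χ ≠ TInstr.test b (TTest.peb i x))

/-- `DPTWA^k`: tree languages accepted by deterministic `k`-head tree-walking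
automata with nested pebbles. -/
def DPTWA (Sig : Type) (rank : Sig → ℕ) (k : ℕ) : Set (Set (RTree Sig rank)) :=
  {L | ∃ A : TWA Sig rank k, Deterministic A ∧ L = Lang A}

/-- `NPTWA^k`: tree languages accepted by nondeterministic `k`-head tree-walking
automata with nested pebbles. -/
def NPTWA (Sig : Type) (rank : Sig → ℕ) (k : ℕ) : Set (Set (RTree Sig rank)) :=
  {L | ∃ A : TWA Sig rank k, L = Lang A}

/-- `NTWA^k`: tree languages accepted by nondeterministic `k`-head tree-walking
automata without pebbles. -/
def NTWA (Sig : Type) (rank : Sig → ℕ) (k : ℕ) : Set (Set (RTree Sig rank)) :=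
  {L | ∃ A : TWA Sig rank k, PebbleFree A ∧ L = Lang A}

end NestedPebbles

namespace NestedPebbles

section Basics
variable {Sig : Type} {rank : Sig → ℕ}

theorem subtree_append (t : RTree Sig rank) (p q : List ℕ) :
    t.subtree (p ++ q) = (t.subtree p).bind (fun s => s.subtree q) := by
  induction p generalizing t with
  | nil => simp [RTree.subtree]
  | cons i p ih =>
    simp only [List.cons_append, RTree.subtree]
    cases t.child i with
    | none => rfl
    | some s => simp [ih]

theorem isPos_left {t : RTree Sig rank} {p q : List ℕ} (h : IsPos t (p ++ q)) : IsPos t p := by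
  unfold IsPos at *
  rw [subtree_append] at h
  cases hs : t.subtree p with
  | none => simp [hs] at h
  | some s => rfl

theorem child_isSome (t : RTree Sig rank) (i : ℕ) : (t.child i).isSome = true ↔ i < rank t.label := by
  cases t with
  | node a c => 
    simp only [RTree.child, RTree.label]
    split <;> simp_all

theorem isPos_snoc {t : RTree Sig rank} {p : List ℕ} {j : ℕ} :
    IsPos t (p ++ [j]) ↔ ∃ s, t.subtree p = some s ∧ j < rank s.label := by
  unfold IsPos
  rw [subtree_append]
  cases hs : t.subtree p with
  | none => simp
  | some s =>
    simp only [Option.bind_some, RTree.subtree, Option.some.injEq, exists_eq_left', ← child_isSome]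
    cases s.child j <;> simp

theorem isPos_snoc_lab {t : RTree Sig rank} {p : List ℕ} {j : ℕ} :
    IsPos t (p ++ [j]) ↔ ∃ a, labelAt t p = some a ∧ j < rank a := by
  rw [isPos_snoc]
  unfold labelAt
  cases hs : t.subtree p <;> simp

theorem labelAt_pos {t : RTree Sig rank} (p : Pos t) : ∃ a, labelAt t p.1 = some a := by
  have := p.2
  unfold IsPos at this
  unfold labelAt
  cases hs : t.subtree p.1 with
  | none => simp [hs] at this
  | some s => simp

/-- The maximal rank. -/
def maxRank (Sig : Type) [Fintype Sig] (rank : Sig → ℕ) : ℕ := Finset.univ.sup rank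

theorem isPos_lt [Fintype Sig] {t : RTree Sig rank} {p : List ℕ} {j : ℕ}
    (h : IsPos t (p ++ [j])) : j < maxRank Sig rank := by
  obtain ⟨a, _, ha⟩ := isPos_snoc_lab.1 h
  exact lt_of_lt_of_le ha (Finset.le_sup (f := rank) (Finset.mem_univ a))

theorem childNo_nil : childNo [] = 0 := rfl
theorem childNo_snoc (p : List ℕ) (j : ℕ) : childNo (p ++ [j]) = j + 1 := by
  simp [childNo]

theorem childNo_eq_zero {p : List ℕ} : childNo p = 0 ↔ p = [] := by
  rcases List.eq_nil_or_concat p with rfl | ⟨q, j, rfl⟩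
  · simp [childNo]
  · simp [childNo]

theorem childNo_eq_succ {p : List ℕ} {j : ℕ} : childNo p = j + 1 ↔ ∃ q, p = q ++ [j] := by
  rcases List.eq_nil_or_concat p with rfl | ⟨q, j', rfl⟩
  · simp [childNo]
  · simp [childNo]

/-- Constructor for nodes. -/
def mkPos (t : RTree Sig rank) (p : List ℕ) (h : IsPos t p) : Pos t := ⟨p, h⟩

@[simp] theorem mkPos_val (t : RTree Sig rank) (p : List ℕ) (h : IsPos t p) :
    (mkPos t p h).1 = p := rfl

theorem pos_ext {t : RTree Sig rank} {p q : Pos t} (h : p.1 = q.1) : p = q := Subtype.ext h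

theorem childNo_root_iff {t : RTree Sig rank} {p : Pos t} : childNo p.1 = 0 ↔ p = rootPos t := by
  rw [childNo_eq_zero]
  constructor
  · intro h; exact pos_ext h
  · rintro rfl; rfl

end Basics

/-- Basic actions on heads numbered by natural numbers. -/
inductive Act (Sig : Type) : Type
  | up (i : ℕ)
  | down (i j : ℕ)
  | lab (i : ℕ) (a : Sig)
  | chno (i j : ℕ)

/-- Regular programs. -/
inductive Prog (Sig : Type) : Type
  | fail
  | act (a : Act Sig)
  | seq (p q : Prog Sig)
  | alt (p q : Prog Sig)
  | star (p : Prog Sig)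

section Sem
variable {Sig : Type} {rank : Sig → ℕ}

def Act.sem (t : RTree Sig rank) : Act Sig → (ℕ → Pos t) → (ℕ → Pos t) → Prop
  | .up i, h, h' => (∃ j : ℕ, (h i).1 = (h' i).1 ++ [j]) ∧ ∀ x, x ≠ i → h' x = h x
  | .down i j, h, h' => 1 ≤ j ∧ (h' i).1 = (h i).1 ++ [j - 1] ∧ ∀ x, x ≠ i → h' x = h x
  | .lab i a, h, h' => h' = h ∧ labelAt t (h i).1 = some a
  | .chno i j, h, h' => h' = h ∧ childNo (h i).1 = j

def Prog.sem (t : RTree Sig rank) : Prog Sig → (ℕ → Pos t) → (ℕ → Pos t) → Prop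
  | .fail, _, _ => False
  | .act a, h, h' => a.sem t h h'
  | .seq p q, h, h' => ∃ m, p.sem t h m ∧ q.sem t m h'
  | .alt p q, h, h' => p.sem t h h' ∨ q.sem t h h'
  | .star p, h, h' => Relation.ReflTransGen (fun x y => p.sem t x y) h h'

def Prog.skip : Prog Sig := .star .fail

theorem sem_skip (t : RTree Sig rank) (h h' : ℕ → Pos t) :
    (Prog.skip).sem t h h' ↔ h' = h := by
  constructor
  · intro H
    simp only [Prog.skip, Prog.sem] at H
    induction H with
    | refl => rfl
    | tail _ h _ => exact h.elim
  · rintro rfl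
    exact Relation.ReflTransGen.refl

def Prog.anyOf (F : ℕ → Prog Sig) : ℕ → Prog Sig
  | 0 => .fail
  | n + 1 => .alt (Prog.anyOf F n) (F n)

theorem sem_anyOf (t : RTree Sig rank) (F : ℕ → Prog Sig) (n : ℕ) (h h' : ℕ → Pos t) :
    (Prog.anyOf F n).sem t h h' ↔ ∃ j < n, (F j).sem t h h' := by
  induction n with
  | zero => simp [Prog.anyOf, Prog.sem]
  | succ n ih =>
    simp only [Prog.anyOf, Prog.sem, ih, Nat.lt_succ_iff_lt_or_eq]
    constructor
    · rintro (⟨j, hj, H⟩ | H)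
      · exact ⟨j, Or.inl hj, H⟩
      · exact ⟨n, Or.inr rfl, H⟩
    · rintro ⟨j, hj | rfl, H⟩
      · exact Or.inl ⟨j, hj, H⟩
      · exact Or.inr H

/-- Run a family of programs for all the elements of a list. -/
def Prog.each (F : ℕ → Prog Sig) : List ℕ → Prog Sig
  | [] => .skip
  | y :: ys => .seq (F y) (Prog.each F ys)

def Prog.rootify (i : ℕ) : Prog Sig := .seq (.star (.act (.up i))) (.act (.chno i 0))

theorem star_up (t : RTree Sig rank) (i : ℕ) (l : List ℕ) (h : ℕ → Pos t) (hl : (h i).1 = l) :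
    (Prog.star (.act (.up i))).sem t h (Function.update h i (rootPos t)) := by
  induction l using List.reverseRecOn generalizing h with
  | nil =>
    have : Function.update h i (rootPos t) = h := by
      rw [Function.update_eq_self_iff]
      exact pos_ext hl.symm
    rw [this]
    exact Relation.ReflTransGen.refl
  | append_singleton p j ih =>
    have hp : IsPos t p := isPos_left (q := [j]) (hl ▸ (h i).2)
    have := ih (Function.update h i (mkPos t p hp)) (by simp)
    rw [Function.update_idem] at this
    refine Relation.ReflTransGen.head ?_ this
    refine ⟨⟨j, by simp [hl]⟩, fun x hx => by simp [hx]⟩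

theorem sem_rootify (t : RTree Sig rank) (i : ℕ) (h h' : ℕ → Pos t) :
    (Prog.rootify i).sem t h h' ↔ h' i = rootPos t ∧ ∀ x, x ≠ i → h' x = h x := by
  constructor
  · rintro ⟨m, h1, h2, h3⟩
    subst h2
    refine ⟨childNo_root_iff.1 h3, ?_⟩
    clear h3
    induction h1 with
    | refl => simp
    | tail _ hs ih => 
      intro x hx
      rw [hs.2 x hx, ih x hx]
  · rintro ⟨h1, h2⟩
    have : h' = Function.update h i (rootPos t) := by
      funext x
      by_cases hx : x = i
      · subst hx; simp [h1]
      · simp [hx, h2 x hx]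
    subst this
    exact ⟨_, star_up t i _ h rfl, rfl, by rw [Function.update_self]; rfl⟩

theorem sem_roots (t : RTree Sig rank) (ys : List ℕ) (h h' : ℕ → Pos t) :
    (Prog.each Prog.rootify ys).sem t h h' ↔
      (∀ y ∈ ys, h' y = rootPos t) ∧ ∀ x, x ∉ ys → h' x = h x := by
  induction ys generalizing h with
  | nil => 
    simp only [Prog.each, sem_skip]
    simp [funext_iff]
  | cons y ys ih =>
    simp only [Prog.each, Prog.sem, ih, sem_rootify]
    constructor
    · rintro ⟨m, ⟨h1, h2⟩, h3, h4⟩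
      refine ⟨?_, ?_⟩
      · intro z hz
        by_cases hz' : z ∈ ys
        · exact h3 z hz'
        · rw [h4 z hz']
          have : z = y := by simp_all
          rw [this, h1]
      · intro x hx
        simp only [List.mem_cons, not_or] at hx
        rw [h4 x hx.2, h2 x hx.1]
    · rintro ⟨h1, h2⟩
      refine ⟨Function.update h y (rootPos t), ⟨by simp, fun x hx => by simp [hx]⟩, 
        fun z hz => h1 z (by simp [hz]), fun x hx => ?_⟩
      by_cases hxy : x = y
      · subst hxy; simp [h1]
      · simp [hxy, h2, hx]

/-- Move all heads in a list down to their `j`-th (0-based) children. -/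
def Prog.downs (ys : List ℕ) (j : ℕ) : Prog Sig := Prog.each (fun y => .act (.down y (j + 1))) ys

theorem sem_downs (t : RTree Sig rank) (ys : List ℕ) (hn : ys.Nodup) (j : ℕ) (h h' : ℕ → Pos t) :
    (Prog.downs ys j).sem t h h' ↔
      (∀ y ∈ ys, (h' y).1 = (h y).1 ++ [j]) ∧ ∀ x, x ∉ ys → h' x = h x := by
  unfold Prog.downs
  induction ys generalizing h with
  | nil => 
    simp only [Prog.each, sem_skip]
    simp [funext_iff]
  | cons y ys ih =>
    simp only [List.nodup_cons] at hn
    simp only [Prog.each, Prog.sem, ih hn.2, Act.sem]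
    constructor
    · rintro ⟨m, ⟨-, h1, h2⟩, h3, h4⟩
      refine ⟨?_, ?_⟩
      · intro z hz
        by_cases hz' : z ∈ ys
        · rw [h3 z hz', h2 z (by rintro rfl; exact hn.1 hz')]
        · rw [h4 z hz']
          have : z = y := by simp_all
          rw [this, h1]; simp
      · intro x hx
        simp only [List.mem_cons, not_or] at hx
        rw [h4 x hx.2, h2 x hx.1]
    · rintro ⟨h1, h2⟩
      refine ⟨Function.update h y (h' y), ⟨by omega, by simp [h1], fun x hx => by simp [hx]⟩, 
        fun z hz => ?_, fun x hx => ?_⟩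
      · rw [h1 z (by simp [hz]), Function.update_of_ne]
        rintro rfl; exact hn.1 hz
      by_cases hxy : x = y
      · subst hxy; simp
      · simp [hxy, h2, hx]

/-- Put all the heads in the list on one and the same, arbitrary, node. -/
def Prog.spread (M : ℕ) (ys : List ℕ) : Prog Sig :=
  .seq (Prog.each Prog.rootify ys) (.star (.anyOf (Prog.downs ys) M))

theorem sem_spread [Fintype Sig] (t : RTree Sig rank) (ys : List ℕ) (hn : ys.Nodup)
    (h h' : ℕ → Pos t) :
    (Prog.spread (maxRank Sig rank) ys).sem t h h' ↔
      ∃ u, (∀ y ∈ ys, h' y = u) ∧ ∀ x, x ∉ ys → h' x = h x := by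
  unfold Prog.spread
  simp only [Prog.sem, sem_roots, sem_anyOf, sem_downs _ _ hn]
  constructor
  · rintro ⟨m, ⟨h1, h2⟩, h3⟩
    induction h3 with
    | refl => exact ⟨_, h1, h2⟩
    | tail _ hs ih =>
      rename_i b c _
      obtain ⟨u, h3, h4⟩ := ih
      obtain ⟨j, -, h5, h6⟩ := hs
      cases ys with
      | nil => exact ⟨rootPos t, by simp, fun x hx => by rw [h6 x hx, h4 x hx]⟩
      | cons y0 ys =>
        refine ⟨c y0, fun y hy => pos_ext ?_, fun x hx => by rw [h6 x hx, h4 x hx]⟩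
        rw [h5 y hy, h5 y0 (by simp), h3 y hy, h3 y0 (by simp)]
  · rintro ⟨u, h1, h2⟩
    obtain ⟨l, hl⟩ := u
    refine ⟨fun x => if x ∈ ys then rootPos t else h x, ⟨?_, ?_⟩, ?_⟩
    · intro y hy; simp [hy]
    · intro y hy; simp [hy]
    induction l using List.reverseRecOn generalizing h' with
    | nil => 
      have : h' = (fun x => if x ∈ ys then rootPos t else h x) := by
        funext x
        by_cases hx : x ∈ ys
        · simp [hx, h1]; rfl
        · simp [hx, h2]
      rw [this]
    | append_singleton p j ih =>
      have hp : IsPos t p := isPos_left hl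
      refine Relation.ReflTransGen.tail (ih (fun x => if x ∈ ys then (mkPos t p hp) else h x) ?_ hp ?_) ?_
      · intro y hy; simp [hy]
      · intro y hy; simp [hy]; rfl
      · refine ⟨j, isPos_lt hl, ?_, ?_⟩
        · intro y hy; simp [hy, h1 y hy]
        · intro x hx; simp [hx, h2 x hx]

def Prog.guess (M : ℕ) (y : ℕ) : Prog Sig := Prog.spread M [y]

theorem sem_guess [Fintype Sig] (t : RTree Sig rank) (y : ℕ) (h h' : ℕ → Pos t) :
    (Prog.guess (maxRank Sig rank) y).sem t h h' ↔ ∀ x, x ≠ y → h' x = h x := by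
  unfold Prog.guess
  rw [sem_spread _ _ (by simp)]
  simp

theorem sem_guesses [Fintype Sig] (t : RTree Sig rank) (ys : List ℕ) (h h' : ℕ → Pos t) :
    (Prog.each (Prog.guess (maxRank Sig rank)) ys).sem t h h' ↔ ∀ x, x ∉ ys → h' x = h x := by
  induction ys generalizing h with
  | nil => 
    simp only [Prog.each, sem_skip]
    simp [funext_iff]
  | cons y ys ih =>
    simp only [Prog.each, Prog.sem, ih, sem_guess]
    constructor
    · rintro ⟨m, h1, h2⟩ x hx
      simp only [List.mem_cons, not_or] at hx
      rw [h2 x hx.2, h1 x hx.1]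
    · intro h1
      refine ⟨Function.update h y (h' y), fun x hx => by simp [hx], fun x hx => ?_⟩
      by_cases hxy : x = y
      · subst hxy; simp
      · simp [hxy, h1, hx]

/-- Compare two heads, destroying them: both end at the root. -/
def Prog.cmpUp (M : ℕ) (x a : ℕ) : Prog Sig :=
  .seq (.star (.anyOf (fun j => .seq (.act (.chno x (j + 1))) (.seq (.act (.chno a (j + 1)))
    (.seq (.act (.up x)) (.act (.up a))))) M))
    (.seq (.act (.chno x 0)) (.act (.chno a 0)))

theorem cmp_step (t : RTree Sig rank) {x a : ℕ} (hxa : x ≠ a) (j : ℕ) (h h' : ℕ → Pos t) :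
    Prog.sem t (.seq (.act (.chno x (j + 1))) (.seq (.act (.chno a (j + 1)))
      (.seq (.act (.up x)) (.act (.up a))))) h h' ↔ 
      (h x).1 = (h' x).1 ++ [j] ∧ (h a).1 = (h' a).1 ++ [j] ∧ ∀ y, y ≠ x → y ≠ a → h' y = h y := by
  simp only [Prog.sem, Act.sem]
  constructor
  · rintro ⟨_, ⟨rfl, h1⟩, _, ⟨rfl, h2⟩, m, ⟨⟨j1, h3⟩, h4⟩, ⟨j2, h5⟩, h6⟩
    rename_i h
    rw [h4 a hxa.symm] at h5
    have e1 := h6 x hxa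
    rw [h3, childNo_snoc] at h1
    rw [h5, childNo_snoc] at h2
    refine ⟨?_, ?_, fun y hy hy' => ?_⟩
    · rw [h3, e1]; simp; omega
    · rw [h5]; simp; omega
    · rw [h6 y hy', h4 y hy]
  · rintro ⟨h1, h2, h3⟩
    refine ⟨h, ⟨rfl, by rw [h1, childNo_snoc]⟩, h, ⟨rfl, by rw [h2, childNo_snoc]⟩, 
      Function.update h x (h' x), ⟨⟨j, by simp [h1]⟩, fun y hy => by simp [hy]⟩, ⟨j, ?_⟩, ?_⟩
    · rw [Function.update_of_ne hxa.symm, h2]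
    · intro y hy
      by_cases hyx : y = x
      · subst hyx; simp
      · simp [hyx, h3 y hyx hy]

theorem sem_cmpUp [Fintype Sig] (t : RTree Sig rank) {x a : ℕ} (hxa : x ≠ a) (h h' : ℕ → Pos t) :
    (Prog.cmpUp (maxRank Sig rank) x a).sem t h h' ↔
      h x = h a ∧ h' x = rootPos t ∧ h' a = rootPos t ∧ ∀ y, y ≠ x → y ≠ a → h' y = h y := by
  unfold Prog.cmpUp
  constructor
  · rintro ⟨m, h1, _, ⟨rfl, h2⟩, ⟨rfl, h3⟩⟩
    rw [childNo_root_iff] at h2 h3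
    refine ⟨?_, h2, h3, ?_⟩
    · simp only [Prog.sem] at h1
      induction h1 using Relation.ReflTransGen.head_induction_on with
      | refl => rw [h2, h3]
      | head hs _ ih =>
        rw [sem_anyOf] at hs
        obtain ⟨j, -, hs⟩ := hs
        rw [cmp_step _ hxa] at hs
        exact pos_ext (by rw [hs.1, hs.2.1, ih])
    · simp only [Prog.sem] at h1
      clear h2 h3
      induction h1 with
      | refl => simp
      | tail _ hs ih =>
        rw [sem_anyOf] at hs
        obtain ⟨j, -, hs⟩ := hs
        rw [cmp_step _ hxa] at hs
        intro y hy hy'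
        rw [hs.2.2 y hy hy', ih y hy hy']
  · rintro ⟨h1, h2, h3, h4⟩
    refine ⟨h', ?_, h', ⟨rfl, childNo_root_iff.2 h2⟩, ⟨rfl, childNo_root_iff.2 h3⟩⟩
    simp only [Prog.sem]
    obtain ⟨l, hl⟩ : ∃ l, (h x).1 = l := ⟨_, rfl⟩
    induction l using List.reverseRecOn generalizing h with
    | nil =>
      have : h' = h := by
        have hx : h x = rootPos t := pos_ext hl
        funext y
        by_cases hyx : y = x
        · rw [hyx, h2, hx]
        · by_cases hya : y = a
          · rw [hya, h3, ← h1, hx]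
          · exact h4 y hyx hya
      rw [this]
    | append_singleton p j ih =>
      have hp : IsPos t p := isPos_left (q := [j]) (hl ▸ (h x).2)
      refine Relation.ReflTransGen.head ?_ 
        (ih (Function.update (Function.update h x (mkPos t p hp)) a (mkPos t p hp)) ?_ ?_ ?_)
      · rw [sem_anyOf]
        refine ⟨j, isPos_lt (t := t) (p := p) (hl ▸ (h x).2), ?_⟩
        rw [cmp_step _ hxa]
        refine ⟨?_, ?_, ?_⟩
        · simp [hxa, hl]
        · simp [← h1, hl]
        · intro y hy hy'; simp [hy, hy']
      · simp [hxa]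
      · intro y hy hy'; simp [hy, hy', h4]
      · simp [hxa]

/-- Transfer the position of `x` to `y1` and `y2`, leaving `x` and `a` at the root. -/
def Prog.transfer (M : ℕ) (x y1 y2 a : ℕ) : Prog Sig :=
  .seq (.spread M [y1, y2, a]) (.cmpUp M x a)

theorem sem_transfer [Fintype Sig] (t : RTree Sig rank) {x y1 y2 a : ℕ} (hn : [x, y1, y2, a].Nodup)
    (h h' : ℕ → Pos t) :
    (Prog.transfer (maxRank Sig rank) x y1 y2 a).sem t h h' ↔
      h' x = rootPos t ∧ h' a = rootPos t ∧ h' y1 = h x ∧ h' y2 = h x ∧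
      ∀ y, y ≠ x → y ≠ y1 → y ≠ y2 → y ≠ a → h' y = h y := by
  have hn' : [y1, y2, a].Nodup := by simp_all
  have hxa : x ≠ a := by simp_all
  unfold Prog.transfer
  simp only [Prog.sem, sem_cmpUp _ hxa, sem_spread _ _ hn']
  simp only [List.nodup_cons, List.mem_cons, not_or] at hn
  constructor
  · rintro ⟨m, ⟨u, h1, h2⟩, h3, h4, h5, h6⟩
    have e1 := h1 y1 (by simp)
    have e2 := h1 y2 (by simp)
    have e3 := h1 a (by simp)
    have e4 := h2 x (by simp; grind)
    refine ⟨h4, h5, ?_, ?_, ?_⟩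
    · rw [h6 y1 (by grind) (by grind), e1, ← e4, h3, e3]
    · rw [h6 y2 (by grind) (by grind), e2, ← e4, h3, e3]
    · intro y hy1 hy2 hy3 hy4
      rw [h6 y hy1 hy4, h2 y (by simp; grind)]
  · rintro ⟨h1, h2, h3, h4, h5⟩
    refine ⟨fun y => if y ∈ [y1, y2, a] then h x else h y, ⟨h x, ?_, ?_⟩, ?_, h1, h2, ?_⟩
    · intro y hy; simp only [hy, if_true]
    · intro y hy; simp only [hy, if_false]
    · simp
    · intro y hy hy'
      by_cases hy1 : y = y1
      · subst hy1; simp [h3]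
      · by_cases hy2 : y = y2
        · subst hy2; simp [h4]
        · simp [hy1, hy2, hy', h5, hy]

/-- Test whether heads `x` and `y` (with `x, y < b`) are at the same node, using heads `≥ b`
as scratch. -/
def Prog.eqTest (M : ℕ) (b x y : ℕ) : Prog Sig :=
  if x = y then .skip else
  .seq (.transfer M x b (b + 1) (b + 4)) (.seq (.transfer M y (b + 2) (b + 3) (b + 4))
  (.seq (.transfer M b x (b + 5) (b + 4)) (.seq (.transfer M (b + 2) y (b + 5) (b + 4))
  (.cmpUp M (b + 1) (b + 3)))))

theorem eqTest_sound [Fintype Sig] (t : RTree Sig rank) {b x y : ℕ} (hx : x < b) (hy : y < b)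
    {h h' : ℕ → Pos t} (H : (Prog.eqTest (maxRank Sig rank) b x y).sem t h h') :
    h x = h y ∧ ∀ i < b, h' i = h i := by
  unfold Prog.eqTest at H
  split at H
  · rw [sem_skip] at H
    subst H; subst x; simp
  rename_i hxy
  obtain ⟨h1, H1, h2, H2, h3, H3, h4, H4, H5⟩ := H
  rw [sem_transfer _ (by simp; omega)] at H1 H2 H3 H4
  rw [sem_cmpUp _ (by omega)] at H5
  obtain ⟨a1, a2, a3, a4, a5⟩ := H1
  obtain ⟨b1, b2, b3, b4, b5⟩ := H2
  obtain ⟨c1, c2, c3, c4, c5⟩ := H3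
  obtain ⟨d1, d2, d3, d4, d5⟩ := H4
  obtain ⟨e1, e2, e3, e4⟩ := H5
  have k1 : h4 (b + 1) = h x := by
    rw [d5 _ (by omega) (by omega) (by omega) (by omega), 
      c5 _ (by omega) (by omega) (by omega) (by omega),
      b5 _ (by omega) (by omega) (by omega) (by omega), a4]
  have k2 : h4 (b + 3) = h y := by
    rw [d5 _ (by omega) (by omega) (by omega) (by omega), 
      c5 _ (by omega) (by omega) (by omega) (by omega),
      b4, a5 _ (by omega) (by omega) (by omega) (by omega)]
  have k3 : h4 x = h x := by
    rw [d5 _ (by omega) (by omega) (by omega) (by omega), c3,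
      b5 _ (by omega) (by omega) (by omega) (by omega), a3]
  have k4 : h4 y = h y := by
    rw [d3, c5 _ (by omega) (by omega) (by omega) (by omega), b3, 
      a5 _ (by omega) (by omega) (by omega) (by omega)]
  refine ⟨by rw [← k1, e1, k2], fun i hi => ?_⟩
  rw [e4 i (by omega) (by omega)]
  by_cases hix : i = x
  · rw [hix, k3]
  by_cases hiy : i = y
  · rw [hiy, k4]
  rw [d5 _ (by omega) (by omega) (by omega) (by omega), 
      c5 _ (by omega) (by omega) (by omega) (by omega),
      b5 _ (by omega) (by omega) (by omega) (by omega), 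
      a5 _ (by omega) (by omega) (by omega) (by omega)]

theorem transfer_total [Fintype Sig] (t : RTree Sig rank) {x y1 y2 a : ℕ}
    (hn : [x, y1, y2, a].Nodup) (h : ℕ → Pos t) :
    ∃ h', (Prog.transfer (maxRank Sig rank) x y1 y2 a).sem t h h' := by
  refine ⟨Function.update (Function.update (Function.update (Function.update h x (rootPos t)) y1
    (h x)) y2 (h x)) a (rootPos t), ?_⟩
  rw [sem_transfer t hn]
  simp only [List.nodup_cons, List.mem_cons, not_or] at hn
  refine ⟨?_, ?_, ?_, ?_, ?_⟩ <;> grind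

theorem eqTest_complete [Fintype Sig] (t : RTree Sig rank) {b x y : ℕ} (hx : x < b) (hy : y < b)
    {h : ℕ → Pos t} (H : h x = h y) :
    ∃ h', (Prog.eqTest (maxRank Sig rank) b x y).sem t h h' := by
  unfold Prog.eqTest
  split
  · exact ⟨h, (sem_skip _ _ _).2 rfl⟩
  rename_i hxy
  obtain ⟨h1, H1⟩ := transfer_total t (x := x) (y1 := b) (y2 := b + 1) (a := b + 4)
    (by simp; omega) h
  obtain ⟨h2, H2⟩ := transfer_total t (x := y) (y1 := b + 2) (y2 := b + 3) (a := b + 4)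
    (by simp; omega) h1
  obtain ⟨h3, H3⟩ := transfer_total t (x := b) (y1 := x) (y2 := b + 5) (a := b + 4)
    (by simp; omega) h2
  obtain ⟨h4, H4⟩ := transfer_total t (x := b + 2) (y1 := y) (y2 := b + 5) (a := b + 4)
    (by simp; omega) h3
  refine ⟨Function.update (Function.update h4 (b + 1) (rootPos t)) (b + 3) (rootPos t), 
    h1, H1, h2, H2, h3, H3, h4, H4, ?_⟩
  rw [sem_cmpUp _ (by omega)]
  rw [sem_transfer _ (by simp; omega)] at H1 H2 H3 H4
  obtain ⟨a1, a2, a3, a4, a5⟩ := H1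
  obtain ⟨b1, b2, b3, b4, b5⟩ := H2
  obtain ⟨c1, c2, c3, c4, c5⟩ := H3
  obtain ⟨d1, d2, d3, d4, d5⟩ := H4
  have k1 : h4 (b + 1) = h x := by
    rw [d5 _ (by omega) (by omega) (by omega) (by omega), 
      c5 _ (by omega) (by omega) (by omega) (by omega),
      b5 _ (by omega) (by omega) (by omega) (by omega), a4]
  have k2 : h4 (b + 3) = h y := by
    rw [d5 _ (by omega) (by omega) (by omega) (by omega), 
      c5 _ (by omega) (by omega) (by omega) (by omega),
      b4, a5 _ (by omega) (by omega) (by omega) (by omega)]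
  refine ⟨by rw [k1, k2, H], by simp, by simp, ?_⟩
  intro z hz hz'
  simp [hz, hz']

end Sem
end NestedPebbles

namespace NestedPebbles

section RecDef
variable {Sig : Type} {rank : Sig → ℕ}

/-- Program `p` tests property `R` of heads, preserving all heads `< b`. -/
def Chk (b : ℕ) (p : Prog Sig) (R : ∀ t : RTree Sig rank, (ℕ → Pos t) → Prop) : Prop :=
  ∀ t h, (∀ h', p.sem t h h' → R t h ∧ ∀ i < b, h' i = h i) ∧ (R t h → ∃ h', p.sem t h h')

/-- The relation `R` is recognizable by programs, for any assignment of heads to variables. -/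
def Rec {V : Type} (R : ∀ t : RTree Sig rank, (V → Pos t) → Prop) : Prop :=
  ∀ (f : V → ℕ) (b : ℕ), (∀ v, f v < b) →
    ∃ p : Prog Sig, Chk b p (fun t h => R t (fun v => h (f v)))

variable {V W U : Type}

theorem Rec.congr {R R' : ∀ t : RTree Sig rank, (V → Pos t) → Prop} (H : Rec R)
    (h : ∀ t ν, R t ν ↔ R' t ν) : Rec R' := by
  have : R = R' := by
    funext t ν
    exact propext (h t ν)
  rwa [← this]

theorem Rec.subst {R : ∀ t : RTree Sig rank, (V → Pos t) → Prop} (H : Rec R) (g : V → W) :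
    Rec (fun t (ν : W → Pos t) => R t (fun v => ν (g v))) := by
  intro f b hf
  exact H (fun v => f (g v)) b (fun v => hf _)

theorem Rec.true : Rec (fun (t : RTree Sig rank) (_ : V → Pos t) => True) := by
  intro f b _
  refine ⟨.skip, fun t h => ⟨fun h' hh => ?_, fun _ => ⟨h, (sem_skip _ _ _).2 rfl⟩⟩⟩
  rw [sem_skip] at hh
  subst hh
  simp

theorem Rec.false : Rec (fun (t : RTree Sig rank) (_ : V → Pos t) => False) := by
  intro f b _
  exact ⟨.fail, fun t h => ⟨fun h' hh => hh.elim, fun h => h.elim⟩⟩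

theorem Rec.const (p : Prop) : Rec (fun (t : RTree Sig rank) (_ : V → Pos t) => p) := by
  by_cases hp : p
  · simp only [hp]; exact Rec.true
  · simp only [hp]; exact Rec.false

theorem Rec.and {R R' : ∀ t : RTree Sig rank, (V → Pos t) → Prop} (H : Rec R) (H' : Rec R') :
    Rec (fun t ν => R t ν ∧ R' t ν) := by
  intro f b hf
  obtain ⟨p, hp⟩ := H f b hf
  obtain ⟨p', hp'⟩ := H' f b hf
  have key : ∀ (t : RTree Sig rank) (h m : ℕ → Pos t), (∀ i < b, m i = h i) →
      (fun v => m (f v)) = (fun v => h (f v)) := fun t h m hh => funext fun v => hh _ (hf v)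
  refine ⟨.seq p p', fun t h => ⟨?_, ?_⟩⟩
  · rintro h' ⟨m, h1, h2⟩
    obtain ⟨h3, h4⟩ := (hp t h).1 m h1
    obtain ⟨h5, h6⟩ := (hp' t m).1 h' h2
    rw [key t h m h4] at h5
    exact ⟨⟨h3, h5⟩, fun i hi => by rw [h6 i hi, h4 i hi]⟩
  · rintro ⟨h1, h2⟩
    obtain ⟨m, hm⟩ := (hp t h).2 h1
    obtain ⟨h3, h4⟩ := (hp t h).1 m hm
    rw [← key t h m h4] at h2
    obtain ⟨h', hh'⟩ := (hp' t m).2 h2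
    exact ⟨h', m, hm, hh'⟩

theorem Rec.or {R R' : ∀ t : RTree Sig rank, (V → Pos t) → Prop} (H : Rec R) (H' : Rec R') :
    Rec (fun t ν => R t ν ∨ R' t ν) := by
  intro f b hf
  obtain ⟨p, hp⟩ := H f b hf
  obtain ⟨p', hp'⟩ := H' f b hf
  refine ⟨.alt p p', fun t h => ⟨?_, ?_⟩⟩
  · rintro h' (h1 | h1)
    · obtain ⟨h3, h4⟩ := (hp t h).1 h' h1
      exact ⟨Or.inl h3, h4⟩
    · obtain ⟨h3, h4⟩ := (hp' t h).1 h' h1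
      exact ⟨Or.inr h3, h4⟩
  · rintro (h1 | h1)
    · obtain ⟨m, hm⟩ := (hp t h).2 h1
      exact ⟨m, Or.inl hm⟩
    · obtain ⟨m, hm⟩ := (hp' t h).2 h1
      exact ⟨m, Or.inr hm⟩

theorem Rec.finAll {ι : Type} [Finite ι] {R : ι → ∀ t : RTree Sig rank, (V → Pos t) → Prop}
    (H : ∀ i, Rec (R i)) : Rec (fun t ν => ∀ i, R i t ν) := by
  classical
  have := Fintype.ofFinite ι
  have key : ∀ s : Finset ι, Rec (fun t ν => ∀ i ∈ s, R i t ν) := by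
    intro s
    induction s using Finset.induction_on with
    | empty => exact Rec.true.congr (by simp)
    | insert a s _ ih => exact ((H a).and ih).congr (by simp)
  exact (key Finset.univ).congr (by simp)

theorem Rec.finEx {ι : Type} [Finite ι] {R : ι → ∀ t : RTree Sig rank, (V → Pos t) → Prop}
    (H : ∀ i, Rec (R i)) : Rec (fun t ν => ∃ i, R i t ν) := by
  classical
  have := Fintype.ofFinite ι
  have key : ∀ s : Finset ι, Rec (fun t ν => ∃ i ∈ s, R i t ν) := by
    intro s
    induction s using Finset.induction_on with
    | empty => exact Rec.false.congr (by simp)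
    | insert a s _ ih => exact ((H a).or ih).congr (by simp)
  exact (key Finset.univ).congr (by simp)

theorem Rec.lab (v : V) (a : Sig) :
    Rec (fun (t : RTree Sig rank) (ν : V → Pos t) => labelAt t (ν v).1 = some a) := by
  intro f b hf
  refine ⟨.act (.lab (f v) a), fun t h => ⟨?_, ?_⟩⟩
  · rintro h' ⟨rfl, h2⟩
    exact ⟨h2, fun _ _ => rfl⟩
  · intro hh
    exact ⟨h, rfl, hh⟩

theorem Rec.root (v : V) :
    Rec (fun (t : RTree Sig rank) (ν : V → Pos t) => ν v = rootPos t) := by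
  intro f b hf
  refine ⟨.act (.chno (f v) 0), fun t h => ⟨?_, ?_⟩⟩
  · rintro h' ⟨rfl, h2⟩
    exact ⟨childNo_root_iff.1 h2, fun _ _ => rfl⟩
  · intro hh
    exact ⟨h, rfl, childNo_root_iff.2 hh⟩

variable [Fintype Sig]

theorem Rec.eq1 (v w : V) :
    Rec (fun (t : RTree Sig rank) (ν : V → Pos t) => ν v = ν w) := by
  intro f b hf
  exact ⟨.eqTest (maxRank Sig rank) b (f v) (f w), fun t h => 
    ⟨fun h' hh => eqTest_sound t (hf v) (hf w) hh, fun hh => eqTest_complete t (hf v) (hf w) hh⟩⟩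

theorem Rec.eq [Finite U] (x y : U → V) :
    Rec (fun (t : RTree Sig rank) (ν : V → Pos t) => (fun u => ν (x u)) = (fun u => ν (y u))) :=
  (Rec.finAll (fun u : U => Rec.eq1 (x u) (y u))).congr (by simp [funext_iff])

theorem Rec.edg (j : ℕ) (v w : V) :
    Rec (fun (t : RTree Sig rank) (ν : V → Pos t) => (ν w).1 = (ν v).1 ++ [j]) := by
  intro f b hf
  refine ⟨.seq (.guess (maxRank Sig rank) b) (.seq (.eqTest (maxRank Sig rank) (b + 1) b (f v))
    (.seq (.act (.down b (j + 1))) (.eqTest (maxRank Sig rank) (b + 1) b (f w)))), 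
    fun t h => ⟨?_, ?_⟩⟩
  · rintro h' ⟨h1, H1, h2, H2, h3, H3, H4⟩
    rw [sem_guess] at H1
    have hv := hf v
    have hw := hf w
    obtain ⟨e2, g2⟩ := eqTest_sound t (by omega) (by omega) H2
    obtain ⟨e4, g4⟩ := eqTest_sound t (by omega) (by omega) H4
    obtain ⟨-, e3, g3⟩ := H3
    have G3 : ∀ i < b, h3 i = h i := fun i hi => by
      rw [g3 i (by omega), g2 i (by omega), H1 i (by omega)]
    refine ⟨?_, fun i hi => by rw [g4 i (by omega), G3 i hi]⟩
    show (h (f w)).1 = (h (f v)).1 ++ [j]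
    rw [← G3 _ hw, ← e4, e3, g2 b (by omega), e2, H1 _ (by omega)]
    rfl
  · intro hh
    change (h (f w)).1 = (h (f v)).1 ++ [j] at hh
    have hv := hf v
    have hw := hf w
    let h1 := Function.update h b (h (f v))
    have k0 : h1 b = h (f v) := by simp [h1]
    have k1 : h1 (f v) = h (f v) := by simp [h1, hv.ne]
    obtain ⟨h2, H2⟩ := eqTest_complete (b := b + 1) t (x := b) (y := f v) (h := h1) 
      (by omega) (by omega) (by rw [k0, k1])
    obtain ⟨e2, g2⟩ := eqTest_sound t (by omega) (by omega) H2
    let h3 := Function.update h2 b (h (f w))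
    obtain ⟨h4, H4⟩ := eqTest_complete (b := b + 1) t (x := b) (y := f w) (h := h3) 
      (by omega) (by omega) (by simp [h3, h1, hw.ne, g2 (f w) (by omega)])
    refine ⟨h4, h1, ?_, h2, H2, h3, ?_, H4⟩
    · rw [sem_guess]
      intro x hx
      simp [h1, hx]
    · refine ⟨by omega, ?_, fun x hx => by simp [h3, hx]⟩
      rw [g2 b (by omega), k0]
      simp [h3, hh]

theorem block_mem {b k i : ℕ} : i ∉ List.range' b k ↔ i < b ∨ b + k ≤ i := by
  simp [List.mem_range'_1]; omega

theorem Rec.ex [Fintype U] {R : ∀ t : RTree Sig rank, (V → Pos t) → (U → Pos t) → Prop}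
    (H : Rec (fun t (ν : V ⊕ U → Pos t) => R t (fun v => ν (.inl v)) (fun u => ν (.inr u)))) :
    Rec (fun t ν => ∃ y, R t ν y) := by
  intro f b hf
  let e := Fintype.equivFin U
  let k := Fintype.card U
  obtain ⟨p, hp⟩ := H (Sum.elim f (fun u => b + (e u).1)) (b + k) (by
    rintro (v | u)
    · have := hf v; simp; omega
    · have := (e u).2; simp; omega)
  refine ⟨.seq (.each (.guess (maxRank Sig rank)) (List.range' b k)) p, fun t h => ⟨?_, ?_⟩⟩
  · rintro h' ⟨m, h1, h2⟩
    rw [sem_guesses] at h1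
    obtain ⟨h3, h4⟩ := (hp t m).1 h' h2
    refine ⟨⟨fun u => m (b + (e u).1), ?_⟩, fun i hi => ?_⟩
    · simp only [Sum.elim_inl, Sum.elim_inr] at h3
      convert h3 using 1
      · funext v
        rw [h1 _ (block_mem.2 (Or.inl (hf v)))]
    · rw [h4 i (by omega), h1 i (block_mem.2 (Or.inl hi))]
  · rintro ⟨y, hy⟩
    let m : ℕ → Pos t := fun i => if hi : b ≤ i ∧ i < b + k then y (e.symm ⟨i - b, by omega⟩) else h i
    obtain ⟨h', hh'⟩ := (hp t m).2 (by
      convert hy using 1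
      · funext v
        have := hf v
        simp only [Sum.elim_inl, m]
        rw [dif_neg (by omega)]
      · funext u
        have := (e u).2
        simp only [Sum.elim_inr, m]
        rw [dif_pos (by omega)]
        simp)
    refine ⟨h', m, ?_, hh'⟩
    rw [sem_guesses]
    intro x hx
    rw [block_mem] at hx
    simp only [m]
    rw [dif_neg (by omega)]

theorem Rec.tc [Fintype U] {E : ∀ t : RTree Sig rank, (V → Pos t) → (U → Pos t) → (U → Pos t) → Prop}
    (H : Rec (fun t (ν : V ⊕ (U ⊕ U) → Pos t) => E t (fun v => ν (.inl v))
      (fun u => ν (.inr (.inl u))) (fun u => ν (.inr (.inr u))))) (x y : U → V) :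
    Rec (fun t ν => Relation.ReflTransGen (E t ν) (fun u => ν (x u)) (fun u => ν (y u))) := by
  intro f b hf
  let e := Fintype.equivFin U
  let k := Fintype.card U
  let cur : U → ℕ := fun u => b + (e u).1
  let nxt : U → ℕ := fun u => b + k + (e u).1
  have hcur : ∀ u, b ≤ cur u ∧ cur u < b + k := fun u => by
    have := (e u).2; simp only [cur]; omega
  have hnxt : ∀ u, b + k ≤ nxt u ∧ nxt u < b + k + k := fun u => by
    have := (e u).2; simp only [nxt]; omega
  have hF : ∀ v, (Sum.elim f (Sum.elim cur nxt)) v < b + k + k := by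
    rintro (v | u | u)
    · have := hf v; simp; omega
    · have := hcur u; simp; omega
    · have := hnxt u; simp; omega
  -- programs
  obtain ⟨p, hp⟩ := H (Sum.elim f (Sum.elim cur nxt)) (b + k + k) hF
  obtain ⟨c0, hc0⟩ := Rec.eq (rank := rank) (fun u : U => (.inr (.inl u) : V ⊕ (U ⊕ U))) 
    (fun u : U => .inl (x u)) (Sum.elim f (Sum.elim cur nxt)) (b + k + k) hF
  obtain ⟨c1, hc1⟩ := Rec.eq (rank := rank) (fun u : U => (.inr (.inl u) : V ⊕ (U ⊕ U))) 
    (fun u : U => .inr (.inr u)) (Sum.elim f (Sum.elim cur nxt)) (b + k + k) hF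
  obtain ⟨c2, hc2⟩ := Rec.eq (rank := rank) (fun u : U => (.inr (.inl u) : V ⊕ (U ⊕ U))) 
    (fun u : U => .inl (y u)) (Sum.elim f (Sum.elim cur nxt)) (b + k + k) hF
  simp only [Sum.elim_inl, Sum.elim_inr] at hp hc0 hc1 hc2
  let G : ℕ → Prog Sig := fun s => .each (.guess (maxRank Sig rank)) (List.range' s k)
  let body : Prog Sig := .seq (G (b + k)) (.seq p (.seq (G b) c1))
  -- writing a tuple into a block
  have wr : ∀ (t : RTree Sig rank) (s : ℕ) (h : ℕ → Pos t) (w : U → Pos t), ∃ m, 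
      (G s).sem t h m ∧ (∀ u, m (s + (e u).1) = w u) ∧ 
      (∀ i, i < s ∨ s + k ≤ i → m i = h i) := by
    intro t s h w
    refine ⟨fun i => if hi : s ≤ i ∧ i < s + k then w (e.symm ⟨i - s, by omega⟩) else h i, ?_, ?_, ?_⟩
    · simp only [G]
      rw [sem_guesses]
      intro i hx
      rw [block_mem] at hx
      rw [dif_neg (by omega)]
    · intro u
      have := (e u).2
      simp only
      rw [dif_pos (by omega)]
      simp
    · intro i hi
      simp only
      rw [dif_neg (by omega)]
  have body_sound : ∀ (t : RTree Sig rank) (h h' : ℕ → Pos t), body.sem t h h' → 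
      E t (fun v => h (f v)) (fun u => h (cur u)) (fun u => h' (cur u)) ∧ ∀ i < b, h' i = h i := by
    rintro t h h' ⟨h1, H1, h2, H2, h3, H3, H4⟩
    simp only [G] at H1 H3
    rw [sem_guesses] at H1 H3
    simp only [block_mem] at H1 H3
    obtain ⟨e2, g2⟩ := (hp _ _).1 _ H2
    obtain ⟨e4, g4⟩ := (hc1 _ _).1 _ H4
    have k1 : (fun v => h1 (f v)) = (fun v => h (f v)) := by
      funext v; have := hf v; rw [H1 _ (by omega)]
    have k2 : (fun u => h1 (cur u)) = (fun u => h (cur u)) := by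
      funext u; have := hcur u; rw [H1 _ (by omega)]
    have k3 : (fun u => h1 (nxt u)) = (fun u => h' (cur u)) := by
      have : (fun u => h' (cur u)) = (fun u => h3 (cur u)) := by
        funext u; have := hcur u; rw [g4 _ (by omega)]
      rw [this, e4]
      funext u; have := hnxt u; rw [H3 _ (by omega), g2 _ (by omega)]
    rw [k1, k2, k3] at e2
    refine ⟨e2, fun i hi => ?_⟩
    rw [g4 i (by omega), H3 i (by omega), g2 i (by omega), H1 i (by omega)]
  have body_complete : ∀ (t : RTree Sig rank) (h : ℕ → Pos t) (w : U → Pos t), 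
      E t (fun v => h (f v)) (fun u => h (cur u)) w → 
      ∃ h', body.sem t h h' ∧ (fun u => h' (cur u)) = w ∧ ∀ i < b, h' i = h i := by
    intro t h w hw
    obtain ⟨h1, H1, a1, b1⟩ := wr t (b + k) h w
    obtain ⟨h2, H2⟩ := (hp t h1).2 (by
      convert hw using 1
      · funext v; have := hf v; rw [b1 _ (by omega)]
      · funext u; have := hcur u; rw [b1 _ (by omega)]
      · funext u; exact a1 u)
    obtain ⟨-, g2⟩ := (hp _ _).1 _ H2
    obtain ⟨h3, H3, a3, b3⟩ := wr t b h2 w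
    obtain ⟨h4, H4⟩ := (hc1 t h3).2 (by
      funext u
      have := hnxt u
      rw [b3 (nxt u) (by omega), g2 (nxt u) (by omega)]
      exact (a3 u).trans (a1 u).symm)
    obtain ⟨-, g4⟩ := (hc1 _ _).1 _ H4
    refine ⟨h4, ⟨h1, H1, h2, H2, h3, H3, H4⟩, ?_, ?_⟩
    · funext u
      have := hcur u
      rw [g4 _ (by omega)]
      exact a3 u
    · intro i hi
      rw [g4 _ (by omega), b3 _ (by omega), g2 _ (by omega), b1 _ (by omega)]
  refine ⟨.seq (G b) (.seq c0 (.seq (.star body) c2)), fun t h => ⟨?_, ?_⟩⟩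
  · rintro h' ⟨h1, H1, h2, H2, h3, H3, H4⟩
    simp only [G] at H1
    rw [sem_guesses] at H1
    simp only [block_mem] at H1
    obtain ⟨e2, g2⟩ := (hc0 _ _).1 _ H2
    obtain ⟨e4, g4⟩ := (hc2 _ _).1 _ H4
    have G2 : ∀ i < b, h2 i = h i := fun i hi => by rw [g2 i (by omega), H1 i (by omega)]
    have s0 : (fun u => h2 (cur u)) = (fun u => h (f (x u))) := by
      have : (fun u => h2 (cur u)) = (fun u => h1 (cur u)) := by
        funext u; have := hcur u; rw [g2 _ (by omega)]
      rw [this, e2]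
      funext u; have := hf (x u); rw [H1 _ (by omega)]
    have key : (∀ i < b, h3 i = h i) ∧ Relation.ReflTransGen (E t (fun v => h (f v))) 
        (fun u => h (f (x u))) (fun u => h3 (cur u)) := by
      clear e4 g4 H4
      simp only [Prog.sem] at H3
      induction H3 with
      | refl => 
        rw [s0]
        exact ⟨G2, Relation.ReflTransGen.refl⟩
      | tail _ hs ih =>
        obtain ⟨g5, r5⟩ := ih
        obtain ⟨e6, g6⟩ := body_sound _ _ _ hs
        refine ⟨fun i hi => by rw [g6 i hi, g5 i hi], r5.tail ?_⟩
        convert e6 using 1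
        funext v
        rw [g5 _ (hf v)]
    obtain ⟨g5, r5⟩ := key
    refine ⟨?_, fun i hi => by rw [g4 i (by omega), g5 i hi]⟩
    rw [e4] at r5
    convert r5 using 1
    funext u
    rw [g5 _ (hf _)]
  · intro hr
    obtain ⟨h1, H1, a1, b1⟩ := wr t b h (fun u => h (f (x u)))
    obtain ⟨h2, H2⟩ := (hc0 t h1).2 (by
      funext u
      have := hf (x u)
      rw [b1 (f (x u)) (by omega)]
      exact a1 u)
    obtain ⟨e2, g2⟩ := (hc0 _ _).1 _ H2
    have G2 : ∀ i < b, h2 i = h i := fun i hi => by rw [g2 i (by omega), b1 i (by omega)]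
    have s0 : (fun u => h2 (cur u)) = (fun u => h (f (x u))) := by
      have : (fun u => h2 (cur u)) = (fun u => h1 (cur u)) := by
        funext u; have := hcur u; rw [g2 _ (by omega)]
      rw [this]
      funext u; exact a1 u
    have key : ∀ z, Relation.ReflTransGen (E t (fun v => h (f v))) (fun u => h (f (x u))) z → 
        ∃ h3, (Prog.star body).sem t h2 h3 ∧ (fun u => h3 (cur u)) = z ∧ ∀ i < b, h3 i = h i := by
      intro z hz
      induction hz with
      | refl => exact ⟨h2, Relation.ReflTransGen.refl, s0, G2⟩
      | tail _ hs ih =>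
        obtain ⟨h3, r3, s3, g3⟩ := ih
        obtain ⟨h4, r4, s4, g4⟩ := body_complete t h3 _ (by
          rw [s3]
          convert hs using 1
          funext v
          rw [g3 _ (hf v)])
        exact ⟨h4, Relation.ReflTransGen.tail r3 r4, s4, fun i hi => by rw [g4 i hi, g3 i hi]⟩
    obtain ⟨h3, H3, s3, g3⟩ := key _ hr
    obtain ⟨h4, H4⟩ := (hc2 t h3).2 (by
      refine s3.trans ?_
      funext u
      exact (g3 _ (hf _)).symm)
    exact ⟨h4, h1, H1, h2, H2, h3, H3, H4⟩

end RecDef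
end NestedPebbles

namespace NestedPebbles

section Thompson
variable {Sig : Type} {rank : Sig → ℕ}

def oSem (t : RTree Sig rank) : Option (Act Sig) → (ℕ → Pos t) → (ℕ → Pos t) → Prop
  | none, h, h' => h' = h
  | some a, h, h' => a.sem t h h'

/-- Step relation of a finite transition system with actions. -/
def dStep {Q : Type} (t : RTree Sig rank) (δ : Set (Q × Option (Act Sig) × Q)) :
    Q × (ℕ → Pos t) → Q × (ℕ → Pos t) → Prop :=
  fun c c' => ∃ o, (c.1, o, c'.1) ∈ δ ∧ oSem t o c.2 c'.2

def liftD {Q Q' : Type} (g : Q → Q') (δ : Set (Q × Option (Act Sig) × Q)) :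
    Set (Q' × Option (Act Sig) × Q') := (fun x => (g x.1, x.2.1, g x.2.2)) '' δ

theorem mem_liftD {Q Q' : Type} {g : Q → Q'} {δ : Set (Q × Option (Act Sig) × Q)} {a b : Q'}
    {o : Option (Act Sig)} : (a, o, b) ∈ liftD g δ ↔ ∃ q q', (q, o, q') ∈ δ ∧ g q = a ∧ g q' = b := by
  unfold liftD
  constructor
  · rintro ⟨⟨q, o', q'⟩, h, h'⟩
    simp only [Prod.mk.injEq] at h'
    obtain ⟨rfl, rfl, rfl⟩ := h'
    exact ⟨q, q', h, rfl, rfl⟩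
  · rintro ⟨q, q', h, rfl, rfl⟩
    exact ⟨(q, o, q'), h, rfl⟩

theorem lift_path {Q Q' : Type} {g : Q → Q'} {δ : Set (Q × Option (Act Sig) × Q)}
    {δ' : Set (Q' × Option (Act Sig) × Q')} (hs : liftD g δ ⊆ δ') {t : RTree Sig rank} {q q' : Q}
    {h h' : ℕ → Pos t} (H : Relation.ReflTransGen (dStep t δ) (q, h) (q', h')) :
    Relation.ReflTransGen (dStep t δ') (g q, h) (g q', h') := by
  refine Relation.ReflTransGen.lift (fun c : Q × (ℕ → Pos t) => (g c.1, c.2)) ?_ _ _ H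
  rintro c c' ⟨o, h1, h2⟩
  exact ⟨o, hs (mem_liftD.2 ⟨_, _, h1, rfl, rfl⟩), h2⟩

theorem thompson (rank : Sig → ℕ) (p : Prog Sig) :
    ∃ (Q : Type) (_ : Finite Q) (δ : Set (Q × Option (Act Sig) × Q)) (s e : Q), δ.Finite ∧
      ∀ (t : RTree Sig rank) h h', Relation.ReflTransGen (dStep t δ) (s, h) (e, h') ↔
        p.sem t h h' := by
  induction p with
  | fail =>
    refine ⟨Bool, inferInstance, ∅, false, true, Set.finite_empty, fun t h h' => ⟨fun H => ?_, ?_⟩⟩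
    · obtain (H | ⟨c, -, o, ho, -⟩) := Relation.ReflTransGen.cases_tail H
      · simp at H
      · exact ho.elim
    · intro H; exact H.elim
  | act a =>
    refine ⟨Bool, inferInstance, {(false, some a, true)}, false, true, Set.finite_singleton _, 
      fun t h h' => ⟨fun H => ?_, fun H => ?_⟩⟩
    · obtain (H | ⟨c, H, o, ho, hs⟩) := Relation.ReflTransGen.cases_tail H
      · simp at H
      · simp only [Set.mem_singleton_iff, Prod.mk.injEq] at ho
        obtain ⟨hc, rfl, -⟩ := ho
        obtain (H | ⟨c', H, o, ho, -⟩) := Relation.ReflTransGen.cases_tail H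
        · rw [H] at hs
          exact hs
        · simp [hc] at ho
    · exact Relation.ReflTransGen.single ⟨some a, by simp, H⟩
  | seq p1 p2 ih1 ih2 =>
    obtain ⟨Q1, f1, δ1, s1, e1, d1, H1⟩ := ih1
    obtain ⟨Q2, f2, δ2, s2, e2, d2, H2⟩ := ih2
    refine ⟨Q1 ⊕ Q2, inferInstance, 
      liftD Sum.inl δ1 ∪ liftD Sum.inr δ2 ∪ {(Sum.inl e1, none, Sum.inr s2)}, Sum.inl s1, Sum.inr e2, 
      ((d1.image _).union (d2.image _)).union (Set.finite_singleton _), fun t h h' => ⟨fun H => ?_, ?_⟩⟩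
    · have key : ∀ c, Relation.ReflTransGen (dStep t (liftD Sum.inl δ1 ∪ liftD Sum.inr δ2 ∪ 
          {(Sum.inl e1, none, Sum.inr s2)})) (Sum.inl s1, h) c → 
          (∀ q, c.1 = Sum.inl q → Relation.ReflTransGen (dStep t δ1) (s1, h) (q, c.2)) ∧ 
          (∀ q, c.1 = Sum.inr q → ∃ m, p1.sem t h m ∧ 
            Relation.ReflTransGen (dStep t δ2) (s2, m) (q, c.2)) := by
        intro c hc
        induction hc with
        | refl => 
          refine ⟨fun q hq => ?_, fun q hq => by simp at hq⟩
          simp only [Sum.inl.injEq] at hq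
          subst hq
          exact Relation.ReflTransGen.refl
        | tail _ hs ih =>
          obtain ⟨o, ho, hs⟩ := hs
          rename_i c c' _
          obtain ⟨x, hx⟩ := c
          obtain ⟨x', hx'⟩ := c'
          simp only [Set.mem_union, mem_liftD, Set.mem_singleton_iff, Prod.mk.injEq] at ho
          simp only at ih hs ⊢
          rcases ho with (⟨q, q', hq, rfl, rfl⟩ | ⟨q, q', hq, rfl, rfl⟩) | ⟨rfl, rfl, rfl⟩
          · refine ⟨fun r hr => ?_, fun r hr => by simp at hr⟩
            obtain rfl : q' = r := by simpa using hr
            exact (ih.1 q rfl).tail ⟨o, hq, hs⟩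
          · refine ⟨fun r hr => by simp at hr, fun r hr => ?_⟩
            obtain rfl : q' = r := by simpa using hr
            obtain ⟨m, hm, hm'⟩ := ih.2 q rfl
            exact ⟨m, hm, hm'.tail ⟨o, hq, hs⟩⟩
          · refine ⟨fun r hr => by simp at hr, fun r hr => ?_⟩
            obtain rfl : s2 = r := by simpa using hr
            cases hs
            exact ⟨_, (H1 _ _ _).1 (ih.1 _ rfl), Relation.ReflTransGen.refl⟩
      obtain ⟨m, hm, hm'⟩ := (key _ H).2 e2 rfl
      exact ⟨m, hm, (H2 _ _ _).1 hm'⟩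
    · rintro ⟨m, h1, h2⟩
      refine (lift_path (g := Sum.inl) ?_ ((H1 _ _ _).2 h1)).trans 
        (Relation.ReflTransGen.head (b := (Sum.inr s2, m)) ⟨none, ?_, rfl⟩ 
          (lift_path (g := Sum.inr) ?_ ((H2 _ _ _).2 h2)))
      · intro x hx; exact Or.inl (Or.inl hx)
      · exact Or.inr rfl
      · intro x hx; exact Or.inl (Or.inr hx)
  | alt p1 p2 ih1 ih2 =>
    obtain ⟨Q1, f1, δ1, s1, e1, d1, H1⟩ := ih1
    obtain ⟨Q2, f2, δ2, s2, e2, d2, H2⟩ := ih2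
    let g1 : Q1 → (Q1 ⊕ Q2) ⊕ Bool := fun q => .inl (.inl q)
    let g2 : Q2 → (Q1 ⊕ Q2) ⊕ Bool := fun q => .inl (.inr q)
    let δ : Set (((Q1 ⊕ Q2) ⊕ Bool) × Option (Act Sig) × ((Q1 ⊕ Q2) ⊕ Bool)) := 
      (liftD g1 δ1 ∪ liftD g2 δ2) ∪ {(.inr false, none, g1 s1), (.inr false, none, g2 s2), 
        (g1 e1, none, .inr true), (g2 e2, none, .inr true)}
    refine ⟨(Q1 ⊕ Q2) ⊕ Bool, inferInstance, δ, .inr false, .inr true, 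
      ((d1.image _).union (d2.image _)).union (by simp), fun t h h' => ⟨fun H => ?_, ?_⟩⟩
    · have key : ∀ c, Relation.ReflTransGen (dStep t δ) (.inr false, h) c → 
          (c.1 = .inr false → c.2 = h) ∧
          (∀ q, c.1 = g1 q → Relation.ReflTransGen (dStep t δ1) (s1, h) (q, c.2)) ∧ 
          (∀ q, c.1 = g2 q → Relation.ReflTransGen (dStep t δ2) (s2, h) (q, c.2)) ∧ 
          (c.1 = .inr true → p1.sem t h c.2 ∨ p2.sem t h c.2) := by
        intro c hc
        induction hc with
        | refl => simp [g1, g2]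
        | tail _ hs ih =>
          obtain ⟨o, ho, hs⟩ := hs
          rename_i c c' _
          obtain ⟨x, hx⟩ := c
          obtain ⟨x', hx'⟩ := c'
          simp only [δ, Set.mem_union, mem_liftD, Set.mem_singleton_iff, Set.mem_insert_iff, 
            Prod.mk.injEq] at ho
          simp only at ih hs ⊢
          obtain ⟨i1, i2, i3, i4⟩ := ih
          rcases ho with (⟨q, q', hq, rfl, rfl⟩ | ⟨q, q', hq, rfl, rfl⟩) | 
            ⟨rfl, rfl, rfl⟩ | ⟨rfl, rfl, rfl⟩ | ⟨rfl, rfl, rfl⟩ | ⟨rfl, rfl, rfl⟩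
          · refine ⟨by simp [g1], fun r hr => ?_, by simp [g1, g2], by simp [g1]⟩
            obtain rfl : q' = r := by simpa [g1] using hr
            exact (i2 q rfl).tail ⟨o, hq, hs⟩
          · refine ⟨by simp [g2], by simp [g1, g2], fun r hr => ?_, by simp [g2]⟩
            obtain rfl : q' = r := by simpa [g2] using hr
            exact (i3 q rfl).tail ⟨o, hq, hs⟩
          · refine ⟨by simp [g1], fun r hr => ?_, by simp [g1, g2], by simp [g1]⟩
            obtain rfl : s1 = r := by simpa [g1] using hr
            cases hs
            rw [i1 rfl]
          · refine ⟨by simp [g2], by simp [g1, g2], fun r hr => ?_, by simp [g2]⟩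
            obtain rfl : s2 = r := by simpa [g2] using hr
            cases hs
            rw [i1 rfl]
          · cases hs
            exact ⟨by simp, by simp [g1], by simp [g2], fun _ => Or.inl ((H1 _ _ _).1 (i2 _ rfl))⟩
          · cases hs
            exact ⟨by simp, by simp [g1], by simp [g2], fun _ => Or.inr ((H2 _ _ _).1 (i3 _ rfl))⟩
      exact (key _ H).2.2.2 rfl
    · rintro (h1 | h1)
      · refine Relation.ReflTransGen.head (b := (g1 s1, h)) ⟨none, by simp [δ], rfl⟩ 
          (Relation.ReflTransGen.tail (b := (g1 e1, h')) 
            (lift_path (g := g1) ?_ ((H1 _ _ _).2 h1)) ⟨none, by simp [δ], rfl⟩)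
        intro x hx; exact Or.inl (Or.inl hx)
      · refine Relation.ReflTransGen.head (b := (g2 s2, h)) ⟨none, by simp [δ], rfl⟩ 
          (Relation.ReflTransGen.tail (b := (g2 e2, h')) 
            (lift_path (g := g2) ?_ ((H2 _ _ _).2 h1)) ⟨none, by simp [δ], rfl⟩)
        intro x hx; exact Or.inl (Or.inr hx)
  | star p ih =>
    obtain ⟨Q, f1, δ1, s1, e1, d1, H1⟩ := ih
    let δ : Set (Option Q × Option (Act Sig) × Option Q) := 
      liftD some δ1 ∪ {(none, none, some s1), (some e1, none, none)}
    refine ⟨Option Q, inferInstance, δ, none, none, 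
      (d1.image _).union (by simp), fun t h h' => ⟨fun H => ?_, fun H => ?_⟩⟩
    · have key : ∀ c, Relation.ReflTransGen (dStep t δ) (none, h) c → 
          (c.1 = none → (Prog.star p).sem t h c.2) ∧
          (∀ q, c.1 = some q → ∃ m, (Prog.star p).sem t h m ∧ 
            Relation.ReflTransGen (dStep t δ1) (s1, m) (q, c.2)) := by
        intro c hc
        induction hc with
        | refl => exact ⟨fun _ => Relation.ReflTransGen.refl, by simp⟩
        | tail _ hs ih =>
          obtain ⟨o, ho, hs⟩ := hs
          rename_i c c' _
          obtain ⟨x, hx⟩ := c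
          obtain ⟨x', hx'⟩ := c'
          simp only [δ, Set.mem_union, mem_liftD, Set.mem_singleton_iff, Set.mem_insert_iff, 
            Prod.mk.injEq] at ho
          simp only at ih hs ⊢
          obtain ⟨i1, i2⟩ := ih
          rcases ho with ⟨q, q', hq, rfl, rfl⟩ | ⟨rfl, rfl, rfl⟩ | ⟨rfl, rfl, rfl⟩
          · refine ⟨by simp, fun r hr => ?_⟩
            obtain rfl : q' = r := by simpa using hr
            obtain ⟨m, hm, hm'⟩ := i2 q rfl
            exact ⟨m, hm, hm'.tail ⟨o, hq, hs⟩⟩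
          · refine ⟨by simp, fun r hr => ?_⟩
            obtain rfl : s1 = r := by simpa using hr
            cases hs
            exact ⟨_, i1 rfl, Relation.ReflTransGen.refl⟩
          · cases hs
            refine ⟨fun _ => ?_, by simp⟩
            obtain ⟨m, hm, hm'⟩ := i2 _ rfl
            exact Relation.ReflTransGen.tail hm ((H1 _ _ _).1 hm')
      exact (key _ H).1 rfl
    · simp only [Prog.sem] at H
      induction H with
      | refl => exact Relation.ReflTransGen.refl
      | tail _ hs ih =>
        rename_i m m' _
        refine ih.trans (Relation.ReflTransGen.head (b := (some s1, m)) ⟨none, by simp [δ], rfl⟩ 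
          (Relation.ReflTransGen.tail (b := (some e1, m')) 
            (lift_path (g := some) ?_ ((H1 _ _ _).2 hs)) ⟨none, by simp [δ], rfl⟩))
        intro x hx; exact Or.inl hx

/-- A bound on the heads of an action. -/
def Act.bd : Act Sig → ℕ
  | .up i => i + 1
  | .down i _ => i + 1
  | .lab i _ => i + 1
  | .chno i _ => i + 1

def Prog.bd : Prog Sig → ℕ
  | .fail => 0
  | .act a => a.bd
  | .seq p q => max p.bd q.bd
  | .alt p q => max p.bd q.bd
  | .star p => p.bd

theorem Act.sem_far {t : RTree Sig rank} {a : Act Sig} {h h' : ℕ → Pos t} (H : a.sem t h h') :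
    ∀ i, a.bd ≤ i → h' i = h i := by
  intro i hi
  cases a with
  | up j => exact H.2 i (by simp [Act.bd] at hi; omega)
  | down j _ => exact H.2.2 i (by simp [Act.bd] at hi; omega)
  | lab j a => rw [H.1]
  | chno j a => rw [H.1]

theorem Prog.sem_far {t : RTree Sig rank} {p : Prog Sig} {h h' : ℕ → Pos t} (H : p.sem t h h') :
    ∀ i, p.bd ≤ i → h' i = h i := by
  induction p generalizing h h' with
  | fail => exact H.elim
  | act a => exact Act.sem_far H
  | seq p q ih1 ih2 =>
    obtain ⟨m, h1, h2⟩ := H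
    intro i hi
    simp only [Prog.bd, max_le_iff] at hi
    rw [ih2 h2 i hi.2, ih1 h1 i hi.1]
  | alt p q ih1 ih2 =>
    intro i hi
    simp only [Prog.bd, max_le_iff] at hi
    rcases H with H | H
    · exact ih1 H i hi.1
    · exact ih2 H i hi.2
  | star p ih =>
    intro i hi
    simp only [Prog.sem] at H
    induction H with
    | refl => rfl
    | tail _ hs ih' => rw [ih hs i hi, ih']

def conv (n : ℕ) : Act Sig → TInstr Sig (n + 1) Empty
  | .up i => .up (Fin.ofNat (n + 1) i)
  | .down i j => .down (Fin.ofNat (n + 1) i) j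
  | .lab i a => .test true (.lab (Fin.ofNat (n + 1) i) a)
  | .chno i j => .test true (.chno (Fin.ofNat (n + 1) i) j)

def extH {t : RTree Sig rank} {n : ℕ} (h : Fin (n + 1) → Pos t) : ℕ → Pos t :=
  fun i => if hi : i < n + 1 then h ⟨i, hi⟩ else rootPos t

theorem extH_inj {t : RTree Sig rank} {n : ℕ} {h h' : Fin (n + 1) → Pos t} :
    extH h' = extH h ↔ h' = h := by
  constructor
  · intro H
    funext i
    have := congrFun H i.1
    simp only [extH, i.2, dite_true] at this
    exact this
  · rintro rfl; rfl

theorem extH_ofNat {t : RTree Sig rank} {n : ℕ} (h : Fin (n + 1) → Pos t) {i : ℕ} (hi : i < n + 1) :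
    extH h i = h (Fin.ofNat (n + 1) i) := by
  simp only [extH, hi, dite_true]
  congr 1
  ext
  simp [Nat.mod_eq_of_lt hi]

theorem extH_others {t : RTree Sig rank} {n : ℕ} {h h' : Fin (n + 1) → Pos t} {i : ℕ} 
    (hi : i < n + 1) :
    (∀ x, x ≠ Fin.ofNat (n + 1) i → h' x = h x) ↔ ∀ x, x ≠ i → extH h' x = extH h x := by
  constructor
  · intro H x hx
    by_cases hxn : x < n + 1
    · rw [extH_ofNat _ hxn, extH_ofNat _ hxn]
      apply H
      intro hh
      have := congrArg Fin.val hh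
      simp [Nat.mod_eq_of_lt hi, Nat.mod_eq_of_lt hxn] at this
      exact hx this
    · simp [extH, hxn]
  · intro H x hx
    have := H x.1 (by
      rintro rfl
      apply hx
      ext
      simp)
    simp only [extH, x.2, dite_true] at this
    exact this

theorem conv_step {t : RTree Sig rank} {n : ℕ} {a : Act Sig} (ha : a.bd ≤ n + 1)
    (h h' : Fin (n + 1) → Pos t) (π' : List (Empty × Pos t)) :
    instrStep t (conv n a) h [] h' π' ↔ π' = [] ∧ a.sem t (extH h) (extH h') := by
  cases a with
  | up i => 
    have hi : i < n + 1 := by simp [Act.bd] at ha; omega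
    simp only [conv, instrStep, Act.sem, extH_ofNat _ hi, extH_others hi]
  | down i j => 
    have hi : i < n + 1 := by simp [Act.bd] at ha; omega
    simp only [conv, instrStep, Act.sem, extH_ofNat _ hi, extH_others hi]
  | lab i a => 
    have hi : i < n + 1 := by simp [Act.bd] at ha; omega
    simp only [conv, instrStep, Act.sem, extH_ofNat _ hi, extH_inj, testHolds]
    tauto
  | chno i j => 
    have hi : i < n + 1 := by simp [Act.bd] at ha; omega
    simp only [conv, instrStep, Act.sem, extH_ofNat _ hi, extH_inj, testHolds]
    tauto

theorem sem_extH {t : RTree Sig rank} {n : ℕ} {a : Act Sig} (ha : a.bd ≤ n + 1)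
    {h : Fin (n + 1) → Pos t} {h' : ℕ → Pos t} (H : a.sem t (extH h) h') : 
    ∃ k : Fin (n + 1) → Pos t, h' = extH k := by
  refine ⟨fun i => h' i.1, ?_⟩
  funext i
  by_cases hi : i < n + 1
  · simp [extH, hi]
  · rw [Act.sem_far H i (by omega)]
    simp [extH, hi]

theorem extH_root {t : RTree Sig rank} {n : ℕ} :
    extH (fun _ : Fin (n + 1) => rootPos t) = fun _ => rootPos t := by
  funext i
  simp [extH]

def nInstr {Q : Type} (n : ℕ) (δ : Set (Q × Option (Act Sig) × Q)) (e : Q) :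
    Set (Option Q × TInstr Sig (n + 1) Empty × Option Q) :=
  (fun x => (some x.1, (match x.2.1 with 
    | none => TInstr.test true (TTest.chno 0 0) 
    | some a => conv n a), some x.2.2)) '' δ ∪
  (fun x => (some x.1, (match x.2.1 with 
    | none => TInstr.test false (TTest.chno 0 0) 
    | some a => conv n a), some x.2.2)) '' δ ∪
  {(some e, TInstr.test true (TTest.chno 0 0), none)}

/-- The tree-walking automaton of a transition system. -/
noncomputable def toTWA (rank : Sig → ℕ) {Q : Type} [Finite Q] (n : ℕ)
    (δ : Set (Q × Option (Act Sig) × Q)) (s e : Q) (hδ : δ.Finite) : TWA Sig rank (n + 1) where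
  Q := Option Q
  finQ := Fintype.ofFinite _
  X := Empty
  finX := inferInstance
  q0 := some s
  acc := {none}
  instr := nInstr n δ e
  instrFin := ((hδ.image _).union (hδ.image _)).union (Set.finite_singleton _)

theorem toTWA_pebbleFree {Q : Type} [Finite Q] (n : ℕ)
    (δ : Set (Q × Option (Act Sig) × Q)) (s e : Q) (hδ : δ.Finite) :
    PebbleFree (toTWA rank n δ s e hδ) := by
  intro p χ q _
  refine ⟨fun i x => x.elim, fun x => x.elim, fun b i x => x.elim⟩

theorem toTWA_lang {Q : Type} [Finite Q] (n : ℕ)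
    (δ : Set (Q × Option (Act Sig) × Q)) (s e : Q) (hδ : δ.Finite)
    (hb : ∀ q a q', (q, some a, q') ∈ δ → a.bd ≤ n + 1) (t : RTree Sig rank) :
    t ∈ Lang (toTWA rank n δ s e hδ) ↔ 
      Relation.ReflTransGen (dStep t δ) (s, fun _ => rootPos t) (e, fun _ => rootPos t) := by
  have step_iff : ∀ (q q' : Q) (h h' : Fin (n + 1) → Pos t) (π' : List (Empty × Pos t)), 
      Step (toTWA rank n δ s e hδ) t (some q, h, []) (some q', h', π') ↔ 
      π' = [] ∧ dStep t δ (q, extH h) (q', extH h') := by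
    intro q q' h h' π'
    constructor
    · rintro ⟨ins, (⟨⟨r, o, r'⟩, h1, h2⟩ | ⟨⟨r, o, r'⟩, h1, h2⟩) | h1, h3⟩
      · simp only [Prod.mk.injEq, Option.some.injEq] at h2
        obtain ⟨rfl, rfl, rfl⟩ := h2
        cases o with
        | none => 
          obtain ⟨e1, e2, -⟩ := h3
          exact ⟨e2, none, h1, extH_inj.2 e1⟩
        | some a =>
          obtain ⟨e1, e2⟩ := (conv_step (hb _ _ _ h1) _ _ _).1 h3
          exact ⟨e1, some a, h1, e2⟩
      · simp only [Prod.mk.injEq, Option.some.injEq] at h2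
        obtain ⟨rfl, rfl, rfl⟩ := h2
        cases o with
        | none => 
          obtain ⟨e1, e2, -⟩ := h3
          exact ⟨e2, none, h1, extH_inj.2 e1⟩
        | some a =>
          obtain ⟨e1, e2⟩ := (conv_step (hb _ _ _ h1) _ _ _).1 h3
          exact ⟨e1, some a, h1, e2⟩
      · have h4 : some q' = none := congrArg (fun x : Option Q × TInstr Sig (n + 1) Empty × Option Q => x.2.2) h1
        exact absurd h4 (Option.some_ne_none _)
    · rintro ⟨rfl, o, h1, h2⟩
      cases o with
      | none => 
        obtain rfl := extH_inj.1 h2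
        by_cases h0 : childNo (h' 0).1 = 0
        · exact ⟨.test true (.chno 0 0), Or.inl (Or.inl ⟨_, h1, rfl⟩), rfl, rfl, by simpa [testHolds]⟩
        · exact ⟨.test false (.chno 0 0), Or.inl (Or.inr ⟨_, h1, rfl⟩), rfl, rfl, by simpa [testHolds]⟩
      | some a => 
        exact ⟨conv n a, Or.inl (Or.inl ⟨_, h1, rfl⟩), (conv_step (hb _ _ _ h1) _ _ _).2 ⟨rfl, h2⟩⟩
  have step_none : ∀ (q : Option Q) (h h' : Fin (n + 1) → Pos t) (π π' : List (Empty × Pos t)), 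
      Step (toTWA rank n δ s e hδ) t (q, h, π) (none, h', π') → q = some e ∧ h' = h ∧ π' = π := by
    rintro q h h' π π' ⟨ins, (⟨⟨r, o, r'⟩, h1, h2⟩ | ⟨⟨r, o, r'⟩, h1, h2⟩) | h1, h3⟩
    · exact absurd (congrArg (fun x : Option Q × TInstr Sig (n + 1) Empty × Option Q => x.2.2) h2) (Option.some_ne_none _)
    · exact absurd (congrArg (fun x : Option Q × TInstr Sig (n + 1) Empty × Option Q => x.2.2) h2) (Option.some_ne_none _)
    · have h4 : q = some e := congrArg (fun x : Option Q × TInstr Sig (n + 1) Empty × Option Q => x.1) h1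
      have h5 : ins = TInstr.test true (TTest.chno 0 0) := 
        congrArg (fun x : Option Q × TInstr Sig (n + 1) Empty × Option Q => x.2.1) h1
      subst h4 h5
      exact ⟨rfl, h3.1, h3.2.1⟩
  have none_step : ∀ (h : Fin (n + 1) → Pos t) (π : List (Empty × Pos t)) c, 
      ¬ Step (toTWA rank n δ s e hδ) t (none, h, π) c := by
    rintro h π c ⟨ins, (⟨⟨r, o, r'⟩, h1, h2⟩ | ⟨⟨r, o, r'⟩, h1, h2⟩) | h1, h3⟩
    · exact absurd (congrArg (fun x : Option Q × TInstr Sig (n + 1) Empty × Option Q => x.1) h2) (Option.some_ne_none _)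
    · exact absurd (congrArg (fun x : Option Q × TInstr Sig (n + 1) Empty × Option Q => x.1) h2) (Option.some_ne_none _)
    · exact absurd (congrArg (fun x : Option Q × TInstr Sig (n + 1) Empty × Option Q => x.1) h1) (Option.some_ne_none _).symm
  constructor
  · rintro ⟨q, hq, hr, -⟩
    obtain rfl : q = none := hq
    have key : ∀ c : TConf (toTWA rank n δ s e hδ) t, 
        Relation.ReflTransGen (Step (toTWA rank n δ s e hδ) t) (initConf _ t) c → 
        c.2.2 = [] ∧ 
        (∀ q, c.1 = some q → Relation.ReflTransGen (dStep t δ) (s, fun _ => rootPos t) (q, extH c.2.1)) ∧ 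
        (c.1 = none → Relation.ReflTransGen (dStep t δ) (s, fun _ => rootPos t) (e, extH c.2.1)) := by
      intro c hc
      induction hc with
      | refl => 
        refine ⟨rfl, fun q hq => ?_, fun hq => by simp [initConf, toTWA] at hq⟩
        simp only [initConf, toTWA] at hq
        cases hq
        simp only [initConf]
        rw [extH_root]
      | tail _ hs ih =>
        rename_i c c' _
        obtain ⟨q, h, π⟩ := c
        obtain ⟨q', h', π'⟩ := c'
        simp only at ih ⊢
        obtain ⟨rfl, i1, i2⟩ := ih
        cases q' with
        | none =>
          obtain ⟨rfl, rfl, rfl⟩ := step_none _ _ _ _ _ hs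
          exact ⟨rfl, fun r hr => (by simp at hr), fun _ => i1 _ rfl⟩
        | some q' =>
          cases q with
          | none => exact (none_step _ _ _ hs).elim
          | some q =>
            obtain ⟨rfl, hs2⟩ := (step_iff _ _ _ _ _).1 hs
            refine ⟨rfl, fun r hr => ?_, fun hr => by simp at hr⟩
            cases hr
            exact (i1 q rfl).tail hs2
    have := (key _ hr).2.2 rfl
    simpa only [extH_root] using this
  · intro H
    refine ⟨none, rfl, ?_, fun c => none_step _ _ c⟩
    have key : ∀ c, Relation.ReflTransGen (dStep t δ) (s, fun _ => rootPos t) c → 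
        ∃ h, c.2 = extH h ∧ Relation.ReflTransGen (Step (toTWA rank n δ s e hδ) t) (initConf _ t) 
          (some c.1, h, []) := by
      intro c hc
      induction hc with
      | refl => exact ⟨fun _ => rootPos t, extH_root.symm, Relation.ReflTransGen.refl⟩
      | tail _ hs ih =>
        rename_i c c' _
        obtain ⟨q, g⟩ := c
        obtain ⟨q', g'⟩ := c'
        obtain ⟨h, rfl, hr⟩ := ih
        obtain ⟨h', rfl⟩ : ∃ h', g' = extH h' := by
          obtain ⟨o, h1, h2⟩ := hs
          cases o with
          | none => exact ⟨h, h2⟩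
          | some a => exact sem_extH (hb _ _ _ h1) h2
        exact ⟨h', rfl, hr.tail ((step_iff _ _ _ _ _).2 ⟨rfl, hs⟩)⟩
    obtain ⟨h, h1, h2⟩ := key _ H
    rw [← extH_root (n := n)] at h1
    have h3 : (fun _ => rootPos t) = h := extH_inj.1 (show extH _ = extH _ from h1)
    subst h3
    refine h2.tail ⟨.test true (.chno 0 0), Or.inr rfl, rfl, rfl, ?_⟩
    simp [testHolds, childNo_root_iff]

theorem prog_to_NTWA (p : Prog Sig) (L : Set (RTree Sig rank)) 
    (hL : ∀ t, t ∈ L ↔ ∃ h', p.sem t (fun _ => rootPos t) h') : 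
    ∃ k, 1 ≤ k ∧ L ∈ NTWA Sig rank k := by
  obtain ⟨Q, fQ, δ, s, e, hδ, H⟩ := thompson rank (.seq p (.each .rootify (List.range p.bd)))
  obtain ⟨n, hn⟩ : ∃ n, ∀ q a q', (q, some a, q') ∈ δ → a.bd ≤ n + 1 := by
    obtain ⟨n, hn⟩ := (hδ.image (fun x => (x.2.1.map Act.bd).getD 0)).bddAbove
    refine ⟨n, fun q a q' h => ?_⟩
    have : a.bd ≤ n := hn ⟨_, h, rfl⟩
    omega
  refine ⟨n + 1, by omega, toTWA rank n δ s e hδ, toTWA_pebbleFree _ _ _ _ _, ?_⟩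
  ext t
  rw [toTWA_lang n δ s e hδ hn, H, hL]
  constructor
  · rintro ⟨h', hh⟩
    refine ⟨h', hh, ?_⟩
    rw [sem_roots]
    refine ⟨fun _ _ => rfl, fun i hi => ?_⟩
    rw [Prog.sem_far hh i (by simpa using hi)]
  · rintro ⟨h', hh, -⟩
    exact ⟨h', hh⟩

theorem Rec.toNTWA {R : ∀ t : RTree Sig rank, (ℕ → Pos t) → Prop} (H : Rec R) : 
    ∃ k, 1 ≤ k ∧ {t | R t (fun _ => rootPos t)} ∈ NTWA Sig rank k := by
  obtain ⟨p, hp⟩ := H (fun _ => 0) 1 (by simp)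
  refine prog_to_NTWA p _ fun t => ?_
  constructor
  · intro h
    exact (hp t _).2 h
  · rintro ⟨h', hh⟩
    exact ((hp t _).1 h' hh).1

end Thompson
end NestedPebbles

namespace NestedPebbles

section Enumeration
variable {Sig : Type} {rank : Sig → ℕ}

def RTree.size : RTree Sig rank → ℕ
  | .node _ c => 1 + ∑ i, (c i).size

def csize (t : RTree Sig rank) (j : ℕ) : ℕ := (t.child j).elim 0 RTree.size

def idx : RTree Sig rank → List ℕ → ℕ
  | _, [] => 0
  | t, i :: p => 1 + ∑ j ∈ Finset.range i, csize t j + (t.child i).elim 0 (fun s => idx s p)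

theorem size_eq (t : RTree Sig rank) :
    t.size = 1 + ∑ j ∈ Finset.range (rank t.label), csize t j := by
  cases t with
  | node a c =>
    simp only [RTree.size, RTree.label]
    rw [Finset.sum_range]
    congr 1
    apply Finset.sum_congr rfl
    intro i _
    simp [csize, RTree.child]

theorem size_pos (t : RTree Sig rank) : 0 < t.size := by rw [size_eq]; omega

theorem child_some {t : RTree Sig rank} {i : ℕ} (h : i < rank t.label) : ∃ s, t.child i = some s :=
  Option.isSome_iff_exists.1 ((child_isSome t i).2 h)

theorem child_lt {t s : RTree Sig rank} {i : ℕ} (h : t.child i = some s) : i < rank t.label :=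
  (child_isSome t i).1 (by simp [h])

theorem idx_bound {t s : RTree Sig rank} {p : List ℕ} (h : t.subtree p = some s) :
    idx t p + s.size ≤ t.size := by
  induction p generalizing t with
  | nil => simp [RTree.subtree] at h; subst h; simp [idx]
  | cons i p ih =>
    simp only [RTree.subtree] at h
    cases hc : t.child i with
    | none => simp [hc] at h
    | some c =>
      simp only [hc, Option.bind_some] at h
      have h1 := ih h
      have h2 := child_lt hc
      have h3 : ∑ j ∈ Finset.range (i + 1), csize t j ≤ ∑ j ∈ Finset.range (rank t.label), csize t j :=
        Finset.sum_le_sum_of_subset (Finset.range_mono h2)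
      rw [Finset.sum_range_succ] at h3
      have h4 : csize t i = c.size := by simp [csize, hc]
      rw [size_eq t]
      simp only [idx, hc, Option.elim_some]
      omega

theorem idx_append {t s : RTree Sig rank} {p : List ℕ} (h : t.subtree p = some s) (q : List ℕ) :
    idx t (p ++ q) = idx t p + idx s q := by
  induction p generalizing t with
  | nil => simp [RTree.subtree] at h; subst h; simp [idx]
  | cons i p ih =>
    simp only [RTree.subtree] at h
    cases hc : t.child i with
    | none => simp [hc] at h
    | some c =>
      simp only [hc, Option.bind_some] at h
      simp only [List.cons_append, idx, hc, Option.elim_some, ih h]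
      omega

theorem idx_inj {t : RTree Sig rank} {p q : List ℕ} (hp : IsPos t p) (hq : IsPos t q)
    (h : idx t p = idx t q) : p = q := by
  induction p generalizing t q with
  | nil =>
    cases q with
    | nil => rfl
    | cons i q => simp only [idx] at h; omega
  | cons i p ih =>
    cases q with
    | nil => simp only [idx] at h; omega
    | cons i' q =>
      unfold IsPos at hp hq ih
      simp only [RTree.subtree] at hp hq
      cases hc : t.child i with
      | none => simp [hc] at hp
      | some c =>
        cases hc' : t.child i' with
        | none => simp [hc'] at hq
        | some c' =>
          simp only [hc, hc', Option.bind_some] at hp hq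
          obtain ⟨s, hs⟩ := Option.isSome_iff_exists.1 hp
          obtain ⟨s', hs'⟩ := Option.isSome_iff_exists.1 hq
          have b1 := idx_bound hs
          have b2 := idx_bound hs'
          have z1 := size_pos s
          have z2 := size_pos s'
          have h4 : csize t i = c.size := by simp [csize, hc]
          have h5 : csize t i' = c'.size := by simp [csize, hc']
          simp only [idx, hc, hc', Option.elim_some] at h
          rcases lt_trichotomy i i' with hlt | rfl | hlt
          · have h3 : ∑ j ∈ Finset.range (i + 1), csize t j ≤ ∑ j ∈ Finset.range i', csize t j :=
              Finset.sum_le_sum_of_subset (Finset.range_mono hlt)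
            rw [Finset.sum_range_succ] at h3
            omega
          · have : c = c' := by simpa [hc] using hc'
            subst this
            rw [ih hp hq (by omega)]
          · have h3 : ∑ j ∈ Finset.range (i' + 1), csize t j ≤ ∑ j ∈ Finset.range i, csize t j :=
              Finset.sum_le_sum_of_subset (Finset.range_mono hlt)
            rw [Finset.sum_range_succ] at h3
            omega

/-- End of the interval of indices of the subtree at `p`. -/
def eidx (t : RTree Sig rank) (p : List ℕ) : ℕ := idx t p + (t.subtree p).elim 0 RTree.size

theorem idx_snoc {t s : RTree Sig rank} {p : List ℕ} (h : t.subtree p = some s) (j : ℕ) :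
    idx t (p ++ [j]) = idx t p + 1 + ∑ i ∈ Finset.range j, csize s i := by
  rw [idx_append h]
  have : (s.child j).elim 0 (fun _ => 0) = 0 := by cases s.child j <;> simp
  simp only [idx, this]
  omega

theorem eidx_snoc {t s : RTree Sig rank} {p : List ℕ} (h : t.subtree p = some s) (j : ℕ) :
    eidx t (p ++ [j]) = idx t p + 1 + ∑ i ∈ Finset.range (j + 1), csize s i := by
  rw [eidx, idx_snoc h, subtree_append, h, Finset.sum_range_succ]
  simp only [Option.bind_some, RTree.subtree, csize]
  cases s.child j <;> simp [RTree.subtree]; omega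

theorem pos_sub {t : RTree Sig rank} (x : Pos t) : ∃ s, t.subtree x.1 = some s :=
  Option.isSome_iff_exists.1 x.2

theorem eidx_last {t : RTree Sig rank} {p : List ℕ} {a : Sig} (h : labelAt t p = some a) 
    {j : ℕ} (hj : j + 1 = rank a) : eidx t (p ++ [j]) = eidx t p := by
  unfold labelAt at h
  cases hs : t.subtree p with
  | none => simp [hs] at h
  | some s =>
    simp [hs] at h
    subst h
    rw [eidx_snoc hs, eidx, hs, hj, Option.elim_some, size_eq]
    omega

theorem eidx_leaf {t : RTree Sig rank} {p : List ℕ} {a : Sig} (h : labelAt t p = some a) 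
    (hj : rank a = 0) : eidx t p = idx t p + 1 := by
  unfold labelAt at h
  cases hs : t.subtree p with
  | none => simp [hs] at h
  | some s =>
    simp [hs] at h
    subst h
    rw [eidx, hs, Option.elim_some, size_eq, hj]
    simp

/-- Last-child edge. -/
def LC (t : RTree Sig rank) (w x : Pos t) : Prop :=
  ∃ a : Sig, rank a ≠ 0 ∧ labelAt t w.1 = some a ∧ x.1 = w.1 ++ [rank a - 1]

def Leaf (t : RTree Sig rank) (x : Pos t) : Prop := ∃ a : Sig, rank a = 0 ∧ labelAt t x.1 = some a

/-- `x` is the last node of the subtree at `w`. -/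
def RD (t : RTree Sig rank) (w x : Pos t) : Prop := Relation.ReflTransGen (LC t) w x ∧ Leaf t x

theorem RD_idx {t : RTree Sig rank} {w x : Pos t} (h : RD t w x) : idx t x.1 + 1 = eidx t w.1 := by
  obtain ⟨h, a, ha, hl⟩ := h
  rw [← eidx_leaf hl ha]
  clear hl
  induction h with
  | refl => rfl
  | tail _ hs ih =>
    obtain ⟨a, ha, h1, h2⟩ := hs
    rw [h2, eidx_last h1 (by omega), ih]

def Suc1 (t : RTree Sig rank) (x y : Pos t) : Prop :=
  y.1 = x.1 ++ [0] ∨ ∃ (z w : Pos t) (j : ℕ), w.1 = z.1 ++ [j] ∧ RD t w x ∧ y.1 = z.1 ++ [j + 1]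

theorem Suc1_idx {t : RTree Sig rank} {x y : Pos t} (h : Suc1 t x y) : idx t y.1 = idx t x.1 + 1 := by
  rcases h with h | ⟨z, w, j, h1, h2, h3⟩
  · obtain ⟨s, hs⟩ := pos_sub x
    rw [h, idx_snoc hs]
    simp
  · obtain ⟨s, hs⟩ := pos_sub z
    rw [RD_idx h2, h3, h1, idx_snoc hs, eidx_snoc hs]

theorem suc_or_last {t : RTree Sig rank} (x : Pos t) : (∃ y, Suc1 t x y) ∨ RD t (rootPos t) x := by
  obtain ⟨a, ha⟩ := labelAt_pos x
  by_cases h0 : rank a = 0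
  · have key : ∀ (p : List ℕ) (w : Pos t), w.1 = p → RD t w x → 
        (∃ y, Suc1 t x y) ∨ RD t (rootPos t) x := by
      intro p
      induction p using List.reverseRecOn with
      | nil => 
        intro w hw h
        have : w = rootPos t := pos_ext hw
        rw [this] at h
        exact Or.inr h
      | append_singleton p j ih =>
        intro w hw h
        have hwp := w.2
        rw [hw] at hwp
        have hp := isPos_left hwp
        obtain ⟨b, hb, hj⟩ := isPos_snoc_lab.1 hwp
        by_cases hj2 : j + 1 = rank b
        · refine ih (mkPos t p hp) rfl ⟨Relation.ReflTransGen.head ⟨b, by omega, hb, ?_⟩ h.1, h.2⟩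
          rw [hw, ← hj2]; rfl
        · left
          exact ⟨mkPos t (p ++ [j + 1]) (isPos_snoc_lab.2 ⟨b, hb, by omega⟩), Or.inr
            ⟨mkPos t p hp, w, j, hw, h, rfl⟩⟩
    exact key _ x rfl ⟨Relation.ReflTransGen.refl, a, h0, ha⟩
  · left
    exact ⟨mkPos t (x.1 ++ [0]) (isPos_snoc_lab.2 ⟨a, ha, by omega⟩), Or.inl rfl⟩

theorem eidx_root (t : RTree Sig rank) : eidx t (rootPos t).1 = t.size := by
  simp [eidx, rootPos, idx, RTree.subtree]

theorem idx_lt {t : RTree Sig rank} (x : Pos t) : idx t x.1 < t.size := by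
  obtain ⟨s, hs⟩ := pos_sub x
  have := idx_bound hs
  have := size_pos s
  omega

theorem Suc1_iff {t : RTree Sig rank} {x y : Pos t} : idx t y.1 = idx t x.1 + 1 ↔ Suc1 t x y := by
  refine ⟨fun h => ?_, Suc1_idx⟩
  rcases suc_or_last x with ⟨y', hy⟩ | hl
  · have := Suc1_idx hy
    have : y = y' := pos_ext (idx_inj y.2 y'.2 (by omega))
    rwa [this]
  · have := RD_idx hl
    rw [eidx_root] at this
    have := idx_lt y
    omega

theorem last_iff {t : RTree Sig rank} {x : Pos t} : idx t x.1 + 1 = t.size ↔ RD t (rootPos t) x := by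
  refine ⟨fun h => ?_, fun h => by rw [RD_idx h, eidx_root]⟩
  rcases suc_or_last x with ⟨y', hy⟩ | hl
  · have := Suc1_idx hy
    have := idx_lt y'
    omega
  · exact hl

theorem idx_root (t : RTree Sig rank) : idx t (rootPos t).1 = 0 := rfl

theorem first_iff {t : RTree Sig rank} {x : Pos t} : idx t x.1 = 0 ↔ x = rootPos t := by
  refine ⟨fun h => pos_ext (idx_inj x.2 (rootPos t).2 (by rw [h]; rfl)), ?_⟩
  rintro rfl; rfl

theorem idx_surj (t : RTree Sig rank) {i : ℕ} (hi : i < t.size) : ∃ x : Pos t, idx t x.1 = i := by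
  induction i with
  | zero => exact ⟨rootPos t, rfl⟩
  | succ i ih =>
    obtain ⟨x, hx⟩ := ih (by omega)
    rcases suc_or_last x with ⟨y, hy⟩ | hl
    · exact ⟨y, by rw [Suc1_idx hy, hx]⟩
    · have := last_iff.2 hl
      omega

theorem rtg_unit {α : Type} {E : α → α → Prop} {a b : Unit → α} :
    Relation.ReflTransGen (fun a b : Unit → α => E (a ()) (b ())) a b ↔ 
      Relation.ReflTransGen E (a ()) (b ()) := by
  constructor
  · intro h
    exact Relation.ReflTransGen.lift (fun a : Unit → α => a ()) (fun _ _ h => h) _ _ h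
  · intro h
    exact Relation.ReflTransGen.lift (p := fun a b : Unit → α => E (a ()) (b ())) 
      (fun (a : α) (_ : Unit) => a) (fun _ _ h => h) _ _ h

variable [Fintype Sig] {V : Type}

theorem Rec.tc1 {E : ∀ t : RTree Sig rank, (V → Pos t) → Pos t → Pos t → Prop}
    (H : Rec (fun t (ν : V ⊕ (Unit ⊕ Unit) → Pos t) => E t (fun v => ν (.inl v))
      (ν (.inr (.inl ()))) (ν (.inr (.inr ()))))) (x y : V) :
    Rec (fun t ν => Relation.ReflTransGen (E t ν) (ν x) (ν y)) :=
  (Rec.tc (E := fun t ν a b => E t ν (a ()) (b ())) H (fun _ : Unit => x) (fun _ : Unit => y)).congr 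
    (fun _ _ => rtg_unit)

theorem Rec.leaf (x : V) : Rec (fun (t : RTree Sig rank) (ν : V → Pos t) => Leaf t (ν x)) :=
  Rec.finEx fun a => (Rec.const _).and (Rec.lab x a)

theorem Rec.RD (w x : V) : Rec (fun (t : RTree Sig rank) (ν : V → Pos t) => RD t (ν w) (ν x)) := 
  (Rec.tc1 (E := fun t _ a b => LC t a b) (Rec.finEx fun _ => (Rec.const _).and ((Rec.lab _ _).and 
    (Rec.edg _ _ _))) w x).and (Rec.leaf x)

theorem Rec.ex1 {R : ∀ t : RTree Sig rank, (V → Pos t) → Pos t → Prop}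
    (H : Rec (fun t (ν : V ⊕ Unit → Pos t) => R t (fun v => ν (.inl v)) (ν (.inr ())))) :
    Rec (fun t ν => ∃ y, R t ν y) :=
  (Rec.ex (R := fun t ν y => R t ν (y ())) H).congr fun _ _ => 
    ⟨fun ⟨y, h⟩ => ⟨y (), h⟩, fun ⟨y, h⟩ => ⟨fun _ => y, h⟩⟩

theorem Rec.suc1 (x y : V) : 
    Rec (fun (t : RTree Sig rank) (ν : V → Pos t) => idx t (ν y).1 = idx t (ν x).1 + 1) := by
  simp only [Suc1_iff]
  refine (Rec.edg 0 x y).or ?_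
  have : Rec (fun (t : RTree Sig rank) (ν : V → Pos t) => ∃ z w : Pos t, ∃ j : Fin (maxRank Sig rank), 
      w.1 = z.1 ++ [j.1] ∧ NestedPebbles.RD t w (ν x) ∧ (ν y).1 = z.1 ++ [j.1 + 1]) := by
    refine Rec.ex1 (Rec.ex1 (Rec.finEx fun j => ?_))
    exact Rec.and (Rec.edg _ (Sum.inl (Sum.inr ())) (Sum.inr ())) (Rec.and (Rec.RD (Sum.inr ()) (Sum.inl (Sum.inl x))) 
      (Rec.edg _ (Sum.inl (Sum.inr ())) (Sum.inl (Sum.inl y))))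
  refine this.congr fun t ν => ?_
  constructor
  · rintro ⟨z, w, j, h⟩; exact ⟨z, w, j.1, h⟩
  · rintro ⟨z, w, j, h⟩
    exact ⟨z, w, ⟨j, isPos_lt (h.1 ▸ w.2)⟩, h⟩

theorem Rec.last1 (x : V) : 
    Rec (fun (t : RTree Sig rank) (ν : V → Pos t) => idx t (ν x).1 + 1 = t.size) := by
  have : Rec (fun (t : RTree Sig rank) (ν : V → Pos t) => ∃ z, z = rootPos t ∧ 
      NestedPebbles.RD t z (ν x)) := by
    refine Rec.ex1 ?_
    exact Rec.and (Rec.root (Sum.inr ())) (Rec.RD (Sum.inr ()) (Sum.inl x))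
  refine this.congr fun t ν => ?_
  rw [last_iff]
  simp

theorem Rec.first1 (x : V) : 
    Rec (fun (t : RTree Sig rank) (ν : V → Pos t) => idx t (ν x).1 = 0) := by
  simp only [first_iff]
  exact Rec.root x

/-- A recognizable enumeration of tuples. -/
structure Enum (rank : Sig → ℕ) (U : Type) where
  rk : ∀ t : RTree Sig rank, (U → Pos t) → ℕ
  N : RTree Sig rank → ℕ
  inj : ∀ t x y, rk t x = rk t y → x = y
  lt : ∀ t x, rk t x < N t
  surj : ∀ t i, i < N t → ∃ x, rk t x = i
  first : Rec (fun t ν => rk t ν = 0)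
  suc : Rec (fun t (ν : U ⊕ U → Pos t) => rk t (fun u => ν (.inr u)) = rk t (fun u => ν (.inl u)) + 1)
  last : Rec (fun t ν => rk t ν + 1 = N t)

theorem enum_exists (U : Type) [Finite U] : Nonempty (Enum rank U) := by
  induction U using Finite.induction_empty_option with
  | of_equiv e H => 
    rename_i α β
    obtain ⟨E⟩ := H
    refine ⟨⟨fun t x => E.rk t (fun u => x (e u)), E.N, ?_, fun t x => E.lt _ _, ?_, E.first.subst e, 
      E.suc.subst (Sum.map e e), E.last.subst e⟩⟩
    · intro t x y h
      have := E.inj _ _ _ h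
      funext b
      simpa using congrFun this (e.symm b)
    · intro t i hi
      obtain ⟨x, hx⟩ := E.surj t i hi
      exact ⟨fun b => x (e.symm b), by simpa using hx⟩
  | h_empty => 
    refine ⟨⟨fun t x => 0, fun t => 1, fun t x y _ => Subsingleton.elim _ _, by simp, ?_, 
      Rec.const _, Rec.const _, Rec.const _⟩⟩
    intro t i hi
    exact ⟨fun u => u.elim, by omega⟩
  | h_option H =>
    rename_i α _
    obtain ⟨E⟩ := H
    have arith : ∀ {n a b c d : ℕ}, b < n → d < n → (a * n + b = c * n + d ↔ a = c ∧ b = d) := by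
      intro n a b c d hb hd
      constructor
      · intro h
        have h1 : (a * n + b) / n = a := by
          rw [mul_comm, Nat.mul_add_div (by omega), Nat.div_eq_of_lt hb, add_zero]
        have h2 : (c * n + d) / n = c := by
          rw [mul_comm, Nat.mul_add_div (by omega), Nat.div_eq_of_lt hd, add_zero]
        have : a = c := by rw [← h1, h, h2]
        subst this
        exact ⟨rfl, by omega⟩
      · rintro ⟨rfl, rfl⟩; rfl
    refine ⟨⟨fun t x => E.rk t (fun u => x (some u)) * t.size + idx t (x none).1, 
      fun t => E.N t * t.size, ?_, ?_, ?_, ?_, ?_, ?_⟩⟩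
    · intro t x y h
      obtain ⟨h1, h2⟩ := (arith (idx_lt _) (idx_lt _)).1 h
      funext u
      cases u with
      | none => exact pos_ext (idx_inj (x none).2 (y none).2 h2)
      | some u => exact congrFun (E.inj _ _ _ h1) u
    · intro t x
      have h1 := E.lt t (fun u => x (some u))
      have h2 := idx_lt (x none)
      calc _ < E.rk t (fun u => x (some u)) * t.size + t.size := by omega
        _ = (E.rk t (fun u => x (some u)) + 1) * t.size := by ring
        _ ≤ _ := Nat.mul_le_mul_right _ h1
    · intro t i hi
      obtain ⟨x, hx⟩ := E.surj t (i / t.size) (Nat.div_lt_of_lt_mul (by rwa [mul_comm]))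
      obtain ⟨y, hy⟩ := idx_surj t (Nat.mod_lt i (size_pos t))
      refine ⟨fun u => u.elim y x, ?_⟩
      simp only [Option.elim_some, Option.elim_none, hx, hy]
      rw [mul_comm]
      exact Nat.div_add_mod i _
    · refine ((E.first.subst some).and (Rec.first1 none)).congr fun t ν => ?_
      have := size_pos t
      simp only [Nat.add_eq_zero_iff, Nat.mul_eq_zero]
      constructor
      · tauto
      · rintro ⟨h1 | h1, h2⟩
        · exact ⟨h1, h2⟩
        · omega
    · refine (((Rec.eq (fun u : α => Sum.inr (some u)) (fun u => Sum.inl (some u))).and 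
        (Rec.suc1 (Sum.inl none) (Sum.inr none))).or ((E.suc.subst (Sum.map some some)).and 
        ((Rec.last1 (Sum.inl none)).and (Rec.first1 (Sum.inr none))))).congr fun t ν => ?_
      have b1 := idx_lt (ν (.inl none))
      have b2 := idx_lt (ν (.inr none))
      simp only [Sum.map_inl, Sum.map_inr]
      constructor
      · rintro (⟨h1, h2⟩ | ⟨h1, h2, h3⟩)
        · rw [h1, h2]; ring
        · rw [h1, h3]
          linarith
      · intro h
        rcases Nat.lt_or_ge (idx t (ν (.inl none)).1 + 1) t.size with hl | hl
        · rw [add_assoc] at h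
          obtain ⟨h1, h2⟩ := (arith b2 hl).1 h
          exact Or.inl ⟨E.inj _ _ _ h1, h2⟩
        · right
          have h4 : idx t (ν (.inl none)).1 + 1 = t.size := by omega
          have h5 : E.rk t (fun u => ν (.inr (some u))) * t.size + idx t (ν (.inr none)).1 = 
            (E.rk t (fun u => ν (.inl (some u))) + 1) * t.size + 0 := by
            rw [h, add_assoc, h4]; ring
          obtain ⟨h1, h2⟩ := (arith b2 (size_pos t)).1 h5
          exact ⟨h1, h4, h2⟩
    · refine ((E.last.subst some).and (Rec.last1 none)).congr fun t ν => ?_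
      have b1 := idx_lt (ν none)
      have b2 := E.lt t (fun u => ν (some u))
      constructor
      · rintro ⟨h1, h2⟩
        rw [← h1, ← h2]; ring_nf
      · intro h
        generalize hA : E.rk t (fun u => ν (some u)) = A at *
        generalize idx t (ν none).1 = B at *
        have h3 : (A + 1) * t.size ≤ E.N t * t.size := Nat.mul_le_mul_right _ b2
        have h4 : B + 1 = t.size := by nlinarith
        refine ⟨?_, h4⟩
        have h5 : (A + 1) * t.size = E.N t * t.size := by rw [← h, ← h4]; ring
        exact Nat.eq_of_mul_eq_mul_right (size_pos t) h5

end Enumeration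
end NestedPebbles

namespace NestedPebbles

section Abstract
variable {α : Type}

/-- Abstract enumeration. -/
structure AEnum (α : Type) where
  rk : α → ℕ
  N : ℕ
  inj : ∀ x y, rk x = rk y → x = y
  lt : ∀ x, rk x < N
  surj : ∀ i, i < N → ∃ x, rk x = i

theorem AEnum.finite (e : AEnum α) : Finite α :=
  Finite.of_injective (fun x => (⟨e.rk x, e.lt x⟩ : Fin e.N)) (fun x y h => e.inj _ _ (by simpa using h))

theorem AEnum.card (e : AEnum α) : Nat.card α = e.N := by
  have : Function.Bijective (fun x => (⟨e.rk x, e.lt x⟩ : Fin e.N)) :=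
    ⟨fun x y h => e.inj _ _ (by simpa using h), fun i => by
      obtain ⟨x, hx⟩ := e.surj i.1 i.2
      exact ⟨x, Fin.ext hx⟩⟩
  rw [Nat.card_congr (Equiv.ofBijective _ this), Nat.card_fin]

theorem AEnum.suc_path (e : AEnum α) (x y : α) :
    Relation.ReflTransGen (fun x y => e.rk y = e.rk x + 1) x y ↔ e.rk x ≤ e.rk y := by
  constructor
  · intro h
    induction h with
    | refl => exact le_rfl
    | tail _ h ih => omega
  · intro h
    obtain ⟨n, hn⟩ := Nat.exists_eq_add_of_le h
    induction n generalizing y with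
    | zero =>
      rw [e.inj y x (by omega)]
    | succ n ih =>
      obtain ⟨w, hw⟩ := e.surj (e.rk x + n) (by have := e.lt y; omega)
      exact (ih w (by omega) hw).tail (by omega)

/-- Certified counting. -/
def Cnt (e : AEnum α) (P Q : α → Prop) (c : α) : Prop :=
  ∃ S : Set α, (∀ u ∈ S, P u) ∧ (∀ u, u ∉ S → Q u) ∧ S.ncard = e.rk c

def cStep (e : AEnum α) (P Q : α → Prop) (p q : α × α) : Prop :=
  e.rk q.1 = e.rk p.1 + 1 ∧ ((P p.1 ∧ e.rk q.2 = e.rk p.2 + 1) ∨ (Q p.1 ∧ p.2 = q.2))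

theorem cnt_iff [Finite α] (e : AEnum α) (P Q : α → Prop) (c : α) :
    Cnt e P Q c ↔ ∃ z u m, e.rk z = 0 ∧ Relation.ReflTransGen (cStep e P Q) (z, z) (u, m) ∧
      e.rk u + 1 = e.N ∧ ((P u ∧ e.rk c = e.rk m + 1) ∨ (Q u ∧ m = c)) := by
  have step : ∀ (S : Set α) (u : α), u ∈ S → 
      (S ∩ {v | e.rk v < e.rk u + 1}).ncard = (S ∩ {v | e.rk v < e.rk u}).ncard + 1 := by
    intro S u hu
    rw [← Set.ncard_insert_of_notMem (a := u) (by simp) (Set.toFinite _)]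
    congr 1
    ext v
    simp only [Set.mem_inter_iff, Set.mem_ofPred_eq, Set.mem_insert_iff]
    constructor
    · rintro ⟨h1, h2⟩
      rcases Nat.lt_or_ge (e.rk v) (e.rk u) with h | h
      · exact Or.inr ⟨h1, h⟩
      · exact Or.inl (e.inj _ _ (by omega))
    · rintro (rfl | h)
      · exact ⟨hu, by omega⟩
      · exact ⟨h.1, by omega⟩
  have step2 : ∀ (S : Set α) (u : α), u ∉ S → 
      (S ∩ {v | e.rk v < e.rk u + 1}).ncard = (S ∩ {v | e.rk v < e.rk u}).ncard := by
    intro S u hu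
    congr 1
    ext v
    simp only [Set.mem_inter_iff, Set.mem_ofPred_eq]
    constructor
    · rintro ⟨h1, h2⟩
      refine ⟨h1, ?_⟩
      rcases Nat.lt_or_ge (e.rk v) (e.rk u) with h | h
      · exact h
      · rw [e.inj v u (by omega)] at h1
        exact absurd h1 hu
    · rintro h
      exact ⟨h.1, by omega⟩
  constructor
  · rintro ⟨S, h1, h2, h3⟩
    have hc := e.lt c
    have hle : ∀ n, (S ∩ {v | e.rk v < n}).ncard ≤ e.rk c := by
      intro n
      rw [← h3]
      exact Set.ncard_le_ncard Set.inter_subset_left (Set.toFinite _)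
    obtain ⟨z, hz⟩ := e.surj 0 (by omega)
    have path : ∀ n, n < e.N → ∃ u m, e.rk u = n ∧ e.rk m = (S ∩ {v | e.rk v < n}).ncard ∧ 
        Relation.ReflTransGen (cStep e P Q) (z, z) (u, m) := by
      intro n
      induction n with
      | zero => 
        intro _
        exact ⟨z, z, hz, by simp [hz], Relation.ReflTransGen.refl⟩
      | succ n ih =>
        intro hn
        obtain ⟨u, m, rfl, hm, hp⟩ := ih (by omega)
        obtain ⟨u', hu'⟩ := e.surj _ hn
        obtain ⟨m', hm'⟩ := e.surj _ (lt_of_le_of_lt (hle (e.rk u + 1)) hc)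
        refine ⟨u', m', hu', hm', hp.tail ⟨hu', ?_⟩⟩
        by_cases hu : u ∈ S
        · rw [step S u hu, ← hm] at hm'
          exact Or.inl ⟨h1 u hu, hm'⟩
        · rw [step2 S u hu, ← hm] at hm'
          exact Or.inr ⟨h2 u hu, (e.inj _ _ hm').symm⟩
    obtain ⟨u, m, hu, hm, hp⟩ := path (e.N - 1) (by omega)
    have hN : e.rk u + 1 = e.N := by omega
    refine ⟨z, u, m, hz, hp, hN, ?_⟩
    have hall : S ∩ {v | e.rk v < e.rk u + 1} = S := by
      ext v
      have := e.lt v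
      simp only [Set.mem_inter_iff, Set.mem_ofPred_eq, and_iff_left_iff_imp]
      intro _; omega
    rw [← hu] at hm
    by_cases hu : u ∈ S
    · have := step S u hu
      rw [hall, h3, ← hm] at this
      exact Or.inl ⟨h1 u hu, this⟩
    · have := step2 S u hu
      rw [hall, h3, ← hm] at this
      exact Or.inr ⟨h2 u hu, (e.inj _ _ this).symm⟩
  · rintro ⟨z, u, m, hz, hp, hN, hf⟩
    have inv : ∀ p, Relation.ReflTransGen (cStep e P Q) (z, z) p → 
        ∃ S : Set α, (∀ v ∈ S, e.rk v < e.rk p.1) ∧ (∀ v ∈ S, P v) ∧ 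
          (∀ v, e.rk v < e.rk p.1 → v ∉ S → Q v) ∧ S.ncard = e.rk p.2 := by
      intro p hp
      induction hp with
      | refl => exact ⟨∅, by simp, by simp, by simp [hz], by simp [hz]⟩
      | tail _ hs ih =>
        rename_i p q _
        obtain ⟨S, i1, i2, i3, i4⟩ := ih
        obtain ⟨s1, ⟨s2, s3⟩ | ⟨s2, s3⟩⟩ := hs
        · refine ⟨insert p.1 S, ?_, ?_, ?_, ?_⟩
          · rintro v (rfl | hv)
            · omega
            · have := i1 v hv; omega
          · rintro v (rfl | hv)
            · exact s2
            · exact i2 v hv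
          · intro v hv hvS
            simp only [Set.mem_insert_iff, not_or] at hvS
            refine i3 v ?_ hvS.2
            rcases Nat.lt_or_ge (e.rk v) (e.rk p.1) with h | h
            · exact h
            · exact absurd (e.inj v p.1 (by omega)) hvS.1
          · rw [Set.ncard_insert_of_notMem (fun h => lt_irrefl _ (i1 _ h)) (Set.toFinite _), i4, s3]
        · refine ⟨S, ?_, i2, ?_, by rw [i4, s3]⟩
          · intro v hv
            have := i1 v hv; omega
          · intro v hv hvS
            rcases Nat.lt_or_ge (e.rk v) (e.rk p.1) with h | h
            · exact i3 v h hvS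
            · rw [e.inj v p.1 (by omega)]
              exact s2
    obtain ⟨S, i1, i2, i3, i4⟩ := inv _ hp
    simp only at i1 i2 i3 i4
    rcases hf with ⟨f1, f2⟩ | ⟨f1, f2⟩
    · refine ⟨insert u S, ?_, ?_, ?_⟩
      · rintro v (rfl | hv)
        · exact f1
        · exact i2 v hv
      · intro v hvS
        simp only [Set.mem_insert_iff, not_or] at hvS
        refine i3 v ?_ hvS.2
        rcases Nat.lt_or_ge (e.rk v) (e.rk u) with h | h
        · exact h
        · have := e.lt v
          exact absurd (e.inj v u (by omega)) hvS.1
      · rw [Set.ncard_insert_of_notMem (fun h => lt_irrefl _ (i1 _ h)) (Set.toFinite _), i4, f2]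
    · refine ⟨S, i2, ?_, by rw [i4, f2]⟩
      intro v hvS
      rcases Nat.lt_or_ge (e.rk v) (e.rk u) with h | h
      · exact i3 v h hvS
      · have := e.lt v
        rw [e.inj v u (by omega)]
        exact f1

/-- Nodes reachable from `A` in at most `n` steps. -/
def DR (G : α → α → Prop) (A : α) : ℕ → α → Prop
  | 0, w => w = A
  | n + 1, w => ∃ v, DR G A n v ∧ (v = w ∨ G v w)

theorem DR_mono {G : α → α → Prop} {A : α} {m n : ℕ} (h : m ≤ n) {w : α} (hw : DR G A m w) : 
    DR G A n w := by
  induction h with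
  | refl => exact hw
  | step _ ih => exact ⟨w, ih, Or.inl rfl⟩

theorem DR_rtg {G : α → α → Prop} {A : α} {n : ℕ} {w : α} (hw : DR G A n w) : 
    Relation.ReflTransGen G A w := by
  induction n generalizing w with
  | zero => rw [show w = A from hw]
  | succ n ih =>
    obtain ⟨v, hv, rfl | h⟩ := hw
    · exact ih hv
    · exact (ih hv).tail h

theorem DR_card [Finite α] (G : α → α → Prop) (A : α) {w : α} : 
    DR G A (Nat.card α) w ↔ Relation.ReflTransGen G A w := by
  refine ⟨DR_rtg, fun h => ?_⟩
  obtain ⟨m, hm, hst⟩ : ∃ m ≤ Nat.card α, ∀ v, DR G A (m + 1) v → DR G A m v := by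
    by_contra hcon
    push Not at hcon
    have : ∀ m ≤ Nat.card α + 1, m ≤ {v | DR G A m v}.ncard := by
      intro m
      induction m with
      | zero => simp
      | succ m ih =>
        intro hm
        obtain ⟨v, h1, h2⟩ := hcon m (by omega)
        have : {v | DR G A m v} ⊂ {v | DR G A (m + 1) v} := by
          refine ⟨fun w hw => DR_mono (Nat.le_succ m) hw, fun hs => h2 (hs h1)⟩
        have := Set.ncard_lt_ncard this (Set.toFinite _)
        have := ih (by omega)
        omega
    have h1 := this _ le_rfl
    have h2 := Set.ncard_le_ncard (Set.subset_univ {v | DR G A (Nat.card α + 1) v}) (Set.toFinite _)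
    rw [Set.ncard_univ] at h2
    omega
  apply DR_mono hm
  induction h with
  | refl => exact DR_mono (Nat.zero_le m) (w := A) rfl
  | tail _ hs ih => exact hst _ ⟨_, ih, Or.inr hs⟩

def NotIn (e : AEnum α) (G : α → α → Prop) (A : α) (i c v : α) : Prop :=
  Cnt e (fun u => u ≠ A ∧ DR G A (e.rk i) u ∧ u ≠ v ∧ ¬ G u v) (fun _ => True) c ∧ A ≠ v ∧ ¬ G A v

theorem notIn_iff [Finite α] (e : AEnum α) (G : α → α → Prop) (A : α) (i c v : α) 
    (hc : e.rk c = {u | u ≠ A ∧ DR G A (e.rk i) u}.ncard) : 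
    NotIn e G A i c v ↔ ¬ DR G A (e.rk i + 1) v := by
  constructor
  · rintro ⟨⟨S, h1, -, h2⟩, h3, h4⟩ ⟨u, h5, h6⟩
    have hS : S = {u | u ≠ A ∧ DR G A (e.rk i) u} := 
      Set.eq_of_subset_of_ncard_le (fun u hu => ⟨(h1 u hu).1, (h1 u hu).2.1⟩) (by omega) (Set.toFinite _)
    by_cases hu : u = A
    · subst hu
      tauto
    · have : u ∈ S := by rw [hS]; exact ⟨hu, h5⟩
      have := (h1 u this).2.2
      tauto
  · intro h
    have hA : DR G A (e.rk i) A := DR_mono (Nat.zero_le _) (w := A) rfl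
    refine ⟨⟨{u | u ≠ A ∧ DR G A (e.rk i) u}, ?_, by simp, hc.symm⟩, ?_, ?_⟩
    · rintro u ⟨h1, h2⟩
      exact ⟨h1, h2, fun h3 => h ⟨u, h2, Or.inl h3⟩, fun h3 => h ⟨u, h2, Or.inr h3⟩⟩
    · intro h3
      exact h ⟨A, hA, Or.inl h3⟩
    · intro h3
      exact h ⟨A, hA, Or.inr h3⟩

def NextC (e : AEnum α) (G : α → α → Prop) (A : α) (i c c' : α) : Prop :=
  Cnt e (fun v => v ≠ A ∧ ∃ w, DR G A (e.rk i) w ∧ (w = v ∨ G w v)) 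
    (fun v => v = A ∨ NotIn e G A i c v) c'

theorem nextC_iff [Finite α] (e : AEnum α) (G : α → α → Prop) (A : α) (i c c' : α) 
    (hc : e.rk c = {u | u ≠ A ∧ DR G A (e.rk i) u}.ncard) : 
    NextC e G A i c c' ↔ e.rk c' = {u | u ≠ A ∧ DR G A (e.rk i + 1) u}.ncard := by
  unfold NextC Cnt
  simp only [notIn_iff e G A i c _ hc]
  constructor
  · rintro ⟨S, h1, h2, h3⟩
    rw [← h3]
    congr 1
    ext u
    constructor
    · intro hu
      exact h1 u hu
    · rintro ⟨h4, h5⟩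
      by_contra hu
      rcases h2 u hu with h | h
      · exact h4 h
      · exact h h5
  · intro h
    refine ⟨_, fun u hu => hu, fun u hu => ?_, h.symm⟩
    by_contra hh
    push Not at hh
    exact hu hh

theorem not_rtg_iff [Finite α] (e : AEnum α) (G : α → α → Prop) (A B : α) :
    ¬ Relation.ReflTransGen G A B ↔ ∃ z i c, e.rk z = 0 ∧ 
      Relation.ReflTransGen (fun p q : α × α => e.rk q.1 = e.rk p.1 + 1 ∧ NextC e G A p.1 p.2 q.2) 
        (z, z) (i, c) ∧ e.rk i + 1 = e.N ∧ NotIn e G A i c B := by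
  rw [← DR_card]
  have inv : ∀ z p, e.rk z = 0 → 
      Relation.ReflTransGen (fun p q : α × α => e.rk q.1 = e.rk p.1 + 1 ∧ NextC e G A p.1 p.2 q.2) 
        (z, z) p → e.rk p.2 = {u | u ≠ A ∧ DR G A (e.rk p.1) u}.ncard := by
    intro z p hz hp
    induction hp with
    | refl => 
      have : {u | u ≠ A ∧ DR G A 0 u} = ∅ := by
        ext u
        simp [DR]
      simp only [hz]
      rw [this]; simp
    | tail _ hs ih =>
      obtain ⟨h1, h2⟩ := hs
      rw [h1]
      exact (nextC_iff e G A _ _ _ ih).1 h2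
  constructor
  · intro h
    have h0 : 0 < e.N := by have := e.lt A; omega
    obtain ⟨z, hz⟩ := e.surj 0 h0
    have path : ∀ n, n < e.N → ∃ i c, e.rk i = n ∧ 
        Relation.ReflTransGen (fun p q : α × α => e.rk q.1 = e.rk p.1 + 1 ∧ NextC e G A p.1 p.2 q.2) 
        (z, z) (i, c) := by
      intro n
      induction n with
      | zero => exact fun _ => ⟨z, z, hz, Relation.ReflTransGen.refl⟩
      | succ n ih =>
        intro hn
        obtain ⟨i, c, rfl, hp⟩ := ih (by omega)
        obtain ⟨i', hi'⟩ := e.surj _ hn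
        have hlt : {u | u ≠ A ∧ DR G A (e.rk i + 1) u}.ncard < e.N := by
          rw [← e.card, ← Set.ncard_univ]
          refine Set.ncard_lt_ncard ⟨Set.subset_univ _, fun hs => ?_⟩ (Set.toFinite _)
          exact (hs (Set.mem_univ A)).1 rfl
        obtain ⟨c', hc'⟩ := e.surj _ hlt
        exact ⟨i', c', hi', hp.tail ⟨hi', (nextC_iff e G A _ _ _ (inv _ _ hz hp)).2 hc'⟩⟩
    obtain ⟨i, c, hi, hp⟩ := path (e.N - 1) (by omega)
    refine ⟨z, i, c, hz, hp, by omega, (notIn_iff e G A _ _ _ (inv _ _ hz hp)).2 ?_⟩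
    rwa [show e.rk i + 1 = Nat.card α by rw [e.card]; omega]
  · rintro ⟨z, i, c, hz, hp, hN, hn⟩
    have := (notIn_iff e G A _ _ _ (inv _ _ hz hp)).1 hn
    rwa [hN, ← e.card] at this

theorem DR_walk (e : AEnum α) (G : α → α → Prop) (A i v : α) :
    DR G A (e.rk i) v ↔ ∃ z, e.rk z = 0 ∧ Relation.ReflTransGen 
      (fun p q : α × α => e.rk q.1 = e.rk p.1 + 1 ∧ (p.2 = q.2 ∨ G p.2 q.2)) (z, A) (i, v) := by
  constructor
  · intro h
    have h0 : 0 < e.N := by have := e.lt A; omega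
    obtain ⟨z, hz⟩ := e.surj 0 h0
    refine ⟨z, hz, ?_⟩
    generalize hn : e.rk i = n at h
    induction n generalizing i v with
    | zero =>
      rw [show v = A from h, e.inj i z (by omega)]
    | succ n ih =>
      obtain ⟨w, h1, h2⟩ := h
      obtain ⟨j, hj⟩ := e.surj n (by have := e.lt i; omega)
      refine (ih j w hj h1).tail ⟨by simp only; omega, h2⟩
  · rintro ⟨z, hz, h⟩
    have : ∀ p, Relation.ReflTransGen 
      (fun p q : α × α => e.rk q.1 = e.rk p.1 + 1 ∧ (p.2 = q.2 ∨ G p.2 q.2)) (z, A) p → 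
      DR G A (e.rk p.1) p.2 := by
      intro p hp
      induction hp with
      | refl => simp [hz, DR]
      | tail _ hs ih =>
        rw [hs.1]
        exact ⟨_, ih, hs.2⟩
    exact this _ h

end Abstract
end NestedPebbles

namespace NestedPebbles

section IS
variable {Sig : Type} {rank : Sig → ℕ} [Fintype Sig] {V W U U' : Type} [Fintype U] [Fintype U']

theorem rtg_pair {α : Type} {E : (U → α) → (U' → α) → (U → α) → (U' → α) → Prop} {a b : U ⊕ U' → α} :
    Relation.ReflTransGen (fun a b : U ⊕ U' → α => E (fun u => a (.inl u)) (fun u => a (.inr u)) 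
      (fun u => b (.inl u)) (fun u => b (.inr u))) a b ↔ 
    Relation.ReflTransGen (fun p q : (U → α) × (U' → α) => E p.1 p.2 q.1 q.2) 
      (fun u => a (.inl u), fun u => a (.inr u)) (fun u => b (.inl u), fun u => b (.inr u)) := by
  constructor
  · intro h
    exact Relation.ReflTransGen.lift (p := fun p q : (U → α) × (U' → α) => E p.1 p.2 q.1 q.2)
      (fun a : U ⊕ U' → α => (fun u => a (.inl u), fun u => a (.inr u))) (fun _ _ h => h) _ _ h
  · intro h
    have := Relation.ReflTransGen.lift (p := fun a b : U ⊕ U' → α => E (fun u => a (.inl u)) 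
      (fun u => a (.inr u)) (fun u => b (.inl u)) (fun u => b (.inr u)))
      (fun p : (U → α) × (U' → α) => Sum.elim p.1 p.2) (fun _ _ h => h) _ _ h
    have e : ∀ a : U ⊕ U' → α, Sum.elim (fun u => a (.inl u)) (fun u => a (.inr u)) = a := by
      intro a; funext u; cases u <;> rfl
    simp only [Function.onFun, e] at this
    exact this

theorem Rec.tc2 {E : ∀ t : RTree Sig rank, (V → Pos t) → (U → Pos t) → (U' → Pos t) → 
      (U → Pos t) → (U' → Pos t) → Prop}
    (H : Rec (fun t (ν : V ⊕ ((U ⊕ U') ⊕ (U ⊕ U')) → Pos t) => E t (fun v => ν (.inl v))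
      (fun u => ν (.inr (.inl (.inl u)))) (fun u => ν (.inr (.inl (.inr u))))
      (fun u => ν (.inr (.inr (.inl u)))) (fun u => ν (.inr (.inr (.inr u)))))) 
    (x : U → V) (x' : U' → V) (y : U → V) (y' : U' → V) :
    Rec (fun t ν => Relation.ReflTransGen 
      (fun p q : (U → Pos t) × (U' → Pos t) => E t ν p.1 p.2 q.1 q.2)
      (fun u => ν (x u), fun u => ν (x' u)) (fun u => ν (y u), fun u => ν (y' u))) :=
  (Rec.tc (E := fun t ν a b => E t ν (fun u => a (.inl u)) (fun u => a (.inr u)) 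
      (fun u => b (.inl u)) (fun u => b (.inr u))) H (Sum.elim x x') (Sum.elim y y')).congr 
    (fun _ _ => rtg_pair)

/-- The abstract enumeration of tuples of nodes in `t`. -/
def Enum.at (e : Enum rank U) (t : RTree Sig rank) : AEnum (U → Pos t) :=
  ⟨e.rk t, e.N t, e.inj t, e.lt t, e.surj t⟩

theorem Enum.rFirst (e : Enum rank U) (x : U → V) : 
    Rec (fun t (ν : V → Pos t) => (e.at t).rk (fun u => ν (x u)) = 0) := e.first.subst x

theorem Enum.rSuc (e : Enum rank U) (x y : U → V) : 
    Rec (fun t (ν : V → Pos t) => (e.at t).rk (fun u => ν (y u)) = (e.at t).rk (fun u => ν (x u)) + 1) := 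
  e.suc.subst (Sum.elim x y)

theorem Enum.rLast (e : Enum rank U) (x : U → V) : 
    Rec (fun t (ν : V → Pos t) => (e.at t).rk (fun u => ν (x u)) + 1 = (e.at t).N) := e.last.subst x

theorem Rec.ne (x y : U → V) : 
    Rec (fun (t : RTree Sig rank) (ν : V → Pos t) => (fun u => ν (x u)) ≠ (fun u => ν (y u))) := by
  obtain ⟨e⟩ := enum_exists (rank := rank) U
  have key : ∀ x y : U → V, Rec (fun (t : RTree Sig rank) (ν : V → Pos t) => 
      ∃ z, (e.at t).rk z = (e.at t).rk (fun u => ν (x u)) + 1 ∧ 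
      Relation.ReflTransGen (fun x y => (e.at t).rk y = (e.at t).rk x + 1) z (fun u => ν (y u))) := by
    intro x y
    refine Rec.ex ?_
    refine Rec.and (e.rSuc (fun u => Sum.inl (x u)) (fun u => Sum.inr u)) ?_
    refine Rec.tc (E := fun t _ x y => (e.at t).rk y = (e.at t).rk x + 1) ?_ 
      (fun u => Sum.inr u) (fun u => Sum.inl (y u))
    exact e.rSuc _ _
  refine ((key x y).or (key y x)).congr fun t ν => ?_
  simp only [AEnum.suc_path]
  constructor
  · rintro (⟨z, h1, h2⟩ | ⟨z, h1, h2⟩) heq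
    · rw [heq] at h1; omega
    · rw [← heq] at h1; omega
  · intro hne
    rcases lt_trichotomy ((e.at t).rk (fun u => ν (x u))) ((e.at t).rk (fun u => ν (y u))) with h | h | h
    · left
      obtain ⟨z, hz⟩ := (e.at t).surj _ (lt_of_le_of_lt h ((e.at t).lt _))
      exact ⟨z, hz, by omega⟩
    · exact absurd ((e.at t).inj _ _ h) hne
    · right
      obtain ⟨z, hz⟩ := (e.at t).surj _ (lt_of_le_of_lt h ((e.at t).lt _))
      exact ⟨z, hz, by omega⟩

theorem Rec.ne1 (v w : V) :
    Rec (fun (t : RTree Sig rank) (ν : V → Pos t) => ν v ≠ ν w) := 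
  (Rec.ne (fun _ : Unit => v) (fun _ : Unit => w)).congr fun t ν => by 
    simp [funext_iff]

theorem Rec.cnt (e : Enum rank U) {P Q : ∀ t : RTree Sig rank, (W → Pos t) → (U → Pos t) → Prop}
    (HP : Rec (fun t (ν : W ⊕ U → Pos t) => P t (fun v => ν (.inl v)) (fun u => ν (.inr u))))
    (HQ : Rec (fun t (ν : W ⊕ U → Pos t) => Q t (fun v => ν (.inl v)) (fun u => ν (.inr u))))
    (c : U → W) :
    Rec (fun t (ν : W → Pos t) => Cnt (e.at t) (P t ν) (Q t ν) (fun u => ν (c u))) := by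
  have key : Rec (fun t (ν : W → Pos t) => ∃ z u m, (e.at t).rk z = 0 ∧ Relation.ReflTransGen 
      (fun p q : (U → Pos t) × (U → Pos t) => (e.at t).rk q.1 = (e.at t).rk p.1 + 1 ∧ 
        ((P t ν p.1 ∧ (e.at t).rk q.2 = (e.at t).rk p.2 + 1) ∨ (Q t ν p.1 ∧ p.2 = q.2))) 
        (z, z) (u, m) ∧
      (e.at t).rk u + 1 = (e.at t).N ∧ ((P t ν u ∧ (e.at t).rk (fun u => ν (c u)) = (e.at t).rk m + 1) 
        ∨ (Q t ν u ∧ m = fun u => ν (c u)))) := by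
    refine Rec.ex (Rec.ex (Rec.ex ?_))
    refine Rec.and (e.rFirst (fun u => Sum.inl (Sum.inl (Sum.inr u)))) (Rec.and ?_ (Rec.and 
      (e.rLast (fun u => Sum.inl (Sum.inr u))) (Rec.or (Rec.and ?_ ?_) (Rec.and ?_ ?_))))
    · refine Rec.tc2 (E := fun t (ν : ((W ⊕ U) ⊕ U) ⊕ U → Pos t) p1 p2 q1 q2 => 
        (e.at t).rk q1 = (e.at t).rk p1 + 1 ∧ 
        ((P t (fun w => ν (.inl (.inl (.inl w)))) p1 ∧ (e.at t).rk q2 = (e.at t).rk p2 + 1) ∨ 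
          (Q t (fun w => ν (.inl (.inl (.inl w)))) p1 ∧ p2 = q2))) ?_ 
        (fun u => Sum.inl (Sum.inl (Sum.inr u))) (fun u => Sum.inl (Sum.inl (Sum.inr u)))
        (fun u => Sum.inl (Sum.inr u)) (fun u => Sum.inr u)
      refine Rec.and (e.rSuc _ _) (Rec.or (Rec.and ?_ (e.rSuc _ _)) (Rec.and ?_ (Rec.eq _ _)))
      · exact HP.subst (Sum.elim (fun w => Sum.inl (Sum.inl (Sum.inl (Sum.inl w)))) 
          (fun u => Sum.inr (Sum.inl (Sum.inl u))))
      · exact HQ.subst (Sum.elim (fun w => Sum.inl (Sum.inl (Sum.inl (Sum.inl w)))) 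
          (fun u => Sum.inr (Sum.inl (Sum.inl u))))
    · exact HP.subst (Sum.elim (fun w => Sum.inl (Sum.inl (Sum.inl w))) 
          (fun u => Sum.inl (Sum.inr u)))
    · exact e.rSuc (fun u => Sum.inr u) (fun u => Sum.inl (Sum.inl (Sum.inl (c u))))
    · exact HQ.subst (Sum.elim (fun w => Sum.inl (Sum.inl (Sum.inl w))) 
          (fun u => Sum.inl (Sum.inr u)))
    · exact Rec.eq (fun u => Sum.inr u) (fun u => Sum.inl (Sum.inl (Sum.inl (c u))))
  refine key.congr fun t ν => ?_
  have := (e.at t).finite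
  rw [cnt_iff]
  rfl

theorem Rec.forall {P : ∀ t : RTree Sig rank, (W → Pos t) → (U → Pos t) → Prop}
    (HP : Rec (fun t (ν : W ⊕ U → Pos t) => P t (fun v => ν (.inl v)) (fun u => ν (.inr u)))) :
    Rec (fun t (ν : W → Pos t) => ∀ u, P t ν u) := by
  obtain ⟨e⟩ := enum_exists (rank := rank) U
  have key : Rec (fun t (ν : W → Pos t) => ∃ z, (e.at t).rk z = 0 ∧ 
      Cnt (e.at t) (fun _ => False) (P t ν) z) := by
    refine Rec.ex (Rec.and (e.rFirst (fun u => Sum.inr u)) ?_)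
    refine Rec.cnt e (P := fun _ _ _ => False) (Q := fun t (ν : W ⊕ U → Pos t) u => 
      P t (fun w => ν (.inl w)) u) Rec.false ?_ (fun u => Sum.inr u)
    exact HP.subst (Sum.elim (fun w => Sum.inl (Sum.inl w)) Sum.inr)
  refine key.congr fun t ν => ?_
  constructor
  · rintro ⟨z, h1, S, h2, h3, h4⟩ u
    exact h3 u fun h => h2 u h
  · intro h
    have h0 : 0 < (e.at t).N := by have := (e.at t).lt (fun _ => rootPos t); omega
    obtain ⟨z, hz⟩ := (e.at t).surj 0 h0
    exact ⟨z, hz, ∅, by simp, fun u _ => h u, by simp [hz]⟩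

variable {G : ∀ t : RTree Sig rank, (V → Pos t) → (U → Pos t) → (U → Pos t) → Prop}

theorem Rec.DR (e : Enum rank U) 
    (HG : Rec (fun t (ν : V ⊕ (U ⊕ U) → Pos t) => G t (fun v => ν (.inl v))
      (fun u => ν (.inr (.inl u))) (fun u => ν (.inr (.inr u))))) (f : V → W) (a i v : U → W) : 
    Rec (fun t (ν : W → Pos t) => NestedPebbles.DR (G t (fun x => ν (f x))) (fun u => ν (a u)) 
      ((e.at t).rk (fun u => ν (i u))) (fun u => ν (v u))) := by
  simp only [DR_walk]
  refine Rec.ex (Rec.and (e.rFirst (fun u => Sum.inr u)) ?_)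
  refine Rec.tc2 (E := fun t (ν : W ⊕ U → Pos t) p1 p2 q1 q2 => (e.at t).rk q1 = (e.at t).rk p1 + 1 ∧ 
    (p2 = q2 ∨ G t (fun x => ν (.inl (f x))) p2 q2)) ?_ Sum.inr (fun u => Sum.inl (a u)) 
    (fun u => Sum.inl (i u)) (fun u => Sum.inl (v u))
  refine Rec.and (e.rSuc _ _) (Rec.or (Rec.eq _ _) ?_)
  exact HG.subst (Sum.elim (fun x => Sum.inl (Sum.inl (f x))) (Sum.elim 
    (fun u => Sum.inr (Sum.inl (Sum.inr u))) (fun u => Sum.inr (Sum.inr (Sum.inr u)))))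

theorem Rec.notIn (e : Enum rank U) 
    (HG : Rec (fun t (ν : V ⊕ (U ⊕ U) → Pos t) => G t (fun v => ν (.inl v))
      (fun u => ν (.inr (.inl u))) (fun u => ν (.inr (.inr u))))) 
    (HN : Rec (fun t (ν : V ⊕ (U ⊕ U) → Pos t) => ¬ G t (fun v => ν (.inl v))
      (fun u => ν (.inr (.inl u))) (fun u => ν (.inr (.inr u))))) (f : V → W) (a i c v : U → W) : 
    Rec (fun t (ν : W → Pos t) => NotIn (e.at t) (G t (fun x => ν (f x))) (fun u => ν (a u)) 
      (fun u => ν (i u)) (fun u => ν (c u)) (fun u => ν (v u))) := by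
  refine Rec.and ?_ (Rec.and (Rec.ne _ _) (HN.subst (Sum.elim f (Sum.elim a v))))
  refine Rec.cnt e (P := fun t (ν : W → Pos t) u => u ≠ (fun u => ν (a u)) ∧ 
    NestedPebbles.DR (G t (fun x => ν (f x))) (fun u => ν (a u)) ((e.at t).rk (fun u => ν (i u))) u ∧ 
    u ≠ (fun u => ν (v u)) ∧ ¬ G t (fun x => ν (f x)) u (fun u => ν (v u))) 
    (Q := fun _ _ _ => True) ?_ Rec.true c
  refine Rec.and (Rec.ne Sum.inr (fun u => Sum.inl (a u))) (Rec.and ?_ 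
    (Rec.and (Rec.ne Sum.inr (fun u => Sum.inl (v u))) ?_))
  · exact Rec.DR e HG (fun x => Sum.inl (f x)) (fun u => Sum.inl (a u)) (fun u => Sum.inl (i u)) Sum.inr
  · exact HN.subst (Sum.elim (fun x => Sum.inl (f x)) (Sum.elim Sum.inr (fun u => Sum.inl (v u))))

theorem Rec.nextC (e : Enum rank U) 
    (HG : Rec (fun t (ν : V ⊕ (U ⊕ U) → Pos t) => G t (fun v => ν (.inl v))
      (fun u => ν (.inr (.inl u))) (fun u => ν (.inr (.inr u))))) 
    (HN : Rec (fun t (ν : V ⊕ (U ⊕ U) → Pos t) => ¬ G t (fun v => ν (.inl v))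
      (fun u => ν (.inr (.inl u))) (fun u => ν (.inr (.inr u))))) (f : V → W) (a i c c' : U → W) : 
    Rec (fun t (ν : W → Pos t) => NextC (e.at t) (G t (fun x => ν (f x))) (fun u => ν (a u)) 
      (fun u => ν (i u)) (fun u => ν (c u)) (fun u => ν (c' u))) := by
  refine Rec.cnt e (P := fun t (ν : W → Pos t) v => v ≠ (fun u => ν (a u)) ∧ 
    ∃ w, NestedPebbles.DR (G t (fun x => ν (f x))) (fun u => ν (a u)) ((e.at t).rk (fun u => ν (i u))) w ∧ 
    (w = v ∨ G t (fun x => ν (f x)) w v)) 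
    (Q := fun t (ν : W → Pos t) v => v = (fun u => ν (a u)) ∨ NotIn (e.at t) (G t (fun x => ν (f x))) 
      (fun u => ν (a u)) (fun u => ν (i u)) (fun u => ν (c u)) v) ?_ ?_ c'
  · refine Rec.and (Rec.ne Sum.inr (fun u => Sum.inl (a u))) (Rec.ex (Rec.and ?_ (Rec.or ?_ ?_)))
    · exact Rec.DR e HG (fun x => Sum.inl (Sum.inl (f x))) (fun u => Sum.inl (Sum.inl (a u))) 
        (fun u => Sum.inl (Sum.inl (i u))) Sum.inr
    · exact Rec.eq (fun u => Sum.inr u) (fun u => Sum.inl (Sum.inr u))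
    · exact HG.subst (Sum.elim (fun x => Sum.inl (Sum.inl (f x))) (Sum.elim Sum.inr 
        (fun u => Sum.inl (Sum.inr u))))
  · refine Rec.or (Rec.eq Sum.inr (fun u => Sum.inl (a u))) ?_
    exact Rec.notIn e HG HN (fun x => Sum.inl (f x)) (fun u => Sum.inl (a u)) (fun u => Sum.inl (i u)) 
      (fun u => Sum.inl (c u)) Sum.inr

/-- Immerman–Szelepcsényi: the complement of a transitive closure is recognizable. -/
theorem Rec.notTC 
    (HG : Rec (fun t (ν : V ⊕ (U ⊕ U) → Pos t) => G t (fun v => ν (.inl v))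
      (fun u => ν (.inr (.inl u))) (fun u => ν (.inr (.inr u))))) 
    (HN : Rec (fun t (ν : V ⊕ (U ⊕ U) → Pos t) => ¬ G t (fun v => ν (.inl v))
      (fun u => ν (.inr (.inl u))) (fun u => ν (.inr (.inr u))))) (a b : U → V) : 
    Rec (fun t (ν : V → Pos t) => 
      ¬ Relation.ReflTransGen (G t ν) (fun u => ν (a u)) (fun u => ν (b u))) := by
  obtain ⟨e⟩ := enum_exists (rank := rank) U
  have key : Rec (fun t (ν : V → Pos t) => ∃ z i c, (e.at t).rk z = 0 ∧ 
      Relation.ReflTransGen (fun p q : (U → Pos t) × (U → Pos t) => (e.at t).rk q.1 = (e.at t).rk p.1 + 1 ∧ 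
        NextC (e.at t) (G t ν) (fun u => ν (a u)) p.1 p.2 q.2) 
        (z, z) (i, c) ∧ (e.at t).rk i + 1 = (e.at t).N ∧ 
          NotIn (e.at t) (G t ν) (fun u => ν (a u)) i c (fun u => ν (b u))) := by
    refine Rec.ex (Rec.ex (Rec.ex (Rec.and (e.rFirst (fun u => Sum.inl (Sum.inl (Sum.inr u)))) (Rec.and ?_ 
      (Rec.and (e.rLast (fun u => Sum.inl (Sum.inr u))) ?_)))))
    · refine Rec.tc2 (E := fun t (ν : ((V ⊕ U) ⊕ U) ⊕ U → Pos t) p1 p2 q1 q2 => 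
        (e.at t).rk q1 = (e.at t).rk p1 + 1 ∧ 
        NextC (e.at t) (G t (fun x => ν (.inl (.inl (.inl x))))) (fun u => ν (.inl (.inl (.inl (a u))))) 
          p1 p2 q2) ?_ (fun u => Sum.inl (Sum.inl (Sum.inr u))) (fun u => Sum.inl (Sum.inl (Sum.inr u)))
        (fun u => Sum.inl (Sum.inr u)) (fun u => Sum.inr u)
      refine Rec.and (e.rSuc _ _) ?_
      exact Rec.nextC e HG HN (fun x => Sum.inl (Sum.inl (Sum.inl (Sum.inl x)))) 
        (fun u => Sum.inl (Sum.inl (Sum.inl (Sum.inl (a u))))) (fun u => Sum.inr (Sum.inl (Sum.inl u)))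
        (fun u => Sum.inr (Sum.inl (Sum.inr u))) (fun u => Sum.inr (Sum.inr (Sum.inr u)))
    · exact Rec.notIn e HG HN (fun x => Sum.inl (Sum.inl (Sum.inl x))) 
        (fun u => Sum.inl (Sum.inl (Sum.inl (a u)))) (fun u => Sum.inl (Sum.inr u)) Sum.inr 
        (fun u => Sum.inl (Sum.inl (Sum.inl (b u))))
  refine key.congr fun t ν => ?_
  have := (e.at t).finite
  rw [not_rtg_iff (e.at t)]

end IS
end NestedPebbles

namespace NestedPebbles

section ToRec
variable {Sig : Type} {rank : Sig → ℕ} [Fintype Sig] {V W : Type}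

theorem Rec.forall1 {R : ∀ t : RTree Sig rank, (V → Pos t) → Pos t → Prop}
    (H : Rec (fun t (ν : V ⊕ Unit → Pos t) => R t (fun v => ν (.inl v)) (ν (.inr ())))) :
    Rec (fun t ν => ∀ y, R t ν y) :=
  (Rec.forall (P := fun t ν y => R t ν (y ())) H).congr fun _ _ => 
    ⟨fun h y => h (fun _ => y), fun h y => h (y ())⟩

theorem Rec.nlab (v : V) (a : Sig) :
    Rec (fun (t : RTree Sig rank) (ν : V → Pos t) => ¬ labelAt t (ν v).1 = some a) := by
  refine (Rec.finEx (ι := {b : Sig // b ≠ a}) (fun b => Rec.lab v b.1)).congr fun t ν => ?_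
  constructor
  · rintro ⟨⟨b, hb⟩, h⟩ h'
    simp only at h
    rw [h] at h'
    exact hb (Option.some.inj h')
  · intro h
    obtain ⟨b, hb⟩ := labelAt_pos (ν v)
    exact ⟨⟨b, fun e => h (e ▸ hb)⟩, hb⟩

theorem Rec.nedg (j : ℕ) (v w : V) :
    Rec (fun (t : RTree Sig rank) (ν : V → Pos t) => ¬ (ν w).1 = (ν v).1 ++ [j]) := by
  have key : Rec (fun (t : RTree Sig rank) (ν : V → Pos t) => ν w = rootPos t ∨ 
      ∃ z : Pos t, ∃ i : Fin (maxRank Sig rank), (ν w).1 = z.1 ++ [i.1] ∧ (i.1 ≠ j ∨ z ≠ ν v)) := by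
    refine Rec.or (Rec.root w) (Rec.ex1 (Rec.finEx fun i => ?_))
    exact Rec.and (Rec.edg i.1 (Sum.inr ()) (Sum.inl w)) 
      (Rec.or (Rec.const _) (Rec.ne1 (Sum.inr ()) (Sum.inl v)))
  refine key.congr fun t ν => ?_
  constructor
  · rintro (h | ⟨z, i, h1, h2⟩) h'
    · rw [h] at h'; simp [rootPos] at h'
    · rw [h1] at h'
      have := List.append_inj' h' rfl
      rcases h2 with h2 | h2
      · exact h2 (by simpa using this.2)
      · exact h2 (pos_ext this.1)
  · intro h
    rcases List.eq_nil_or_concat (ν w).1 with h0 | ⟨p, i, hp⟩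
    · left; exact pos_ext h0
    · right
      rw [List.concat_eq_append] at hp
      have hw : IsPos t (ν w).1 := (ν w).2
      rw [hp] at hw
      refine ⟨mkPos t p (isPos_left hw), ⟨i, isPos_lt hw⟩, hp, ?_⟩
      by_contra hc
      push Not at hc
      apply h
      rw [hp, ← hc.2, ← hc.1]; rfl

/-- The child relation. -/
def ChildRel (t : RTree Sig rank) (a b : Pos t) : Prop := 
  ∃ j : Fin (maxRank Sig rank), b.1 = a.1 ++ [j.1]

theorem child_rtg {t : RTree Sig rank} {x y : Pos t} : 
    Relation.ReflTransGen (ChildRel t) x y ↔ x.1 <+: y.1 := by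
  constructor
  · intro h
    induction h with
    | refl => exact List.prefix_rfl
    | tail _ h ih => 
      obtain ⟨j, hj⟩ := h
      rw [hj]
      exact ih.trans (List.prefix_append _ _)
  · rintro ⟨s, hs⟩
    induction s using List.reverseRecOn generalizing y with
    | nil => 
      have : x = y := pos_ext (by simpa using hs)
      rw [this]
    | append_singleton s j ih =>
      have hy : IsPos t (x.1 ++ s ++ [j]) := by
        rw [List.append_assoc, hs]; exact y.2
      have := ih (y := mkPos t (x.1 ++ s) (isPos_left hy)) rfl
      refine this.tail ⟨⟨j, isPos_lt hy⟩, ?_⟩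
      rw [← hs, ← List.append_assoc]; rfl

theorem upd_comp {α β : Type} {k : ℕ} (h : α → β) (ν : ℕ → α) (xs : Fin k → ℕ) (a : Fin k → α) (n : ℕ) :
    h (updVec ν xs a n) = updVec (fun n => h (ν n)) xs (fun i => h (a i)) n := by
  unfold updVec
  split <;> rfl

theorem update_comp {α β : Type} (h : α → β) (ν : ℕ → α) (x : ℕ) (a : α) (n : ℕ) :
    h (Function.update ν x a n) = Function.update (fun n => h (ν n)) x (h a) n := by
  by_cases hn : n = x
  · subst hn; simp
  · simp [Function.update_of_ne hn]

theorem sat_rec {k : ℕ} (φ : TForm Sig rank k) : 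
    Rec (fun t ν => Sat t φ ν) ∧ Rec (fun t ν => ¬ Sat t φ ν) := by
  have H1 : ∀ (x : ℕ) (R : ∀ t : RTree Sig rank, (ℕ → Pos t) → Prop), Rec R → 
      Rec (fun t (ν : ℕ ⊕ Unit → Pos t) => 
        R t (Function.update (fun v => ν (.inl v)) x (ν (.inr ())))) := by
    intro x R H
    refine (H.subst (Function.update Sum.inl x (Sum.inr ()))).congr fun t ν => ?_
    have : (fun v => ν (Function.update Sum.inl x (Sum.inr ()) v)) = 
      (Function.update (fun v => ν (.inl v)) x (ν (.inr ()))) := funext fun n => update_comp ν _ _ _ n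
    rw [this]
  have H2 : ∀ (xs ys : Fin k → ℕ) (R : ∀ t : RTree Sig rank, (ℕ → Pos t) → Prop), Rec R → 
      Rec (fun t (ν : ℕ ⊕ (Fin k ⊕ Fin k) → Pos t) => 
        R t (updVec (updVec (fun v => ν (.inl v)) xs (fun u => ν (.inr (.inl u)))) 
          ys (fun u => ν (.inr (.inr u))))) := by
    intro xs ys R H
    refine (H.subst (updVec (updVec Sum.inl xs (fun u => Sum.inr (Sum.inl u))) ys 
      (fun u => Sum.inr (Sum.inr u)))).congr fun t ν => ?_
    have : (fun v => ν (updVec (updVec Sum.inl xs (fun u => Sum.inr (Sum.inl u))) ys 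
      (fun u => Sum.inr (Sum.inr u)) v)) = (updVec (updVec (fun v => ν (.inl v)) xs 
        (fun u => ν (.inr (.inl u)))) ys (fun u => ν (.inr (.inr u)))) := by
      funext n
      rw [upd_comp ν]
      congr 1
      funext m
      rw [upd_comp ν]
    rw [this]
  induction φ with
  | lab a x => exact ⟨Rec.lab x a, Rec.nlab x a⟩
  | edg i x y => 
    refine ⟨Rec.and (Rec.const _) (Rec.edg _ x y), ?_⟩
    refine (Rec.or (Rec.const (¬ 1 ≤ i)) (Rec.nedg (i - 1) x y)).congr fun t ν => ?_
    simp only [Sat]; tauto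
  | le x y => 
    have A : Rec (fun t (ν : ℕ ⊕ (Unit ⊕ Unit) → Pos t) => ChildRel (rank := rank) t 
        (ν (.inr (.inl ()))) (ν (.inr (.inr ())))) := Rec.finEx fun j => Rec.edg _ _ _
    have B : Rec (fun t (ν : ℕ ⊕ (Unit ⊕ Unit) → Pos t) => ¬ ChildRel (rank := rank) t 
        (ν (.inr (.inl ()))) (ν (.inr (.inr ())))) := 
      (Rec.finAll fun j : Fin (maxRank Sig rank) => Rec.nedg j.1 (Sum.inr (Sum.inl ())) (Sum.inr (Sum.inr ()))).congr 
        fun t ν => by simp [ChildRel]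
    constructor
    · exact (Rec.tc1 (E := fun t _ a b => ChildRel t a b) A x y).congr fun t ν => child_rtg
    · refine (Rec.notTC (G := fun t _ a b => ChildRel t (a ()) (b ())) A B 
        (fun _ : Unit => x) (fun _ : Unit => y)).congr fun t ν => ?_
      exact not_congr (rtg_unit.trans child_rtg)
  | eq x y => exact ⟨Rec.eq1 x y, Rec.ne1 x y⟩
  | not φ ih => exact ⟨ih.2, ih.1.congr fun t ν => by simp [Sat]⟩
  | and φ ψ ih1 ih2 => 
    exact ⟨Rec.and ih1.1 ih2.1, (Rec.or ih1.2 ih2.2).congr fun t ν => by simp only [Sat]; tauto⟩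
  | or φ ψ ih1 ih2 => 
    exact ⟨Rec.or ih1.1 ih2.1, (Rec.and ih1.2 ih2.2).congr fun t ν => by simp only [Sat]; tauto⟩
  | ex x φ ih => 
    refine ⟨Rec.ex1 (R := fun t ν u => Sat t φ (Function.update ν x u)) (H1 x _ ih.1), 
      (Rec.forall1 (R := fun t ν u => ¬ Sat t φ (Function.update ν x u)) (H1 x _ ih.2)).congr
        fun t ν => by simp [Sat]⟩
  | all x φ ih => 
    refine ⟨Rec.forall1 (R := fun t ν u => Sat t φ (Function.update ν x u)) (H1 x _ ih.1), 
      (Rec.ex1 (R := fun t ν u => ¬ Sat t φ (Function.update ν x u)) (H1 x _ ih.2)).congr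
        fun t ν => by simp [Sat]⟩
  | tc xs ys φ us vs ih => 
    exact ⟨Rec.tc (E := fun t ν a b => Sat t φ (updVec (updVec ν xs a) ys b)) (H2 xs ys _ ih.1) us vs, 
      Rec.notTC (G := fun t ν a b => Sat t φ (updVec (updVec ν xs a) ys b)) (H2 xs ys _ ih.1) 
        (H2 xs ys _ ih.2) us vs⟩

theorem FOTC_NTWA {k : ℕ} {L : Set (RTree Sig rank)} (h : L ∈ FOTC Sig rank k) : 
    (∃ k, 1 ≤ k ∧ L ∈ NTWA Sig rank k) ∧ (∃ k, 1 ≤ k ∧ Lᶜ ∈ NTWA Sig rank k) := by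
  obtain ⟨φ, _, _, rfl⟩ := h
  exact ⟨(sat_rec φ).1.toNTWA, (sat_rec φ).2.toNTWA⟩

end ToRec
end NestedPebbles

namespace NestedPebbles

section Definable
variable {Sig : Type} {rank : Sig → ℕ} {V W : Type} {K : ℕ}

/-- Relations on nodes definable in first-order logic with `K`-ary transitive closure. -/
def Dfn (K : ℕ) (R : ∀ t : RTree Sig rank, (V → Pos t) → Prop) : Prop :=
  ∀ (f : V → ℕ) (b : ℕ), (∀ v, f v < b) → ∃ φ : TForm Sig rank K, WF φ ∧ 
    freeVars φ ⊆ Set.range f ∧ ∀ t (ν : ℕ → Pos t), Sat t φ ν ↔ R t (fun v => ν (f v))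

theorem Dfn.congr {R R' : ∀ t : RTree Sig rank, (V → Pos t) → Prop} (H : Dfn K R)
    (h : ∀ t ν, R t ν ↔ R' t ν) : Dfn K R' := by
  have : R = R' := by
    funext t ν
    exact propext (h t ν)
  rwa [← this]

theorem Dfn.subst {R : ∀ t : RTree Sig rank, (V → Pos t) → Prop} (H : Dfn K R) (g : V → W) :
    Dfn K (fun t (ν : W → Pos t) => R t (fun v => ν (g v))) := by
  intro f b hf
  obtain ⟨φ, h1, h2, h3⟩ := H (fun v => f (g v)) b (fun v => hf _)
  exact ⟨φ, h1, h2.trans (Set.range_comp_subset_range g f), h3⟩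

theorem Dfn.true : Dfn K (fun (t : RTree Sig rank) (_ : V → Pos t) => True) := by
  intro f b _
  exact ⟨.ex 0 (.eq 0 0), trivial, by simp [freeVars], fun t ν => by simp [Sat]; exact ⟨rootPos t⟩⟩

theorem Dfn.not {R : ∀ t : RTree Sig rank, (V → Pos t) → Prop} (H : Dfn K R) :
    Dfn K (fun t ν => ¬ R t ν) := by
  intro f b hf
  obtain ⟨φ, h1, h2, h3⟩ := H f b hf
  exact ⟨.not φ, h1, h2, fun t ν => not_congr (h3 t ν)⟩

theorem Dfn.and {R R' : ∀ t : RTree Sig rank, (V → Pos t) → Prop} (H : Dfn K R) (H' : Dfn K R') :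
    Dfn K (fun t ν => R t ν ∧ R' t ν) := by
  intro f b hf
  obtain ⟨φ, h1, h2, h3⟩ := H f b hf
  obtain ⟨φ', h1', h2', h3'⟩ := H' f b hf
  exact ⟨.and φ φ', ⟨h1, h1'⟩, Set.union_subset h2 h2', fun t ν => and_congr (h3 t ν) (h3' t ν)⟩

theorem Dfn.or {R R' : ∀ t : RTree Sig rank, (V → Pos t) → Prop} (H : Dfn K R) (H' : Dfn K R') :
    Dfn K (fun t ν => R t ν ∨ R' t ν) := by
  intro f b hf
  obtain ⟨φ, h1, h2, h3⟩ := H f b hf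
  obtain ⟨φ', h1', h2', h3'⟩ := H' f b hf
  exact ⟨.or φ φ', ⟨h1, h1'⟩, Set.union_subset h2 h2', fun t ν => or_congr (h3 t ν) (h3' t ν)⟩

theorem Dfn.const (p : Prop) : Dfn K (fun (t : RTree Sig rank) (_ : V → Pos t) => p) := by
  by_cases hp : p
  · simp only [hp]; exact Dfn.true
  · exact (Dfn.not Dfn.true).congr fun _ _ => by simp [hp]

theorem Dfn.lab (v : V) (a : Sig) :
    Dfn K (fun (t : RTree Sig rank) (ν : V → Pos t) => labelAt t (ν v).1 = some a) := by
  intro f b hf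
  exact ⟨.lab a (f v), trivial, by simp [freeVars], fun t ν => Iff.rfl⟩

theorem Dfn.eq (v w : V) :
    Dfn K (fun (t : RTree Sig rank) (ν : V → Pos t) => ν v = ν w) := by
  intro f b hf
  exact ⟨.eq (f v) (f w), trivial, by simp [freeVars, Set.insert_subset_iff], fun t ν => Iff.rfl⟩

theorem Dfn.edg (j : ℕ) (v w : V) :
    Dfn K (fun (t : RTree Sig rank) (ν : V → Pos t) => (ν w).1 = (ν v).1 ++ [j]) := by
  intro f b hf
  exact ⟨.edg (j + 1) (f v) (f w), trivial, by simp [freeVars, Set.insert_subset_iff], 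
    fun t ν => by simp [Sat]⟩

theorem Dfn.le (v w : V) :
    Dfn K (fun (t : RTree Sig rank) (ν : V → Pos t) => (ν v).1 <+: (ν w).1) := by
  intro f b hf
  exact ⟨.le (f v) (f w), trivial, by simp [freeVars, Set.insert_subset_iff], 
    fun t ν => Iff.rfl⟩

theorem Dfn.finAll {ι : Type} [Finite ι] {R : ι → ∀ t : RTree Sig rank, (V → Pos t) → Prop}
    (H : ∀ i, Dfn K (R i)) : Dfn K (fun t ν => ∀ i, R i t ν) := by
  classical
  have := Fintype.ofFinite ι
  have key : ∀ s : Finset ι, Dfn K (fun t ν => ∀ i ∈ s, R i t ν) := by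
    intro s
    induction s using Finset.induction_on with
    | empty => exact Dfn.true.congr fun t ν => by simp
    | insert a s _ ih => exact (Dfn.and (H a) ih).congr fun t ν => by simp
  exact (key Finset.univ).congr fun t ν => by simp

theorem Dfn.finEx {ι : Type} [Finite ι] {R : ι → ∀ t : RTree Sig rank, (V → Pos t) → Prop}
    (H : ∀ i, Dfn K (R i)) : Dfn K (fun t ν => ∃ i, R i t ν) :=
  (Dfn.not (Dfn.finAll fun i => Dfn.not (H i))).congr fun t ν => by simp

theorem Dfn.ex1 {R : ∀ t : RTree Sig rank, (V → Pos t) → Pos t → Prop}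
    (H : Dfn K (fun t (ν : V ⊕ Unit → Pos t) => R t (fun v => ν (.inl v)) (ν (.inr ())))) :
    Dfn K (fun t ν => ∃ y, R t ν y) := by
  intro f b hf
  obtain ⟨φ, h1, h2, h3⟩ := H (Sum.elim f (fun _ => b)) (b + 1) (by
    rintro (v | v)
    · exact (hf v).trans (Nat.lt_succ_self b)
    · simp)
  refine ⟨.ex b φ, h1, ?_, fun t ν => ?_⟩
  · rintro x ⟨hx, hxb⟩
    obtain ⟨v | v, rfl⟩ := h2 hx
    · exact ⟨v, rfl⟩
    · exact absurd rfl hxb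
  · refine exists_congr fun u => ?_
    rw [h3]
    have : (fun v => Function.update ν b u (f v)) = fun v => ν (f v) := 
      funext fun v => Function.update_of_ne (hf v).ne _ _
    simp [this]

theorem Dfn.exFin (n : ℕ) : ∀ {V : Type} {R : ∀ t : RTree Sig rank, (V → Pos t) → (Fin n → Pos t) → Prop}
    (_ : Dfn K (fun t (ν : V ⊕ Fin n → Pos t) => R t (fun v => ν (.inl v)) (fun i => ν (.inr i)))),
    Dfn K (fun t ν => ∃ y, R t ν y) := by
  induction n with
  | zero => 
    intro V R H
    refine (H.subst (W := V) (Sum.elim id (fun i => i.elim0))).congr fun t ν => ?_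
    constructor
    · intro h; exact ⟨_, h⟩
    · rintro ⟨y, h⟩
      convert h using 2
      rfl
  | succ n ih =>
    intro V R H
    have key : Dfn K (fun t (ν : V → Pos t) => ∃ z : Pos t, ∃ y : Fin n → Pos t, R t ν (Fin.cons z y)) := by
      refine Dfn.ex1 (ih ?_)
      refine (H.subst (W := (V ⊕ Unit) ⊕ Fin n) (Sum.elim (fun v => Sum.inl (Sum.inl v)) 
        (Fin.cons (Sum.inl (Sum.inr ())) (fun i => Sum.inr i)))).congr fun t ν => ?_
      have : (fun i => ν (Sum.elim (fun v => Sum.inl (Sum.inl v)) 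
        (Fin.cons (Sum.inl (Sum.inr ())) (fun i => Sum.inr i)) (Sum.inr i : V ⊕ Fin (n+1)))) = 
        (Fin.cons (ν (Sum.inl (Sum.inr ()))) (fun i => ν (Sum.inr i)) : Fin (n+1) → Pos t) := by
        funext i
        refine Fin.cases ?_ (fun i => ?_) i <;> simp
      rw [this]; rfl
    refine key.congr fun t ν => ?_
    constructor
    · rintro ⟨z, y, h⟩; exact ⟨_, h⟩
    · rintro ⟨y, h⟩; exact ⟨y 0, Fin.tail y, by rwa [Fin.cons_self_tail y]⟩

theorem Dfn.ex {U : Type} [Finite U] {R : ∀ t : RTree Sig rank, (V → Pos t) → (U → Pos t) → Prop}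
    (H : Dfn K (fun t (ν : V ⊕ U → Pos t) => R t (fun v => ν (.inl v)) (fun i => ν (.inr i)))) :
    Dfn K (fun t ν => ∃ y, R t ν y) := by
  obtain ⟨n, ⟨e⟩⟩ := Finite.exists_equiv_fin U
  refine (Dfn.exFin (K := K) n (R := fun t ν y => R t ν (fun u => y (e u))) ?_).congr fun t ν => ?_
  · exact H.subst (Sum.elim Sum.inl (fun u => Sum.inr (e u)))
  · constructor
    · rintro ⟨y, h⟩; exact ⟨_, h⟩
    · rintro ⟨y, h⟩; exact ⟨fun i => y (e.symm i), by simpa using h⟩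

theorem updVec_apply {α : Type} {k : ℕ} (ν : ℕ → α) {xs : Fin k → ℕ} (hxs : Function.Injective xs) 
    (a : Fin k → α) (i : Fin k) : updVec ν xs a (xs i) = a i := by
  have h : ∃ j, xs j = xs i := ⟨i, rfl⟩
  rw [updVec, dif_pos h]
  congr 1
  exact hxs h.choose_spec

theorem updVec_none {α : Type} {k : ℕ} (ν : ℕ → α) {xs : Fin k → ℕ}  
    (a : Fin k → α) (n : ℕ) (h : ∀ i, xs i ≠ n) : updVec ν xs a n = ν n := by
  rw [updVec, dif_neg]
  rintro ⟨i, hi⟩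
  exact h i hi

theorem triv_form (l : List ℕ) : ∃ ψ : TForm Sig rank K, WF ψ ∧ freeVars ψ = {x | x ∈ l} ∧ 
    ∀ t ν, Sat t ψ ν := by
  induction l with
  | nil => exact ⟨.ex 0 (.eq 0 0), trivial, by simp [freeVars], fun t ν => ⟨rootPos t, rfl⟩⟩
  | cons x l ih => 
    obtain ⟨ψ, h1, h2, h3⟩ := ih
    refine ⟨.and (.eq x x) ψ, ⟨trivial, h1⟩, ?_, fun t ν => ⟨rfl, h3 t ν⟩⟩
    ext y
    simp [freeVars, h2]

theorem Dfn.tcFin {E : ∀ t : RTree Sig rank, (V → Pos t) → (Fin K → Pos t) → (Fin K → Pos t) → Prop}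
    (H : Dfn K (fun t (ν : V ⊕ (Fin K ⊕ Fin K) → Pos t) => E t (fun v => ν (.inl v))
      (fun u => ν (.inr (.inl u))) (fun u => ν (.inr (.inr u))))) (x y : Fin K → V) :
    Dfn K (fun t ν => Relation.ReflTransGen (E t ν) (fun u => ν (x u)) (fun u => ν (y u))) := by
  intro f b hf
  obtain ⟨φ, h1, h2, h3⟩ := H (Sum.elim f (Sum.elim (fun i => b + i.1) (fun i => b + K + i.1))) (b + 2 * K) (by
    rintro (v | v | v)
    · have := hf v; simp; omega
    · have := v.2; simp; omega
    · have := v.2; simp; omega)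
  obtain ⟨ψ, g1, g2, g3⟩ := triv_form (Sig := Sig) (rank := rank) (K := K) (List.range' b (2 * K))
  have ix : Function.Injective (fun i : Fin K => b + i.1) := fun i j h => Fin.ext (by simpa using h)
  have iy : Function.Injective (fun i : Fin K => b + K + i.1) := fun i j h => Fin.ext (by simpa using h)
  have ne : ∀ i j : Fin K, b + i.1 ≠ b + K + j.1 := fun i j => by omega
  refine ⟨.tc (fun i => b + i.1) (fun i => b + K + i.1) (.and φ ψ) (fun i => f (x i)) (fun i => f (y i)),
    ⟨⟨ix, iy, ne⟩, ?_, h1, g1⟩, ?_, fun t ν => ?_⟩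
  · rintro n (⟨i, rfl⟩ | ⟨i, rfl⟩)
    · right; rw [g2]; simp only [Set.mem_ofPred_eq, List.mem_range'_1]; omega
    · right; rw [g2]; simp only [Set.mem_ofPred_eq, List.mem_range'_1]; omega
  · rintro n ((⟨hn | hn, hn2⟩ | ⟨i, rfl⟩) | ⟨i, rfl⟩)
    · obtain ⟨v | v | v, rfl⟩ := h2 hn
      · exact ⟨v, rfl⟩
      · exact absurd (Or.inl ⟨v, rfl⟩) hn2
      · exact absurd (Or.inr ⟨v, rfl⟩) hn2
    · rw [g2] at hn
      simp only [Set.mem_ofPred_eq, List.mem_range'_1] at hn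
      refine absurd ?_ hn2
      by_cases hh : n < b + K
      · exact Or.inl ⟨⟨n - b, by omega⟩, by simp; omega⟩
      · exact Or.inr ⟨⟨n - b - K, by omega⟩, by simp; omega⟩
    · exact ⟨_, rfl⟩
    · exact ⟨_, rfl⟩
  · have : (fun c c' : Fin K → Pos t => Sat t (.and φ ψ) (updVec (updVec ν (fun i => b + i.1) c) (fun i => b + K + i.1) c')) 
        = E t (fun v => ν (f v)) := by
      funext c c'
      apply propext
      refine (and_iff_left (g3 t _)).trans ((h3 t _).trans ?_)
      have e1 : ∀ v, updVec (updVec ν (fun i : Fin K => b + i.1) c) (fun i => b + K + i.1) c' (f v) = ν (f v) := by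
        intro v
        have := hf v
        rw [updVec_none _ _ _ (by intro i; omega), updVec_none _ _ _ (by intro i; omega)]
      have e2 : ∀ i : Fin K, updVec (updVec ν (fun i : Fin K => b + i.1) c) (fun i => b + K + i.1) c' (b + i.1) = c i := by
        intro i
        rw [updVec_none _ _ _ (by intro j; exact (ne i j).symm)]
        exact updVec_apply ν ix c i
      have e3 : ∀ i : Fin K, updVec (updVec ν (fun i : Fin K => b + i.1) c) (fun i => b + K + i.1) c' (b + K + i.1) = c' i :=
        fun i => updVec_apply _ iy c' i
      simp only [Sum.elim_inl, Sum.elim_inr, e1, e2, e3]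
    show Relation.ReflTransGen _ _ _ ↔ _
    rw [this]

theorem Dfn.tc {U : Type} (e : U ≃ Fin K) 
    {E : ∀ t : RTree Sig rank, (V → Pos t) → (U → Pos t) → (U → Pos t) → Prop}
    (H : Dfn K (fun t (ν : V ⊕ (U ⊕ U) → Pos t) => E t (fun v => ν (.inl v))
      (fun u => ν (.inr (.inl u))) (fun u => ν (.inr (.inr u))))) (x y : U → V) :
    Dfn K (fun t ν => Relation.ReflTransGen (E t ν) (fun u => ν (x u)) (fun u => ν (y u))) := by
  refine (Dfn.tcFin (K := K) (E := fun t ν a b => E t ν (fun u => a (e u)) (fun u => b (e u))) ?_ 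
    (fun i => x (e.symm i)) (fun i => y (e.symm i))).congr fun t ν => ?_
  · exact H.subst (Sum.elim Sum.inl (Sum.elim (fun u => Sum.inr (Sum.inl (e u))) (fun u => Sum.inr (Sum.inr (e u)))))
  · constructor
    · intro h
      have := Relation.ReflTransGen.lift (p := E t ν) (fun a : Fin K → Pos t => fun u => a (e u)) 
        (fun _ _ h => h) _ _ h
      simp only [Function.onFun, Equiv.symm_apply_apply] at this
      exact this
    · intro h
      exact Relation.ReflTransGen.lift (p := fun a b => E t ν (fun u => a (e u)) (fun u => b (e u)))
        (fun a : U → Pos t => fun i => a (e.symm i)) (fun a b h => by simpa [Function.onFun] using h) _ _ h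

theorem Dfn.toFOTC {R : ∀ t : RTree Sig rank, (Empty → Pos t) → Prop} (H : Dfn K R) : 
    {t | R t (fun v => v.elim)} ∈ FOTC Sig rank K := by
  obtain ⟨φ, h1, h2, h3⟩ := H (fun v => v.elim) 0 (fun v => v.elim)
  refine ⟨φ, h1, Set.eq_empty_of_forall_notMem fun n hn => by
    obtain ⟨v, _⟩ := h2 hn
    exact v.elim, ?_⟩
  ext t
  show R t _ ↔ Sat t φ _
  rw [h3]
  have : (fun v : Empty => rootPos t) = fun v => v.elim := funext fun v => v.elim
  rw [this]

theorem Dfn.root (v : V) : 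
    Dfn K (fun (t : RTree Sig rank) (ν : V → Pos t) => ν v = rootPos t) := by
  have : Dfn K (fun (t : RTree Sig rank) (ν : V → Pos t) => ¬ ∃ y : Pos t, ¬ (ν v).1 <+: y.1) :=
    Dfn.not (Dfn.ex1 (Dfn.not (Dfn.le (Sum.inl v) (Sum.inr ()))))
  refine this.congr fun t ν => ?_
  push Not
  constructor
  · intro h; exact pos_ext (List.prefix_nil.1 (h (rootPos t)))
  · intro h y; rw [h]; exact ⟨y.1, rfl⟩

theorem Dfn.up [Fintype Sig] (v w : V) : 
    Dfn K (fun (t : RTree Sig rank) (ν : V → Pos t) => ∃ j : ℕ, (ν w).1 = (ν v).1 ++ [j]) := by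
  refine (Dfn.finEx (ι := Fin (maxRank Sig rank)) fun j => Dfn.edg j.1 v w).congr fun t ν => ?_
  constructor
  · rintro ⟨j, h⟩; exact ⟨_, h⟩
  · rintro ⟨j, h⟩
    have hw : IsPos t (ν w).1 := (ν w).2
    rw [h] at hw
    exact ⟨⟨j, isPos_lt hw⟩, h⟩

theorem Dfn.chno (v : V) (j : ℕ) : 
    Dfn K (fun (t : RTree Sig rank) (ν : V → Pos t) => childNo (ν v).1 = j) := by
  cases j with
  | zero => exact (Dfn.root v).congr fun t ν => childNo_root_iff.symm
  | succ j => 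
    have : Dfn K (fun (t : RTree Sig rank) (ν : V → Pos t) => ∃ z : Pos t, (ν v).1 = z.1 ++ [j]) :=
      Dfn.ex1 (Dfn.edg j (Sum.inr ()) (Sum.inl v))
    refine this.congr fun t ν => ?_
    rw [childNo_eq_succ]
    constructor
    · rintro ⟨z, h⟩; exact ⟨_, h⟩
    · rintro ⟨q, h⟩
      have hw : IsPos t (ν v).1 := (ν v).2
      rw [h] at hw
      exact ⟨mkPos t q (isPos_left hw), h⟩

end Definable
end NestedPebbles

namespace NestedPebbles

section Encode
variable {Sig : Type} {rank : Sig → ℕ} {V W : Type} {K : ℕ}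

theorem Dfn.stackEq {X : Type} (L L' : List (X × V)) : 
    Dfn K (fun (t : RTree Sig rank) (ν : V → Pos t) => 
      L.map (fun p => (p.1, ν p.2)) = L'.map (fun p => (p.1, ν p.2))) := by
  induction L generalizing L' with
  | nil => exact (Dfn.const (L' = [])).congr fun t ν => by cases L' <;> simp
  | cons p L ih => 
    cases L' with
    | nil => exact (Dfn.const False).congr fun t ν => by simp
    | cons p' L' => 
      exact (Dfn.and (Dfn.and (Dfn.const (p.1 = p'.1)) (Dfn.eq p.2 p'.2)) (ih L')).congr fun t ν => by simp

theorem Dfn.stackMem {X : Type} (L : List (X × V)) (x : X) (v : V) : 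
    Dfn K (fun (t : RTree Sig rank) (ν : V → Pos t) => (x, ν v) ∈ L.map (fun p => (p.1, ν p.2))) := by
  induction L with
  | nil => exact (Dfn.const False).congr fun t ν => by simp
  | cons p L ih => 
    exact (Dfn.or (Dfn.and (Dfn.const (x = p.1)) (Dfn.eq v p.2)) ih).congr fun t ν => by simp

theorem Dfn.headsEq {k : ℕ} (h h' : Fin k → V) : 
    Dfn K (fun (t : RTree Sig rank) (ν : V → Pos t) => (fun i => ν (h i)) = (fun i => ν (h' i))) := 
  (Dfn.finAll fun i => Dfn.eq (h i) (h' i)).congr fun t ν => funext_iff.symm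

theorem Dfn.others {k : ℕ} (h h' : Fin k → V) (i : Fin k) : 
    Dfn K (fun (t : RTree Sig rank) (ν : V → Pos t) => ∀ j, j ≠ i → ν (h j) = ν (h' j)) := 
  (Dfn.finAll fun j => Dfn.or (Dfn.const (j = i)) (Dfn.eq (h j) (h' j))).congr fun t ν => by 
    refine forall_congr' fun j => ?_
    tauto

theorem Dfn.instr [Fintype Sig] {k : ℕ} {X : Type} (ins : TInstr Sig k X) (h h' : Fin k → V) (L L' : List (X × V)) :
    Dfn K (fun (t : RTree Sig rank) (ν : V → Pos t) => 
      instrStep t ins (fun i => ν (h i)) (L.map (fun p => (p.1, ν p.2))) 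
        (fun i => ν (h' i)) (L'.map (fun p => (p.1, ν p.2)))) := by
  cases ins with
  | up i => exact Dfn.and (Dfn.stackEq L' L) (Dfn.and (Dfn.up (h' i) (h i)) (Dfn.others h' h i))
  | down i j => 
    exact Dfn.and (Dfn.stackEq L' L) (Dfn.and (Dfn.const _) (Dfn.and (Dfn.edg (j - 1) (h i) (h' i)) (Dfn.others h' h i)))
  | dropPeb i x => 
    refine Dfn.and (Dfn.headsEq h' h) (Dfn.and (Dfn.stackEq L' ((x, h i) :: L)) ?_)
    refine (Dfn.const (x ∉ L.map Prod.fst)).congr fun t ν => ?_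
    simp
  | retrieve x => 
    refine Dfn.and (Dfn.headsEq h' h) ?_
    cases L with
    | nil => exact (Dfn.const False).congr fun t ν => by simp
    | cons p L => 
      exact (Dfn.and (Dfn.const (p.1 = x)) (Dfn.stackEq L L')).congr fun t ν => by simp
  | test b τ => 
    refine Dfn.and (Dfn.headsEq h' h) (Dfn.and (Dfn.stackEq L' L) ?_)
    have key : Dfn K (fun (t : RTree Sig rank) (ν : V → Pos t) => 
        testHolds t τ (fun i => ν (h i)) (L.map (fun p => (p.1, ν p.2)))) := by
      cases τ with
      | lab i a => exact Dfn.lab _ _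
      | peb i x => exact Dfn.stackMem L x (h i)
      | chno i j => exact Dfn.chno _ _
    cases b with
    | true => exact key.congr fun t ν => by simp
    | false => exact key.not.congr fun t ν => by simp

variable {k : ℕ} (A : TWA Sig rank k)

/-- Lists of pebbles without repetition. -/
abbrev PL : Type := {l : List A.X // l.Nodup}

/-- Variables encoding a configuration: heads, pebbles and a mark for the control. -/
abbrev CV : Type := (Fin k ⊕ A.X) ⊕ (A.Q × PL A)

/-- The control part of an encoded configuration. -/
def StIs {t : RTree Sig rank} (c : CV A → Pos t) (q : A.Q × PL A) : Prop :=
  c (Sum.inr q) ≠ rootPos t ∧ ∀ q', q' ≠ q → c (Sum.inr q') = rootPos t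

/-- The encoded pebble stack. -/
def encSt (l : PL A) : List (A.X × CV A) := l.1.map fun x => (x, Sum.inl (Sum.inr x))

/-- The tuple `c` represents the configuration `C`. -/
def Rep {t : RTree Sig rank} (c : CV A → Pos t) (C : TConf A t) : Prop :=
  ∃ l : PL A, StIs A c (C.1, l) ∧ (fun i => c (Sum.inl (Sum.inl i))) = C.2.1 ∧ 
    (encSt A l).map (fun p => (p.1, c p.2)) = C.2.2

/-- The step relation on encoded configurations. -/
def EStep {t : RTree Sig rank} (c c' : CV A → Pos t) : Prop :=
  ∃ (i : A.instr) (l l' : PL A), StIs A c (i.1.1, l) ∧ StIs A c' (i.1.2.2, l') ∧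
    instrStep t i.1.2.1 (fun i => c (Sum.inl (Sum.inl i))) ((encSt A l).map (fun p => (p.1, c p.2)))
      (fun i => c' (Sum.inl (Sum.inl i))) ((encSt A l').map (fun p => (p.1, c' p.2)))

theorem EStep_iff {t : RTree Sig rank} {c c' : CV A → Pos t} : 
    EStep A c c' ↔ ∃ C C', Rep A c C ∧ Rep A c' C' ∧ Step A t C C' := by
  constructor
  · rintro ⟨⟨⟨p, ins, q⟩, hi⟩, l, l', h1, h2, h3⟩
    exact ⟨(p, _, _), (q, _, _), ⟨l, h1, rfl, rfl⟩, ⟨l', h2, rfl, rfl⟩, ins, hi, h3⟩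
  · rintro ⟨⟨p, hs, π⟩, ⟨q, hs', π'⟩, ⟨l, h1, h2, h3⟩, ⟨l', h1', h2', h3'⟩, ins, hi, hh⟩
    simp only at h2 h3 h2' h3' hh
    subst h2 h3 h2' h3'
    exact ⟨⟨(p, ins, q), hi⟩, l, l', h1, h1', hh⟩

theorem Rep.unique {t : RTree Sig rank} {c : CV A → Pos t} {C C' : TConf A t} (h : Rep A c C)
    (h' : Rep A c C') : C = C' := by
  obtain ⟨p, hs, π⟩ := C
  obtain ⟨q, hs', π'⟩ := C'
  obtain ⟨l, h1, h2, h3⟩ := h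
  obtain ⟨l', h1', h2', h3'⟩ := h'
  have : (p, l) = (q, l') := by
    by_contra hne
    exact h1.1 (h1'.2 _ hne)
  simp only [Prod.mk.injEq] at this
  obtain ⟨rfl, rfl⟩ := this
  simp only at h2 h3 h2' h3'
  subst h2 h3 h2' h3'
  rfl

theorem Rep.exists {t : RTree Sig rank} (w : Pos t) (hw : w ≠ rootPos t) (C : TConf A t) 
    (hC : (C.2.2.map Prod.fst).Nodup) : ∃ c, Rep A c C := by
  classical
  obtain ⟨q, hs, π⟩ := C
  simp only at hC
  let pp : A.X → Pos t := fun x => if h : ∃ w, (x, w) ∈ π then h.choose else rootPos t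
  let c : CV A → Pos t := Sum.elim (Sum.elim hs pp) 
    (fun q' => if q' = (q, ⟨π.map Prod.fst, hC⟩) then w else rootPos t)
  refine ⟨c, ⟨π.map Prod.fst, hC⟩, ⟨by simpa [c] using hw, fun q' hq' => by simp [c, hq']⟩, rfl, ?_⟩
  simp only [encSt, List.map_map]
  conv_rhs => rw [← List.map_id π]
  apply List.map_congr_left
  rintro ⟨x, v⟩ hx
  have hex : ∃ w, (x, w) ∈ π := ⟨v, hx⟩
  have : pp x = v := by
    simp only [pp, dif_pos hex]
    have := List.inj_on_of_nodup_map hC hex.choose_spec hx rfl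
    simpa using this
  simp [c, this]

theorem Step.nodup {t : RTree Sig rank} {C C' : TConf A t} (h : Step A t C C') 
    (hC : (C.2.2.map Prod.fst).Nodup) : (C'.2.2.map Prod.fst).Nodup := by
  obtain ⟨ins, _, h⟩ := h
  cases ins with
  | up i => rw [h.1]; exact hC
  | down i j => rw [h.1]; exact hC
  | dropPeb i x => 
    rw [h.2.1, List.map_cons, List.nodup_cons]
    refine ⟨?_, hC⟩
    simpa using h.2.2
  | retrieve x => 
    obtain ⟨_, w, hw⟩ := h
    rw [hw, List.map_cons, List.nodup_cons] at hC
    exact hC.2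
  | test b τ => rw [h.2.1]; exact hC

theorem rep_forward {t : RTree Sig rank} (w : Pos t) (hw : w ≠ rootPos t) {C C' : TConf A t} 
    (hC : (C.2.2.map Prod.fst).Nodup) (h : Relation.ReflTransGen (Step A t) C C') 
    {c : CV A → Pos t} (hc : Rep A c C) : 
    (C'.2.2.map Prod.fst).Nodup ∧ ∃ c', Rep A c' C' ∧ Relation.ReflTransGen (EStep A) c c' := by
  induction h with
  | refl => exact ⟨hC, c, hc, .refl⟩
  | tail _ hs ih => 
    obtain ⟨h1, c', h2, h3⟩ := ih
    have h4 := Step.nodup A hs h1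
    obtain ⟨c'', h5⟩ := Rep.exists A w hw _ h4
    exact ⟨h4, c'', h5, h3.tail ((EStep_iff A).2 ⟨_, _, h2, h5, hs⟩)⟩

theorem rep_backward {t : RTree Sig rank} {C : TConf A t} {c c' : CV A → Pos t} (hc : Rep A c C)
    (h : Relation.ReflTransGen (EStep A) c c') : 
    ∃ C', Rep A c' C' ∧ Relation.ReflTransGen (Step A t) C C' := by
  induction h with
  | refl => exact ⟨C, hc, .refl⟩
  | tail _ hs ih => 
    obtain ⟨C', h1, h2⟩ := ih
    obtain ⟨D, D', h3, h4, h5⟩ := (EStep_iff A).1 hs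
    rw [Rep.unique A h3 h1] at h5
    exact ⟨D', h4, h2.tail h5⟩

/-- Acceptance in terms of encoded configurations. -/
def EAcc (t : RTree Sig rank) : Prop := 
  ∃ c : CV A → Pos t, Rep A c (initConf A t) ∧ ∃ c' : CV A → Pos t, Relation.ReflTransGen (EStep A) c c' ∧ 
    (∃ q : A.acc, Rep A c' (q.1, fun _ => rootPos t, [])) ∧ ¬ ∃ c'' : CV A → Pos t, EStep A c' c''

theorem EAcc_sound {t : RTree Sig rank} (h : EAcc A t) : Accepts A t := by
  obtain ⟨c, h1, c', h2, ⟨⟨q, hq⟩, h3⟩, h4⟩ := h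
  obtain ⟨C', h5, h6⟩ := rep_backward A h1 h2
  rw [Rep.unique A h5 h3] at h6
  refine ⟨q, hq, h6, fun D hD => h4 ?_⟩
  obtain ⟨l, hl, _⟩ := h3
  obtain ⟨c'', hc''⟩ := Rep.exists A _ hl.1 D (Step.nodup A hD (by simp))
  exact ⟨c'', (EStep_iff A).2 ⟨_, _, ⟨l, hl, by assumption⟩, hc'', hD⟩⟩

theorem EAcc_complete {t : RTree Sig rank} (w : Pos t) (hw : w ≠ rootPos t) (h : Accepts A t) : EAcc A t := by
  obtain ⟨q, hq, h1, h2⟩ := h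
  have hn : ((initConf A t).2.2.map Prod.fst).Nodup := by simp [initConf]
  obtain ⟨c, hc⟩ := Rep.exists A w hw (initConf A t) hn
  obtain ⟨_, c', h3, h4⟩ := rep_forward A w hw hn h1 hc
  refine ⟨c, hc, c', h4, ⟨⟨q, hq⟩, h3⟩, ?_⟩
  rintro ⟨c'', h5⟩
  obtain ⟨D, D', h6, h7, h8⟩ := (EStep_iff A).1 h5
  rw [Rep.unique A h6 h3] at h8
  exact h2 _ h8

theorem accepts_iff {t : RTree Sig rank} : Accepts A t ↔ 
    (∃ a : {a : Sig // rank a = 0 ∧ ∃ ch, Accepts A (RTree.node a ch)}, labelAt t (rootPos t).1 = some a.1) ∨ EAcc A t := by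
  constructor
  · intro h
    by_cases hw : ∃ w, w ≠ rootPos t
    · obtain ⟨w, hw⟩ := hw
      exact Or.inr (EAcc_complete A w hw h)
    · left
      obtain ⟨a, ch⟩ := t
      refine ⟨⟨a, ?_, ch, h⟩, rfl⟩
      by_contra hr
      apply hw
      have : IsPos (RTree.node a ch) ([] ++ [0]) := isPos_snoc_lab.2 ⟨a, rfl, Nat.pos_of_ne_zero hr⟩
      refine ⟨mkPos _ _ this, fun h => ?_⟩
      have := congrArg Subtype.val h
      simp [mkPos, rootPos] at this
  · rintro (⟨⟨a, h0, ch, h⟩, ha⟩ | h)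
    · obtain ⟨a', ch'⟩ := t
      have : a' = a := Option.some.inj ha
      subst this
      have : ch' = ch := by
        funext i
        have := i.2
        omega
      rwa [this]
    · exact EAcc_sound A h

theorem NPTWA_FOTC [Fintype Sig] {k : ℕ} {L : Set (RTree Sig rank)} (hL : L ∈ NPTWA Sig rank k) : 
    ∃ k, 1 ≤ k ∧ L ∈ FOTC Sig rank k := by
  classical
  obtain ⟨A, rfl⟩ := hL
  have := A.finQ
  have := A.finX
  have : Finite A.instr := A.instrFin
  let K := Fintype.card (CV A)
  let e : CV A ≃ Fin K := Fintype.equivFin _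
  refine ⟨K, Fintype.card_pos_iff.2 ⟨Sum.inr (A.q0, ⟨[], List.nodup_nil⟩)⟩, ?_⟩
  have hSt : ∀ {V : Type} (c : CV A → V) (q : A.Q × PL A), 
      Dfn K (fun (t : RTree Sig rank) (ν : V → Pos t) => StIs A (fun u => ν (c u)) q) := by
    intro V c q
    refine Dfn.and (Dfn.not (Dfn.root _)) (Dfn.finAll fun q' => ?_)
    refine (Dfn.or (Dfn.const (q' = q)) (Dfn.root (c (Sum.inr q')))).congr fun t ν => ?_
    tauto
  have hE : ∀ {V : Type} (c c' : CV A → V), 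
      Dfn K (fun (t : RTree Sig rank) (ν : V → Pos t) => EStep A (fun u => ν (c u)) (fun u => ν (c' u))) := by
    intro V c c'
    refine Dfn.finEx fun i => Dfn.finEx fun l => Dfn.finEx fun l' => 
      Dfn.and (hSt c _) (Dfn.and (hSt c' _) ?_)
    refine (Dfn.instr i.1.2.1 (fun j => c (Sum.inl (Sum.inl j))) (fun j => c' (Sum.inl (Sum.inl j))) 
      ((encSt A l).map (fun p => (p.1, c p.2))) ((encSt A l').map (fun p => (p.1, c' p.2)))).congr fun t ν => ?_
    simp only [List.map_map, Function.comp_def]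
  have hR : ∀ {V : Type} (c : CV A → V) (q : A.Q), Dfn K (fun (t : RTree Sig rank) (ν : V → Pos t) => 
      Rep A (fun u => ν (c u)) (q, fun _ => rootPos t, [])) := by
    intro V c q
    refine Dfn.finEx fun l => Dfn.and (hSt c (q, l)) (Dfn.and ?_ ?_)
    · refine (Dfn.finAll fun i => Dfn.root (c (Sum.inl (Sum.inl i)))).congr fun t ν => ?_
      exact funext_iff.symm
    · refine (Dfn.const (encSt A l = [])).congr fun t ν => ?_
      simp
  have key : Dfn K (fun (t : RTree Sig rank) (_ : Empty → Pos t) => 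
      (∃ a : {a : Sig // rank a = 0 ∧ ∃ ch, Accepts A (RTree.node a ch)}, 
        labelAt t (rootPos t).1 = some a.1) ∨ EAcc A t) := by
    refine Dfn.or (Dfn.finEx fun a => ?_) ?_
    · have : Dfn K (fun (t : RTree Sig rank) (_ : Empty → Pos t) => 
          ∃ x : Pos t, x = rootPos t ∧ labelAt t x.1 = some a.1) := 
        Dfn.ex1 (Dfn.and (Dfn.root (Sum.inr ())) (Dfn.lab (Sum.inr ()) a.1))
      exact this.congr fun t ν => by simp
    · refine Dfn.ex (Dfn.and (hR (fun u => Sum.inr u) A.q0) (Dfn.ex (Dfn.and ?_ (Dfn.and ?_ (Dfn.not (Dfn.ex ?_))))))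
      · exact Dfn.tc e (E := fun t _ a b => EStep A a b) (hE _ _) (fun u => Sum.inl (Sum.inr u)) (fun u => Sum.inr u)
      · exact Dfn.finEx fun q => hR (fun u => Sum.inr u) q.1
      · exact hE (fun u => Sum.inl (Sum.inr u)) (fun u => Sum.inr u)
  have := key.toFOTC
  convert this using 1
  ext t
  exact accepts_iff A

end Encode

theorem union_NPTWA_closed_compl (Sig : Type) [Fintype Sig] (rank : Sig → ℕ) :
    (∀ L ∈ {L | ∃ k, 1 ≤ k ∧ L ∈ NPTWA Sig rank k},
      Lᶜ ∈ {L | ∃ k, 1 ≤ k ∧ L ∈ NPTWA Sig rank k}) ∧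
    {L | ∃ k, 1 ≤ k ∧ L ∈ NPTWA Sig rank k} =
      {L | ∃ k, 1 ≤ k ∧ L ∈ FOTC Sig rank k} ∧
    {L | ∃ k, 1 ≤ k ∧ L ∈ NPTWA Sig rank k} =
      {L | ∃ k, 1 ≤ k ∧ L ∈ NTWA Sig rank k} := by
  have h1 : ∀ {L : Set (RTree Sig rank)}, (∃ k, 1 ≤ k ∧ L ∈ NTWA Sig rank k) → 
      ∃ k, 1 ≤ k ∧ L ∈ NPTWA Sig rank k := by
    rintro L ⟨k, hk, A, _, rfl⟩
    exact ⟨k, hk, A, rfl⟩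
  refine ⟨?_, ?_, ?_⟩
  · rintro L ⟨k, _, hL⟩
    obtain ⟨k', _, h⟩ := NPTWA_FOTC hL
    exact h1 (FOTC_NTWA h).2
  · ext L
    constructor
    · rintro ⟨k, _, hL⟩
      exact NPTWA_FOTC hL
    · rintro ⟨k, _, hL⟩
      exact h1 (FOTC_NTWA hL).1
  · ext L
    constructor
    · rintro ⟨k, _, hL⟩
      obtain ⟨k', _, h⟩ := NPTWA_FOTC hL
      exact (FOTC_NTWA h).1
    · exact h1

end NestedPebbles
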